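/- arXiv:2002.09590 — 9 statements merged into one kernel-verified Lean document; each statement's English description precedes it below -/
import Mathlib

section
/- For every real λ ∈ [−1,1] and every θ ∈ ℂ with |θ| < π/4, one has cosh(2θ) ≠ 0 and 1 − λ·tanh(2θ) ≠ 0, and the map θ ↦ F_θ(λ) = (λ − tanh(2θ))/(1 − λ·tanh(2θ)) is holomorphic (complex differentiable) on the open disk D_{π/4}(0) = {θ ∈ ℂ : |θ| < π/4}. -/
theorem cosh_sub_mul_sinh_ne_zero (t : ℝ) (ht : t ∈ Set.Icc (-1 : ℝ) 1) (θ : ℂ)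
    (hθ : ‖θ‖ < Real.pi / 4) :
    Complex.cosh (2 * θ) - (t : ℂ) * Complex.sinh (2 * θ) ≠ 0 := by
  intro h
  obtain ⟨h1, h2⟩ := ht
  have him := abs_lt.mp ((Complex.abs_im_le_norm θ).trans_lt hθ)
  have hcos : 0 < Real.cos (2 * θ.im) :=
    Real.cos_pos_of_mem_Ioo ⟨by linarith [him.1], by linarith [him.2]⟩
  have e : ((1 - t : ℝ) : ℂ) * Complex.exp (2 * θ) + ((1 + t : ℝ) : ℂ) * Complex.exp (-(2 * θ)) = 0 := by
    rw [Complex.cosh, Complex.sinh] at h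
    push_cast
    linear_combination 2 * h
  have hre := congrArg Complex.re e
  rw [Complex.add_re, Complex.re_ofReal_mul, Complex.re_ofReal_mul, Complex.exp_re,
    Complex.exp_re] at hre
  simp only [Complex.neg_re, Complex.neg_im, Real.cos_neg, Complex.zero_re] at hre
  have i2 : (2 * θ).im = 2 * θ.im := by simp
  rw [i2] at hre
  have hp := Real.exp_pos (2 * θ).re
  have hq := Real.exp_pos (-(2 * θ).re)
  have hs : 0 < (1 - t) * Real.exp (2 * θ).re + (1 + t) * Real.exp (-(2 * θ).re) := by
    rcases le_total t 0 with h0 | h0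
    · have := mul_pos (show 0 < 1 - t by linarith) hp
      have := mul_nonneg (show 0 ≤ 1 + t by linarith) hq.le
      linarith
    · have := mul_nonneg (show 0 ≤ 1 - t by linarith) hp.le
      have := mul_pos (show 0 < 1 + t by linarith) hq
      linarith
  have := mul_pos hs hcos
  linarith

theorem Ftheta_nonvanishing (t : ℝ) (ht : t ∈ Set.Icc (-1 : ℝ) 1) (θ : ℂ)
    (hθ : ‖θ‖ < Real.pi / 4) :
    Complex.cosh (2 * θ) ≠ 0 ∧ 1 - (t : ℂ) * Complex.tanh (2 * θ) ≠ 0 := by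
  have hc : Complex.cosh (2 * θ) ≠ 0 := by
    simpa using cosh_sub_mul_sinh_ne_zero 0 ⟨by norm_num, by norm_num⟩ θ hθ
  refine ⟨hc, fun h => cosh_sub_mul_sinh_ne_zero t ht θ hθ ?_⟩
  rw [Complex.tanh_eq_sinh_div_cosh] at h
  field_simp at h
  simpa using h

/-- For every real `λ ∈ [−1,1]` and every `θ ∈ ℂ` with `|θ| < π/4`,
one has `cosh(2θ) ≠ 0` and `1 − λ·tanh(2θ) ≠ 0`, and the map
`θ ↦ F_θ(λ) = (λ − tanh(2θ))/(1 − λ·tanh(2θ))` is holomorphic on the disk `D_{π/4}(0)`. -/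
theorem Ftheta_holomorphic_in_theta :
    (∀ t : ℝ, t ∈ Set.Icc (-1 : ℝ) 1 → ∀ θ : ℂ, ‖θ‖ < Real.pi / 4 →
      Complex.cosh (2 * θ) ≠ 0 ∧ 1 - (t : ℂ) * Complex.tanh (2 * θ) ≠ 0) ∧
    (∀ t : ℝ, t ∈ Set.Icc (-1 : ℝ) 1 →
      DifferentiableOn ℂ
        (fun θ : ℂ => ((t : ℂ) - Complex.tanh (2 * θ)) / (1 - (t : ℂ) * Complex.tanh (2 * θ)))
        (Metric.ball (0 : ℂ) (Real.pi / 4))) := by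
  refine ⟨Ftheta_nonvanishing, fun t ht θ hθ => ?_⟩
  obtain ⟨hc, hd⟩ := Ftheta_nonvanishing t ht θ (by simpa using hθ)
  have htanh : DifferentiableAt ℂ (fun θ : ℂ => Complex.tanh (2 * θ)) θ := by
    simp only [Complex.tanh_eq_sinh_div_cosh]
    exact DifferentiableAt.fun_div (by fun_prop) (by fun_prop) hc
  exact (DifferentiableAt.fun_div (htanh.const_sub _) ((htanh.const_mul _).const_sub _) hd).differentiableWithinAt
end

section
/- Let θ₁, θ₂ ∈ ℂ with |θ₁| < π/8, |θ₂| < π/8 and Im(θ₁) = Im(θ₂). Then S_{θ₁} = S_{θ₂}, i.e. the curve S_θ ⊆ ℂ does not depend on the choice of Re(θ). -/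
/-- The homographic transformation `F_θ(λ) = (λ − tanh(2θ))/(1 − λ·tanh(2θ))`. -/
noncomputable def Ftheta (θ l : ℂ) : ℂ :=
  (l - Complex.tanh (2 * θ)) / (1 - l * Complex.tanh (2 * θ))

/-- The curve `S_θ = {2 − 2·F_θ(t) : t ∈ [−1,1]}`, the spectrum of the complex-scaled
free operator `Ĥ₀(θ)`. -/
noncomputable def Scurve (θ : ℂ) : Set ℂ :=
  {z : ℂ | ∃ t : ℝ, t ∈ Set.Icc (-1 : ℝ) 1 ∧ z = 2 - 2 * Ftheta θ (t : ℂ)}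


lemma cosh_two_ne (θ : ℂ) (h : ‖θ‖ < Real.pi / 8) : Complex.cosh (2 * θ) ≠ 0 := by
  intro h0
  have h1 : Complex.cos (2 * θ * Complex.I) = 0 := by rw [Complex.cos_mul_I, h0]
  have h2 : (Complex.cos (2 * θ * Complex.I)).re = 0 := by rw [h1]; rfl
  rw [Complex.cos_eq] at h2
  have him := (abs_le.mp (Complex.abs_im_le_norm θ))
  have hp := Real.pi_pos
  have hc : 0 < Real.cos (-(2 * θ.im)) := by
    apply Real.cos_pos_of_mem_Ioo
    constructor <;> linarith [him.1, him.2]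
  have hr : (2 * θ * Complex.I).re = -(2 * θ.im) := by simp
  rw [hr, ← Complex.ofReal_cos, ← Complex.ofReal_cosh, ← Complex.ofReal_sin,
    ← Complex.ofReal_sinh] at h2
  have hch := Real.cosh_pos (2 * θ * Complex.I).im
  have h3 : Real.cos (-(2 * θ.im)) * Real.cosh (2 * θ * Complex.I).im = 0 := by
    rw [Complex.sub_re, Complex.re_mul_ofReal, Complex.ofReal_re, Complex.mul_I_re,
      Complex.im_mul_ofReal, Complex.ofReal_im] at h2
    linarith
  exact (mul_pos hc hch).ne' h3

lemma Ftheta_eq (θ l : ℂ) (h : Complex.cosh (2 * θ) ≠ 0) :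
    Ftheta θ l = (l * Complex.cosh (2 * θ) - Complex.sinh (2 * θ)) /
      (Complex.cosh (2 * θ) - l * Complex.sinh (2 * θ)) := by
  unfold Ftheta
  rw [← mul_div_mul_right _ _ h, Complex.tanh_eq_sinh_div_cosh]
  congr 1 <;> field_simp

lemma Scurve_sub (θ₁ θ₂ : ℂ)
    (hθ₁ : ‖θ₁‖ < Real.pi / 8) (hθ₂ : ‖θ₂‖ < Real.pi / 8)
    (him : θ₁.im = θ₂.im) :
    Scurve θ₁ ⊆ Scurve θ₂ := by
  rintro z ⟨t, ⟨ht1, ht2⟩, rfl⟩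
  obtain ⟨r, hr⟩ : ∃ r : ℝ, 2 * θ₁ = 2 * θ₂ + (r : ℂ) :=
    ⟨2 * (θ₁.re - θ₂.re), by apply Complex.ext <;> simp [him]; ring⟩
  have hp : 0 < Real.cosh r + Real.sinh r := by
    rw [Real.cosh_add_sinh]; exact Real.exp_pos _
  have hm : 0 < Real.cosh r - Real.sinh r := by
    rw [Real.cosh_sub_sinh]; exact Real.exp_pos _
  have hd : 0 < Real.cosh r - t * Real.sinh r := by
    by_cases h : 0 ≤ t
    · nlinarith [Real.cosh_pos r]
    · nlinarith [Real.cosh_pos r]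
  refine ⟨(t * Real.cosh r - Real.sinh r) / (Real.cosh r - t * Real.sinh r), ⟨?_, ?_⟩, ?_⟩
  · rw [le_div_iff₀ hd]; nlinarith
  · rw [div_le_iff₀ hd]; nlinarith
  · have hd' : (Complex.cosh r - t * Complex.sinh r : ℂ) ≠ 0 := by
      exact_mod_cast hd.ne'
    rw [Ftheta_eq _ _ (cosh_two_ne _ hθ₁), Ftheta_eq _ _ (cosh_two_ne _ hθ₂), hr,
      Complex.cosh_add, Complex.sinh_add]
    push_cast
    congr 2
    rw [← mul_div_mul_right (_ / _ * _ - _) _ hd']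
    have hx := div_mul_cancel₀ (t * Complex.cosh r - Complex.sinh r : ℂ) hd'
    congr 1
    · linear_combination (-Complex.cosh (2 * θ₂)) * hx
    · linear_combination Complex.sinh (2 * θ₂) * hx

/-- For `|θ₁|, |θ₂| < π/8` with `Im(θ₁) = Im(θ₂)`, one has
`S_{θ₁} = S_{θ₂}`: the curve `S_θ` does not depend on `Re(θ)`. -/
theorem Scurve_depends_only_on_im (θ₁ θ₂ : ℂ)
    (hθ₁ : ‖θ₁‖ < Real.pi / 8) (hθ₂ : ‖θ₂‖ < Real.pi / 8)
    (him : θ₁.im = θ₂.im) :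
    Scurve θ₁ = Scurve θ₂ :=
  Set.Subset.antisymm (Scurve_sub θ₁ θ₂ hθ₁ hθ₂ him) (Scurve_sub θ₂ θ₁ hθ₂ hθ₁ him.symm)
end

section
/- Let θ ∈ ℂ with |θ| < π/8 and Im(θ) > 0. Then every z ∈ S_θ satisfies Im(z) ≥ 0, and Im(z) > 0 unless z = 0 or z = 4. Symmetrically, if Im(θ) < 0, every z ∈ S_θ satisfies Im(z) ≤ 0, with Im(z) < 0 unless z = 0 or z = 4. -/
theorem aux_tanh_im (u : ℂ) (h1 : -(Real.pi / 2) < u.im) (h2 : u.im < Real.pi / 2) :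
    ∃ c : ℝ, 0 < c ∧ (Complex.tanh u).im = c * Real.sin u.im := by
  have hc : 0 < Real.cos u.im := Real.cos_pos_of_mem_Ioo ⟨h1, h2⟩
  have hcr : (Complex.cosh u).re = Real.cosh u.re * Real.cos u.im := by
    conv_lhs => rw [← Complex.re_add_im u, Complex.cosh_add, Complex.cosh_mul_I, Complex.sinh_mul_I]
    simp [Complex.cosh_ofReal_re, Complex.sinh_ofReal_re, Complex.cos_ofReal_re, Complex.sin_ofReal_re]
  have hci : (Complex.cosh u).im = Real.sinh u.re * Real.sin u.im := by
    conv_lhs => rw [← Complex.re_add_im u, Complex.cosh_add, Complex.cosh_mul_I, Complex.sinh_mul_I]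
    simp [Complex.cosh_ofReal_re, Complex.sinh_ofReal_re, Complex.cos_ofReal_re, Complex.sin_ofReal_re]
  have hsr : (Complex.sinh u).re = Real.sinh u.re * Real.cos u.im := by
    conv_lhs => rw [← Complex.re_add_im u, Complex.sinh_add, Complex.cosh_mul_I, Complex.sinh_mul_I]
    simp [Complex.cosh_ofReal_re, Complex.sinh_ofReal_re, Complex.cos_ofReal_re, Complex.sin_ofReal_re]
  have hsi : (Complex.sinh u).im = Real.cosh u.re * Real.sin u.im := by
    conv_lhs => rw [← Complex.re_add_im u, Complex.sinh_add, Complex.cosh_mul_I, Complex.sinh_mul_I]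
    simp [Complex.cosh_ofReal_re, Complex.sinh_ofReal_re, Complex.cos_ofReal_re, Complex.sin_ofReal_re]
  have hne : Complex.cosh u ≠ 0 := by
    intro h
    rw [h] at hcr
    have := mul_pos (Real.cosh_pos u.re) hc
    simp at hcr
    rcases hcr with h | h
    · exact (Real.cosh_pos u.re).ne' h
    · exact hc.ne' h
  have hn := Complex.normSq_pos.2 hne
  refine ⟨Real.cos u.im / Complex.normSq (Complex.cosh u), div_pos hc hn, ?_⟩
  rw [Complex.tanh_eq_sinh_div_cosh, Complex.div_im, hcr, hci, hsr, hsi]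
  have := Real.cosh_sq u.re
  field_simp
  rw [this]
  ring

theorem aux_curve (w : ℂ) (hw : w.im ≠ 0) (t : ℝ) (ht : t ∈ Set.Icc (-1 : ℝ) 1) (z : ℂ)
    (hz : z = 2 - 2 * (((t : ℂ) - w) / (1 - (t : ℂ) * w))) :
    ∃ k : ℝ, 0 ≤ k ∧ (z ≠ 0 → z ≠ 4 → 0 < k) ∧ z.im = k * w.im := by
  have hne : 1 - (t : ℂ) * w ≠ 0 := by
    intro h
    have h1 := congrArg Complex.im h
    have h2 := congrArg Complex.re h
    simp [hw] at h1 h2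
    simp [h1] at h2
  have hn := Complex.normSq_pos.2 hne
  refine ⟨2 * (1 - t ^ 2) / Complex.normSq (1 - (t : ℂ) * w), ?_, ?_, ?_⟩
  · have : 0 ≤ 1 - t ^ 2 := by nlinarith [ht.1, ht.2]
    positivity
  · intro h0 h4
    have h1 : t ≠ 1 := by
      rintro rfl
      apply h0
      rw [hz]
      push_cast at hne ⊢
      rw [one_mul] at hne ⊢
      rw [div_self hne]; ring
    have h2 : t ≠ -1 := by
      rintro rfl
      apply h4
      rw [hz]
      push_cast at hne ⊢
      have : (-1 - w) / (1 - -1 * w) = -1 := by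
        rw [div_eq_iff hne]; ring
      rw [this]; ring
    have h3 : t < 1 := lt_of_le_of_ne ht.2 h1
    have h4 : -1 < t := lt_of_le_of_ne ht.1 h2.symm
    have : 0 < 1 - t ^ 2 := by nlinarith
    positivity
  · have h : z.im = -2 * (((t : ℂ) - w) / (1 - (t : ℂ) * w)).im := by
      rw [hz]; simp
    rw [h, Complex.div_im]
    simp only [Complex.sub_im, Complex.sub_re, Complex.mul_re, Complex.mul_im, Complex.ofReal_re,
      Complex.ofReal_im, Complex.one_re, Complex.one_im]
    field_simp
    ring

/-- For `|θ| < π/8` with `Im(θ) > 0`, every `z ∈ S_θ` has `Im(z) ≥ 0`,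
with `Im(z) > 0` unless `z = 0` or `z = 4`; symmetrically for `Im(θ) < 0`. -/
theorem Scurve_in_half_plane (θ : ℂ) (hθ : ‖θ‖ < Real.pi / 8) :
    (0 < θ.im → ∀ z ∈ Scurve θ, 0 ≤ z.im ∧ (z ≠ 0 → z ≠ 4 → 0 < z.im)) ∧
    (θ.im < 0 → ∀ z ∈ Scurve θ, z.im ≤ 0 ∧ (z ≠ 0 → z ≠ 4 → z.im < 0)) := by
  have him := lt_of_le_of_lt (Complex.abs_im_le_norm θ) hθ
  rw [abs_lt] at him
  have hpi := Real.pi_pos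
  have e : (2 * θ).im = 2 * θ.im := by simp
  obtain ⟨c, hc, hw⟩ := aux_tanh_im (2 * θ) (by rw [e]; linarith) (by rw [e]; linarith)
  rw [e] at hw
  constructor
  · rintro h z ⟨t, ht, hz⟩
    have hs : 0 < (Complex.tanh (2 * θ)).im := by
      rw [hw]
      exact mul_pos hc (Real.sin_pos_of_pos_of_lt_pi (by linarith) (by linarith))
    obtain ⟨k, hk, hk', hzk⟩ := aux_curve _ hs.ne' t ht z hz
    rw [hzk]
    exact ⟨mul_nonneg hk hs.le, fun h0 h4 => mul_pos (hk' h0 h4) hs⟩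
  · rintro h z ⟨t, ht, hz⟩
    have hs : (Complex.tanh (2 * θ)).im < 0 := by
      rw [hw]
      exact mul_neg_of_pos_of_neg hc
        (Real.sin_neg_of_neg_of_neg_pi_lt (by linarith) (by linarith))
    obtain ⟨k, hk, hk', hzk⟩ := aux_curve _ hs.ne t ht z hz
    rw [hzk]
    exact ⟨mul_nonpos_of_nonneg_of_nonpos hk hs.le,
      fun h0 h4 => mul_neg_of_pos_of_neg (hk' h0 h4) hs⟩
end

section
/- Let θ ∈ ℂ with |θ| < π/8. (i) If Im(θ) ≠ 0, then there exist c ∈ ℂ and r > 0 such that |z − c| = r for every z ∈ S_θ (the curve lies on a circle), and moreover 0 ∈ S_θ and 4 ∈ S_θ. (ii) If Im(θ) = 0, then S_θ equals the real segment [0,4] viewed as a subset of ℂ. -/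
lemma tanh_im_ne (z : ℂ) (h0 : z.im ≠ 0) (h1 : |z.im| < Real.pi / 2) : (Complex.tanh z).im ≠ 0 := by
  obtain ⟨x, y⟩ := z
  simp only at h0 h1
  obtain ⟨h2, h3⟩ := abs_lt.mp h1
  have hc : 0 < Real.cos y := Real.cos_pos_of_mem_Ioo ⟨by linarith, h3⟩
  have hs : Real.sin y ≠ 0 := by
    intro h
    have := (Real.sin_eq_zero_iff_of_lt_of_lt (x := y) (by linarith [Real.pi_pos]) (by linarith [Real.pi_pos])).mp h
    exact h0 this
  have e : (⟨x, y⟩ : ℂ) = (x : ℂ) + (y : ℂ) * Complex.I := Complex.mk_eq_add_mul_I x y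
  have hS : Complex.sinh ⟨x, y⟩ = ⟨Real.sinh x * Real.cos y, Real.cosh x * Real.sin y⟩ := by
    rw [e, Complex.sinh_add, Complex.sinh_mul_I, Complex.cosh_mul_I]
    simp only [← Complex.ofReal_sinh, ← Complex.ofReal_cosh, ← Complex.ofReal_sin, ← Complex.ofReal_cos]
    apply Complex.ext <;> simp <;> first | rfl | (left; rfl)
  have hC : Complex.cosh ⟨x, y⟩ = ⟨Real.cosh x * Real.cos y, Real.sinh x * Real.sin y⟩ := by
    rw [e, Complex.cosh_add, Complex.sinh_mul_I, Complex.cosh_mul_I]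
    simp only [← Complex.ofReal_sinh, ← Complex.ofReal_cosh, ← Complex.ofReal_sin, ← Complex.ofReal_cos]
    apply Complex.ext <;> simp <;> first | rfl | (left; rfl)
  have hne : Complex.cosh ⟨x, y⟩ ≠ 0 := by
    intro h
    rw [hC] at h
    have := congrArg Complex.re h
    simp only [Complex.zero_re] at this
    have := mul_pos (Real.cosh_pos x) hc
    linarith
  have hn := Complex.normSq_pos.mpr hne
  rw [Complex.tanh_eq_sinh_div_cosh, Complex.div_im, ← sub_div]
  apply div_ne_zero _ hn.ne'
  rw [hS, hC]
  have : Real.cosh x * Real.sin y * (Real.cosh x * Real.cos y) - Real.sinh x * Real.cos y * (Real.sinh x * Real.sin y) = Real.sin y * Real.cos y := by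
    linear_combination (Real.sin y * Real.cos y) * Real.cosh_sq_sub_sinh_sq x
  simp only [this]
  exact mul_ne_zero hs hc.ne'

lemma circle_aux (w : ℂ) (hw : w.im ≠ 0) (t : ℝ) :
    ‖(2 - 2 * (((t : ℂ) - w) / (1 - t * w))) - (2 - 2 * (((1 - Complex.normSq w) / (2 * w.im) : ℝ) : ℂ) * Complex.I)‖
      = 2 * Real.sqrt (1 + ((1 - Complex.normSq w) / (2 * w.im)) ^ 2) := by
  have hd : (1 - (t : ℂ) * w) ≠ 0 := by
    intro h
    have h1 := congrArg Complex.re h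
    have h2 := congrArg Complex.im h
    simp at h1 h2
    rcases h2 with h2 | h2
    · simp [h2] at h1
    · exact hw h2
  set k : ℝ := (1 - Complex.normSq w) / (2 * w.im) with hk
  have hk' : k * (2 * w.im) = 1 - Complex.normSq w := by rw [hk]; field_simp
  clear_value k
  have e : (2 - 2 * (((t : ℂ) - w) / (1 - t * w))) - (2 - 2 * (k : ℂ) * Complex.I)
      = (-2 * ((t - w) - k * Complex.I * (1 - t * w))) / (1 - t * w) := by
    field_simp
    ring
  have hp := norm_pos_iff.mpr hd
  rw [e, norm_div, div_eq_iff hp.ne', ← sq_eq_sq₀ (norm_nonneg _) (by positivity)]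
  rw [mul_pow, mul_pow, Real.sq_sqrt (by positivity), Complex.sq_norm, Complex.sq_norm]
  obtain ⟨a, b⟩ := w
  simp [Complex.normSq_apply] at hk' ⊢
  linear_combination (4 * (1 - t ^ 2)) * hk'

/-- For `|θ| < π/8`: (i) if `Im(θ) ≠ 0`, the curve `S_θ` lies on a circle
and contains the points `0` and `4`; (ii) if `Im(θ) = 0`, then `S_θ = [0,4] ⊆ ℂ`. -/
theorem Scurve_arc_of_circle_or_segment (θ : ℂ) (hθ : ‖θ‖ < Real.pi / 8) :
    (θ.im ≠ 0 →
      (∃ (c : ℂ) (r : ℝ), 0 < r ∧ ∀ z ∈ Scurve θ, ‖z - c‖ = r) ∧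
      (0 : ℂ) ∈ Scurve θ ∧ (4 : ℂ) ∈ Scurve θ) ∧
    (θ.im = 0 → Scurve θ = {z : ℂ | ∃ t : ℝ, t ∈ Set.Icc (0 : ℝ) 4 ∧ z = (t : ℂ)}) := by
  constructor
  · intro hi
    have hw : (Complex.tanh (2 * θ)).im ≠ 0 := by
      apply tanh_im_ne
      · simpa using hi
      · have := Complex.abs_im_le_norm θ
        have h2 : (2 * θ).im = 2 * θ.im := by simp
        rw [h2, abs_mul, abs_two]
        linarith [Real.pi_pos]
    refine ⟨⟨2 - 2 * (((1 - Complex.normSq (Complex.tanh (2 * θ))) / (2 * (Complex.tanh (2 * θ)).im) : ℝ) : ℂ) * Complex.I, 2 * Real.sqrt (1 + ((1 - Complex.normSq (Complex.tanh (2 * θ))) / (2 * (Complex.tanh (2 * θ)).im)) ^ 2), by positivity, ?_⟩, ?_, ?_⟩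
    · rintro z ⟨t, -, rfl⟩
      exact circle_aux _ hw t
    · refine ⟨1, by simp, ?_⟩
      have : 1 - Complex.tanh (2 * θ) ≠ 0 := by
        intro h
        have := congrArg Complex.im h
        simp at this
        exact hw this
      simp [Ftheta, div_self this]
    · refine ⟨-1, by simp, ?_⟩
      have : 1 + Complex.tanh (2 * θ) ≠ 0 := by
        intro h
        have := congrArg Complex.im h
        simp at this
        exact hw this
      simp only [Ftheta]
      push_cast
      rw [show (-1 - Complex.tanh (2 * θ)) = -(1 + Complex.tanh (2 * θ)) by ring,
        show (1 - -1 * Complex.tanh (2 * θ)) = (1 + Complex.tanh (2 * θ)) by ring, neg_div, div_self this]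
      norm_num
  · intro hi
    obtain ⟨w, hw, h1, h2⟩ : ∃ w : ℝ, Complex.tanh (2 * θ) = w ∧ -1 < w ∧ w < 1 := by
      refine ⟨Real.tanh (2 * θ.re), ?_, Real.neg_one_lt_tanh _, Real.tanh_lt_one _⟩
      have : θ = (θ.re : ℂ) := Complex.ext (by simp) (by simpa using hi)
      rw [Complex.ofReal_tanh]
      push_cast
      rw [← this]
    ext z
    simp only [Scurve, Ftheta, hw, Set.mem_ofPred_eq, Set.mem_Icc]
    constructor
    · rintro ⟨t, ⟨ht1, ht2⟩, rfl⟩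
      have hd : 0 < 1 - t * w := by
        rcases ht1.eq_or_lt with h | h
        · rw [← h]; linarith
        · nlinarith [mul_pos (sub_pos.mpr h) (sub_pos.mpr h2), mul_nonneg (sub_nonneg.mpr ht2) (sub_pos.mpr h1).le]
      refine ⟨2 - 2 * ((t - w) / (1 - t * w)), ⟨?_, ?_⟩, by push_cast; rfl⟩
      · have : (t - w) / (1 - t * w) ≤ 1 := by rw [div_le_one hd]; nlinarith
        linarith
      · have : -1 ≤ (t - w) / (1 - t * w) := by rw [le_div_iff₀ hd]; nlinarith
        linarith
    · rintro ⟨u, ⟨hu1, hu2⟩, rfl⟩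
      obtain ⟨s, rfl⟩ : ∃ s, u = 2 - 2 * s := ⟨(2 - u) / 2, by ring⟩
      have hs1 : -1 ≤ s := by linarith
      have hs2 : s ≤ 1 := by linarith
      have hd : 0 < 1 + s * w := by
        rcases hs1.eq_or_lt with h | h
        · rw [← h]; linarith
        · nlinarith [mul_pos (sub_pos.mpr h) (sub_pos.mpr h1), mul_nonneg (sub_nonneg.mpr hs2) (sub_pos.mpr h2).le]
      refine ⟨(s + w) / (1 + s * w), ⟨?_, ?_⟩, ?_⟩
      · rw [le_div_iff₀ hd]; nlinarith
      · rw [div_le_one hd]; nlinarith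
      · have key : ((s + w) / (1 + s * w) - w) / (1 - (s + w) / (1 + s * w) * w) = s := by
          have hw2 : 0 < 1 - w ^ 2 := by nlinarith
          have e1 : (s + w) / (1 + s * w) - w = s * (1 - w ^ 2) / (1 + s * w) := by
            field_simp; ring
          have e2 : 1 - (s + w) / (1 + s * w) * w = (1 - w ^ 2) / (1 + s * w) := by
            field_simp; ring
          rw [e1, e2]
          field_simp
        conv_lhs => rw [← key]
        push_cast
        rfl
end

section
/- Let H be a complex Hilbert space, R > 0, and let f be a map from ℂ to the bounded linear operators on H which is holomorphic (complex differentiable) on the open disk D_R(0) = {θ ∈ ℂ : |θ| < R}. If f(t) is a compact operator for every real t with |t| < R, then f(θ) is a compact operator for every θ ∈ D_R(0). -/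
/-- Let `H` be a complex Hilbert space, `R > 0`, and
`f : ℂ → B(H)` holomorphic on the disk `D_R(0)`. If `f(t)` is compact for every real
`t` with `|t| < R`, then `f(θ)` is compact for every `θ ∈ D_R(0)`. -/
theorem compactness_propagates_by_holomorphy
    (H : Type*) [NormedAddCommGroup H] [InnerProductSpace ℂ H] [CompleteSpace H]
    (R : ℝ) (hR : 0 < R) (f : ℂ → H →L[ℂ] H)
    (hf : DifferentiableOn ℂ f (Metric.ball (0 : ℂ) R))
    (hc : ∀ t : ℝ, |t| < R → IsCompactOperator (f (t : ℂ))) :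
    ∀ θ : ℂ, ‖θ‖ < R → IsCompactOperator (f θ) := by
  intro θ hθ
  let K : Submodule ℂ (H →L[ℂ] H) := compactOperator (RingHom.id ℂ) H H
  have hKc : IsClosed (K : Set (H →L[ℂ] H)) := isClosed_setOfPred_isCompactOperator
  have hg : DifferentiableOn ℂ (fun z => K.mkQL (f z)) (Metric.ball (0 : ℂ) R) :=
    K.mkQL.differentiable.comp_differentiableOn hf
  have ha := hg.analyticOnNhd Metric.isOpen_ball
  have hfreq : ∃ᶠ z in nhdsWithin (0 : ℂ) {0}ᶜ, K.mkQL (f z) = 0 := by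
    have ht : Filter.Tendsto (fun t : ℝ => (t : ℂ)) (nhdsWithin 0 {0}ᶜ)
        (nhdsWithin (0 : ℂ) {0}ᶜ) := by
      refine tendsto_nhdsWithin_iff.2 ⟨?_, ?_⟩
      · have := Complex.continuous_ofReal.tendsto 0
        simp only [Complex.ofReal_zero] at this
        exact this.mono_left nhdsWithin_le_nhds
      · filter_upwards [self_mem_nhdsWithin] with t ht
        simpa using ht
    refine ht.frequently (Filter.Eventually.frequently ?_)
    filter_upwards [nhdsWithin_le_nhds (Metric.ball_mem_nhds (0 : ℝ) hR)] with t ht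
    have : f (t : ℂ) ∈ K := hc t (by simpa using ht)
    simpa using this
  have hz := ha.eqOn_zero_of_preconnected_of_frequently_eq_zero
    (convex_ball (0 : ℂ) R).isPreconnected (Metric.mem_ball_self hR) hfreq
  have h : K.mkQL (f θ) = 0 := hz (by simpa using hθ)
  have : f θ ∈ K := by simpa using h
  exact this
end

section
/- Let γ > 0 and let D_γ be the bounded operator on ℓ²(ℤ) given by (D_γ x)(n) = e^{−(γ/2)|n|} x(n). Then there exists ε₀ with 0 < ε₀ ≤ γ/8 and a map G from the punctured disk D*_{ε₀}(0) = {λ ∈ ℂ : 0 < |λ| < ε₀} to B(ℓ²(ℤ)) such that: (i) G is holomorphic on D*_{ε₀}(0); (ii) G(λ) is a compact operator for every λ ∈ D*_{ε₀}(0); and (iii) for every λ ∈ D*_{ε₀}(0) with Im(λ) > 0, the number λ² lies in the resolvent set of L₀ and G(λ) = D_γ ∘ (L₀ − λ²)⁻¹ ∘ D_γ. -/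
namespace WRes

noncomputable abbrev H2 := lp (fun _ : ℤ => ℂ) 2

theorem summable_natAbs (r : ℝ) (h0 : 0 ≤ r) (h1 : r < 1) :
    Summable (fun n : ℤ => r ^ n.natAbs) := by
  apply Summable.of_nat_of_neg
  · simpa using summable_geometric_of_lt_one h0 h1
  · simpa using summable_geometric_of_lt_one h0 h1

theorem two_pos' : 0 < (2 : ENNReal).toReal := by norm_num

/-- shift operator -/
noncomputable def shift (a : ℤ) : H2 →L[ℂ] H2 :=
  LinearMap.mkContinuous
    { toFun := fun x => ⟨fun n => x (n + a), by
        apply memℓp_gen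
        have := (lp.memℓp x).summable two_pos'
        exact (Equiv.addRight a).summable_iff.2 this⟩
      map_add' := fun x y => by ext n; rfl
      map_smul' := fun c x => by ext n; rfl } 1 (by
    intro x
    rw [one_mul]
    apply lp.norm_le_of_tsum_le two_pos' (norm_nonneg _)
    rw [lp.norm_rpow_eq_tsum two_pos' x]
    exact le_of_eq ((Equiv.addRight a).tsum_eq (fun n => ‖x n‖ ^ (2 : ENNReal).toReal)))

theorem shift_apply (a : ℤ) (x : H2) (n : ℤ) : shift a x n = x (n + a) := rfl

theorem shift_norm (a : ℤ) : ‖shift a‖ ≤ 1 := LinearMap.mkContinuous_norm_le _ zero_le_one _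

/-- matrix unit -/
noncomputable def E (n m : ℤ) : H2 →L[ℂ] H2 :=
  (lp.evalCLM ℂ (fun _ : ℤ => ℂ) 2 m).smulRight (lp.single 2 n (1 : ℂ) : H2)

theorem E_norm (n m : ℤ) : ‖E n m‖ ≤ 1 := by
  unfold E
  rw [ContinuousLinearMap.norm_smulRight_apply, lp.norm_single (by norm_num)]
  simp only [norm_one, mul_one]
  exact LinearMap.mkContinuous_norm_le _ zero_le_one _

theorem E_apply (n m : ℤ) (x : H2) (k : ℤ) : E n m x k = if k = n then x m else 0 := by
  have : E n m x = x m • (lp.single 2 n (1 : ℂ) : H2) := rfl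
  rw [this, lp.coeFn_smul, Pi.smul_apply, lp.single_apply, Pi.single_apply]
  split_ifs <;> simp

theorem E_compact (n m : ℤ) : IsCompactOperator (E n m) := by
  have h : IsCompactOperator (ContinuousLinearMap.toSpanSingleton ℂ
      (lp.single 2 n (1 : ℂ) : H2)) :=
    isCompactOperator_of_locallyCompactSpace_rng _
  exact h.comp_clm (lp.evalCLM ℂ (fun _ : ℤ => ℂ) 2 m)

/-- coefficient -/
noncomputable def k (q : ℝ) (z : ℂ) (p : ℤ × ℤ) : ℂ :=
  z ^ (p.1 - p.2).natAbs * (((q ^ 2) ^ p.1.natAbs * (q ^ 2) ^ p.2.natAbs : ℝ) : ℂ)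

theorem k_norm (q : ℝ) (hq : 0 < q) (hq1 : q < 1) (z : ℂ) (hz : ‖z‖ ≤ q⁻¹) (p : ℤ × ℤ) :
    ‖k q z p‖ ≤ q ^ p.1.natAbs * q ^ p.2.natAbs := by
  unfold k
  rw [norm_mul, norm_pow, Complex.norm_real, Real.norm_of_nonneg (by positivity)]
  have h1 : ‖z‖ ^ (p.1 - p.2).natAbs ≤ (q⁻¹) ^ (p.1.natAbs + p.2.natAbs) := by
    calc ‖z‖ ^ (p.1 - p.2).natAbs ≤ (q⁻¹) ^ (p.1 - p.2).natAbs := by gcongr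
      _ ≤ _ := pow_le_pow_right₀ ((one_le_inv₀ hq).2 hq1.le) (by omega)
  calc _ ≤ (q⁻¹) ^ (p.1.natAbs + p.2.natAbs) * ((q ^ 2) ^ p.1.natAbs * (q ^ 2) ^ p.2.natAbs) := by
        gcongr
    _ = (q⁻¹ * q ^ 2) ^ p.1.natAbs * (q⁻¹ * q ^ 2) ^ p.2.natAbs := by
        rw [mul_pow, mul_pow, pow_add]; ring
    _ = _ := by
        have : q⁻¹ * q ^ 2 = q := by field_simp
        rw [this]

theorem kE_norm (q : ℝ) (hq : 0 < q) (hq1 : q < 1) (z : ℂ) (hz : ‖z‖ ≤ q⁻¹) (p : ℤ × ℤ) :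
    ‖k q z p • E p.1 p.2‖ ≤ q ^ p.1.natAbs * q ^ p.2.natAbs := by
  rw [norm_smul]
  calc _ ≤ ‖k q z p‖ * 1 := by gcongr; exact E_norm _ _
    _ ≤ _ := by rw [mul_one]; exact k_norm q hq hq1 z hz p

theorem summable_q (q : ℝ) (hq : 0 < q) (hq1 : q < 1) :
    Summable (fun p : ℤ × ℤ => q ^ p.1.natAbs * q ^ p.2.natAbs) :=
  (summable_natAbs q hq.le hq1).mul_of_nonneg (summable_natAbs q hq.le hq1)
    (fun _ => by positivity) (fun _ => by positivity)

noncomputable def K (q : ℝ) (z : ℂ) : H2 →L[ℂ] H2 := ∑' p : ℤ × ℤ, k q z p • E p.1 p.2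

theorem K_hasSum (q : ℝ) (hq : 0 < q) (hq1 : q < 1) (z : ℂ) (hz : ‖z‖ ≤ q⁻¹) :
    HasSum (fun p : ℤ × ℤ => k q z p • E p.1 p.2) (K q z) :=
  (Summable.of_norm_bounded (summable_q q hq hq1) (kE_norm q hq hq1 z hz)).hasSum

theorem K_compact (q : ℝ) (hq : 0 < q) (hq1 : q < 1) (z : ℂ) (hz : ‖z‖ ≤ q⁻¹) :
    IsCompactOperator (K q z) := by
  refine isCompactOperator_of_tendsto (K_hasSum q hq hq1 z hz) (Filter.Eventually.of_forall ?_)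
  intro s
  have : (∑ p ∈ s, k q z p • E p.1 p.2) ∈ compactOperator (RingHom.id ℂ) H2 H2 := by
    refine Submodule.sum_mem _ fun p _ => Submodule.smul_mem _ _ ?_
    exact E_compact p.1 p.2
  exact this

theorem K_apply (q : ℝ) (hq : 0 < q) (hq1 : q < 1) (z : ℂ) (hz : ‖z‖ ≤ q⁻¹) (m n : ℤ) :
    K q z (lp.single 2 m (1 : ℂ)) n = k q z (n, m) := by
  have h1 := (K_hasSum q hq hq1 z hz).mapL
    ((lp.evalCLM ℂ (fun _ : ℤ => ℂ) 2 n).comp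
      (ContinuousLinearMap.apply ℂ H2 (lp.single 2 m (1 : ℂ) : H2)))
  have h2 := hasSum_single (f := fun p : ℤ × ℤ => ((lp.evalCLM ℂ (fun _ : ℤ => ℂ) 2 n).comp
      (ContinuousLinearMap.apply ℂ H2 (lp.single 2 m (1 : ℂ) : H2))) (k q z p • E p.1 p.2)) (n, m)
      (by
        rintro ⟨a, b⟩ hab
        change k q z (a, b) * (E a b (lp.single 2 m (1 : ℂ)) n) = 0
        rw [E_apply, lp.single_apply, Pi.single_apply]
        split_ifs with h h'
        · exact absurd (by rw [h, h']) hab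
        · simp
        · simp)
  have h3 := h1.unique h2
  change K q z (lp.single 2 m (1 : ℂ)) n = k q z (n, m) * (E n m (lp.single 2 m (1 : ℂ)) n) at h3
  rw [h3, E_apply]
  simp

/-- square root -/
noncomputable def s (l : ℂ) : ℂ := (1 - l ^ 2 / 4) ^ (1 / 2 : ℂ)

theorem s_sq (l : ℂ) : s l ^ 2 = 1 - l ^ 2 / 4 := by
  unfold s
  rw [← Complex.cpow_nat_mul]
  norm_num

theorem slit (l : ℂ) (hl : ‖l‖ < 1) : 0 < (1 - l ^ 2 / 4).re := by
  have h1 : ‖l ^ 2 / 4‖ < 1 := by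
    rw [norm_div, norm_pow]
    norm_num
    nlinarith [norm_nonneg l]
  have := Complex.re_le_norm (l ^ 2 / 4)
  rw [Complex.sub_re, Complex.one_re]
  linarith

theorem s_diff (l : ℂ) (hl : ‖l‖ < 1) : DifferentiableAt ℂ s l := by
  unfold s
  apply DifferentiableAt.cpow_const (by fun_prop)
  exact Or.inl (slit l hl)

theorem s_re (l : ℂ) (hl : ‖l‖ < 1) : 0 < (s l).re := by
  have hs := slit l hl
  have hne : (1 - l ^ 2 / 4) ≠ 0 := by
    intro h; rw [h] at hs; simp at hs
  unfold s
  rw [Complex.cpow_def_of_ne_zero hne, Complex.exp_re]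
  apply mul_pos (Real.exp_pos _)
  have him : (Complex.log (1 - l ^ 2 / 4) * (1 / 2)).im = Complex.arg (1 - l ^ 2 / 4) / 2 := by
    have : (1 / 2 : ℂ) = ((1 / 2 : ℝ) : ℂ) := by norm_num
    rw [this, Complex.im_mul_ofReal, Complex.log_im]; ring
  rw [him]
  have := Complex.neg_pi_lt_arg (1 - l ^ 2 / 4)
  have := Complex.abs_arg_lt_pi_div_two_iff.2 (Or.inl hs)
  rw [abs_lt] at this
  apply Real.cos_pos_of_mem_Ioo
  constructor <;> linarith [Real.pi_pos]

noncomputable def w (l : ℂ) : ℂ := s l + Complex.I * l / 2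
noncomputable def w' (l : ℂ) : ℂ := s l - Complex.I * l / 2

theorem ww (l : ℂ) : w l * w' l = 1 := by
  unfold w w'
  linear_combination s_sq l - l ^ 2 / 4 * Complex.I_sq

theorem w_lt (l : ℂ) (hl : ‖l‖ < 1) (him : 0 < l.im) : ‖w l‖ < 1 := by
  have hr := s_re l hl
  have hi : 4 * ((s l).re * (s l).im) = - (l.re * l.im) := by
    have := congrArg Complex.im (s_sq l)
    simp [pow_two, Complex.mul_im] at this
    linarith
  have hneg : (s l).im * l.re ≤ 0 := by
    by_contra hcon
    push Not at hcon
    have := mul_pos hcon hr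
    have h4 : 4 * ((s l).im * l.re * (s l).re) = - (l.re ^ 2 * l.im) := by
      linear_combination l.re * hi
    have h5 := mul_nonneg (sq_nonneg l.re) him.le
    linarith
  have h1 : Complex.normSq (w l) < Complex.normSq (w' l) := by
    have hwre : (w l).re = (s l).re - l.im / 2 := by simp [w]; ring
    have hwim : (w l).im = (s l).im + l.re / 2 := by simp [w]
    have hwre' : (w' l).re = (s l).re + l.im / 2 := by simp [w']; ring
    have hwim' : (w' l).im = (s l).im - l.re / 2 := by simp [w']
    rw [Complex.normSq_apply, Complex.normSq_apply, hwre, hwim, hwre', hwim']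
    nlinarith [mul_pos hr him]
  rw [Complex.normSq_eq_norm_sq, Complex.normSq_eq_norm_sq] at h1
  have h2 : ‖w l‖ * ‖w' l‖ = 1 := by rw [← norm_mul, ww, norm_one]
  have h3 := lt_of_pow_lt_pow_left₀ 2 (norm_nonneg _) h1
  by_contra hcon
  push Not at hcon
  nlinarith

noncomputable def z (l : ℂ) : ℂ := w l ^ 2

theorem z_ne (l : ℂ) : z l ≠ 0 := pow_ne_zero _ (left_ne_zero_of_mul_eq_one (ww l))

theorem z_inv (l : ℂ) : (z l)⁻¹ = w' l ^ 2 := by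
  apply inv_eq_of_mul_eq_one_right
  unfold z
  rw [← mul_pow, ww, one_pow]

theorem z_add (l : ℂ) : (z l)⁻¹ + z l = 2 - l ^ 2 := by
  rw [z_inv]; unfold z w w'
  linear_combination 2 * s_sq l + l ^ 2 / 2 * Complex.I_sq

theorem z_sub (l : ℂ) : (z l)⁻¹ - z l = - 2 * Complex.I * l * s l := by
  rw [z_inv]; unfold z w w'
  ring

theorem z_diff (l : ℂ) (hl : ‖l‖ < 1) : DifferentiableAt ℂ z l := by
  have := s_diff l hl
  unfold z w
  fun_prop

theorem z_zero : z 0 = 1 := by simp [z, w, s]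

theorem factor (z c : ℂ) (hz : z ≠ 0) (hc : z⁻¹ + z = 2 - c)
    (L0 : H2 →L[ℂ] H2)
    (hL0 : ∀ (x : H2) (n : ℤ), (L0 x) n = 2 * x n - x (n + 1) - x (n - 1)) :
    L0 - algebraMap ℂ (H2 →L[ℂ] H2) c =
      z⁻¹ • ((1 - z • shift 1) * (1 - z • shift (-1))) := by
  ext x n
  have e1 : (L0 - algebraMap ℂ (H2 →L[ℂ] H2) c) x n = L0 x n - c * x n := rfl
  have e2 : (z⁻¹ • ((1 - z • shift 1) * (1 - z • shift (-1)))) x n =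
    z⁻¹ * ((x n - z * x (n + -1)) - z * (x (n + 1) - z * x (n + 1 + -1))) := rfl
  rw [e1, e2, hL0, add_neg_cancel_right, ← sub_eq_add_neg]
  field_simp
  field_simp at hc
  linear_combination (-x n) * hc

theorem isUnit_A (z c : ℂ) (hz : z ≠ 0) (hz1 : ‖z‖ < 1) (hc : z⁻¹ + z = 2 - c)
    (L0 : H2 →L[ℂ] H2)
    (hL0 : ∀ (x : H2) (n : ℤ), (L0 x) n = 2 * x n - x (n + 1) - x (n - 1)) :
    IsUnit (L0 - algebraMap ℂ (H2 →L[ℂ] H2) c) := by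
  rw [factor z c hz hc L0 hL0]
  have h : ∀ a, IsUnit (1 - z • shift a) := fun a => by
    apply isUnit_one_sub_of_norm_lt_one
    rw [norm_smul]
    nlinarith [shift_norm a, norm_nonneg z]
  have := ((h 1).mul (h (-1)))
  have h2 := this.smul (Units.mk0 z⁻¹ (inv_ne_zero hz))
  exact h2

/-- the Green function -/
noncomputable def green (z : ℂ) (hz1 : ‖z‖ < 1) (m : ℤ) : H2 :=
  ⟨fun n => (z⁻¹ - z)⁻¹ * z ^ (n - m).natAbs, by
    apply memℓp_gen
    have h := (summable_natAbs (‖z‖ ^ 2) (by positivity)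
      (by nlinarith [norm_nonneg z])).mul_left (‖(z⁻¹ - z)⁻¹‖ ^ 2)
    refine ((Equiv.subRight m).summable_iff.2 h).congr ?_
    intro n
    simp only [Function.comp, Equiv.subRight_apply, norm_mul, norm_pow, ENNReal.toReal_ofNat,
      Real.rpow_ofNat, mul_pow]
    rw [← pow_mul, ← pow_mul, mul_comm 2]⟩

theorem green_eq (z c : ℂ) (hz : z ≠ 0) (hz1 : ‖z‖ < 1) (hc : z⁻¹ + z = 2 - c)
    (hd : z⁻¹ - z ≠ 0) (L0 : H2 →L[ℂ] H2)
    (hL0 : ∀ (x : H2) (n : ℤ), (L0 x) n = 2 * x n - x (n + 1) - x (n - 1)) (m : ℤ) :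
    (L0 - algebraMap ℂ (H2 →L[ℂ] H2) c) (green z hz1 m) = lp.single 2 m (1 : ℂ) := by
  ext n
  have e1 : (L0 - algebraMap ℂ (H2 →L[ℂ] H2) c) (green z hz1 m) n
    = L0 (green z hz1 m) n - c * green z hz1 m n := rfl
  have e2 : ∀ n, green z hz1 m n = (z⁻¹ - z)⁻¹ * z ^ (n - m).natAbs := fun _ => rfl
  rw [e1, hL0, e2, e2, e2, lp.single_apply, Pi.single_apply]
  have hc' : c = 2 - (z⁻¹ + z) := by rw [hc]; ring
  rw [hc']
  split_ifs with h
  · subst h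
    have a1 : (n + 1 - n).natAbs = 1 := by omega
    have a2 : (n - 1 - n).natAbs = 1 := by omega
    rw [a1, a2, sub_self]
    rw [Int.natAbs_zero, pow_zero, pow_one]
    rw [show 2 * ((z⁻¹ - z)⁻¹ * 1) - (z⁻¹ - z)⁻¹ * z - (z⁻¹ - z)⁻¹ * z
      - (2 - (z⁻¹ + z)) * ((z⁻¹ - z)⁻¹ * 1) = (z⁻¹ - z)⁻¹ * (z⁻¹ - z) by ring]
    exact inv_mul_cancel₀ hd
  · generalize (z⁻¹ - z)⁻¹ = d
    rcases lt_or_gt_of_ne h with h | h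
    · obtain ⟨j, hj⟩ : ∃ j : ℕ, (n + 1 - m).natAbs = j := ⟨_, rfl⟩
      have a1 : (n - m).natAbs = j + 1 := by omega
      have a2 : (n - 1 - m).natAbs = j + 2 := by omega
      rw [hj, a1, a2, pow_add, pow_add]
      field_simp
      ring
    · obtain ⟨j, hj⟩ : ∃ j : ℕ, (n - 1 - m).natAbs = j := ⟨_, rfl⟩
      have a1 : (n - m).natAbs = j + 1 := by omega
      have a2 : (n + 1 - m).natAbs = j + 2 := by omega
      rw [hj, a1, a2, pow_add, pow_add]
      field_simp
      ring

theorem exp_eq (γ : ℝ) (n : ℤ) :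
    Real.exp (-(γ / 2) * |(n : ℝ)|) = (Real.exp (-(γ / 4)) ^ 2) ^ n.natAbs := by
  rw [← Real.exp_nat_mul, ← Real.exp_nat_mul, Nat.cast_natAbs]
  congr 1
  push_cast
  ring

end WRes

/-- For `γ > 0` and `D_γ` the weight `e^{−(γ/2)|n|}` on `ℓ²(ℤ)`,
the weighted resolvent `D_γ (L₀ − λ²)⁻¹ D_γ`, defined for `Im λ > 0`, admits a holomorphic
extension `G` with compact values to a punctured disk `D*_{ε₀}(0)`, `0 < ε₀ ≤ γ/8`. -/
theorem weighted_resolvent_holomorphic_extension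
    (γ : ℝ) (hγ : 0 < γ)
    (L0 : lp (fun _ : ℤ => ℂ) 2 →L[ℂ] lp (fun _ : ℤ => ℂ) 2)
    (hL0 : ∀ (x : lp (fun _ : ℤ => ℂ) 2) (n : ℤ),
      (L0 x) n = 2 * x n - x (n + 1) - x (n - 1))
    (Dγ : lp (fun _ : ℤ => ℂ) 2 →L[ℂ] lp (fun _ : ℤ => ℂ) 2)
    (hDγ : ∀ (x : lp (fun _ : ℤ => ℂ) 2) (n : ℤ),
      (Dγ x) n = (Real.exp (-(γ / 2) * |(n : ℝ)|) : ℂ) * x n) :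
    ∃ ε₀ : ℝ, 0 < ε₀ ∧ ε₀ ≤ γ / 8 ∧
      ∃ G : ℂ → (lp (fun _ : ℤ => ℂ) 2 →L[ℂ] lp (fun _ : ℤ => ℂ) 2),
        DifferentiableOn ℂ G {l : ℂ | l ≠ 0 ∧ ‖l‖ < ε₀} ∧
        (∀ l : ℂ, l ≠ 0 → ‖l‖ < ε₀ → IsCompactOperator (G l)) ∧
        (∀ l : ℂ, l ≠ 0 → ‖l‖ < ε₀ → 0 < l.im →
          l ^ 2 ∈ resolventSet ℂ L0 ∧
          G l = Dγ ∘L Ring.inverse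
            (L0 - algebraMap ℂ (lp (fun _ : ℤ => ℂ) 2 →L[ℂ] lp (fun _ : ℤ => ℂ) 2) (l ^ 2))
            ∘L Dγ) := by
  set q : ℝ := Real.exp (-(γ / 4)) with hqdef
  have hq : 0 < q := Real.exp_pos _
  have hq1 : q < 1 := by rw [hqdef, Real.exp_lt_one_iff]; linarith
  have hcont : ContinuousAt (fun l => ‖WRes.z l‖) 0 :=
    (WRes.z_diff 0 (by simp)).continuousAt.norm
  have hev : ∀ᶠ l in nhds (0 : ℂ), ‖WRes.z l‖ < q⁻¹ := by
    apply hcont.eventually_lt continuousAt_const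
    rw [WRes.z_zero, norm_one]
    exact (one_lt_inv₀ hq).2 hq1
  obtain ⟨δ, hδ, hball⟩ := Metric.eventually_nhds_iff.1 hev
  have hz : ∀ l : ℂ, ‖l‖ < min (min δ 1) (γ / 8) → ‖WRes.z l‖ ≤ q⁻¹ ∧ ‖l‖ < 1 := by
    intro l hl
    rw [lt_min_iff, lt_min_iff] at hl
    exact ⟨(hball (by rw [dist_zero_right]; exact hl.1.1)).le, hl.1.2⟩
  have hd : ∀ l : ℂ, l ≠ 0 → ‖l‖ < 1 → (WRes.z l)⁻¹ - WRes.z l ≠ 0 := by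
    intro l hl h1
    have hs : WRes.s l ≠ 0 := by
      intro h
      have := WRes.s_re l h1
      rw [h] at this
      simp at this
    rw [WRes.z_sub]
    simp [hl, hs]
  refine ⟨min (min δ 1) (γ / 8), by positivity, min_le_right _ _,
    fun l => ((WRes.z l)⁻¹ - WRes.z l)⁻¹ • WRes.K q (WRes.z l), ?_, ?_, ?_⟩
  · have hopen : IsOpen {l : ℂ | l ≠ 0 ∧ ‖l‖ < min (min δ 1) (γ / 8)} :=
      isOpen_ne.inter (isOpen_lt continuous_norm continuous_const)
    apply DifferentiableOn.fun_smul
    · rintro l ⟨hl0, hl⟩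
      have h := WRes.z_diff l (hz l hl).2
      exact ((h.inv (WRes.z_ne l)).sub h).inv (hd l hl0 (hz l hl).2) |>.differentiableWithinAt
    · refine Complex.differentiableOn_tsum_of_summable_norm (WRes.summable_q q hq hq1)
        ?_ hopen ?_
      · rintro p l ⟨hl0, hl⟩
        have h := WRes.z_diff l (hz l hl).2
        apply DifferentiableAt.differentiableWithinAt
        unfold WRes.k
        fun_prop
      · rintro p l ⟨hl0, hl⟩
        exact WRes.kE_norm q hq hq1 _ (hz l hl).1 p
  · intro l hl0 hl
    exact (WRes.K_compact q hq hq1 _ (hz l hl).1).smul (((WRes.z l)⁻¹ - WRes.z l)⁻¹)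
  · intro l hl0 hl him
    obtain ⟨hzq, hl1⟩ := hz l hl
    have hz1 : ‖WRes.z l‖ < 1 := by
      unfold WRes.z
      rw [norm_pow]
      have := WRes.w_lt l hl1 him
      nlinarith [norm_nonneg (WRes.w l)]
    have hU := WRes.isUnit_A (WRes.z l) (l ^ 2) (WRes.z_ne l) hz1 (WRes.z_add l) L0 hL0
    refine ⟨?_, ?_⟩
    · rw [spectrum.mem_resolventSet_iff, ← IsUnit.neg_iff, neg_sub]
      exact hU
    · have hDs : ∀ m : ℤ, Dγ (lp.single 2 m (1 : ℂ)) =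
          (((q ^ 2) ^ m.natAbs : ℝ) : ℂ) • (lp.single 2 m (1 : ℂ) : WRes.H2) := by
        intro m
        ext n
        rw [hDγ, WRes.exp_eq, lp.coeFn_smul, Pi.smul_apply, lp.single_apply, Pi.single_apply,
          smul_eq_mul]
        split_ifs with h
        · rw [h]
        · simp
      have hR : ∀ m : ℤ, Ring.inverse (L0 - algebraMap ℂ (WRes.H2 →L[ℂ] WRes.H2) (l ^ 2))
          (lp.single 2 m (1 : ℂ)) = WRes.green (WRes.z l) hz1 m := by
        intro m
        rw [← WRes.green_eq (WRes.z l) (l ^ 2) (WRes.z_ne l) hz1 (WRes.z_add l)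
          (hd l hl0 hl1) L0 hL0 m]
        have := Ring.inverse_mul_cancel _ hU
        exact congrArg (fun T : WRes.H2 →L[ℂ] WRes.H2 => T (WRes.green (WRes.z l) hz1 m)) this
      apply lp.ext_continuousLinearMap (by norm_num)
      intro m
      apply ContinuousLinearMap.ext_ring
      ext n
      have e1 : (Dγ ∘L Ring.inverse
            (L0 - algebraMap ℂ (lp (fun _ : ℤ => ℂ) 2 →L[ℂ] lp (fun _ : ℤ => ℂ) 2) (l ^ 2))
            ∘L Dγ) (lp.single 2 m (1 : ℂ)) n = (((q ^ 2) ^ n.natAbs : ℝ) : ℂ) *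
            ((((q ^ 2) ^ m.natAbs : ℝ) : ℂ) * (((WRes.z l)⁻¹ - WRes.z l)⁻¹ *
              WRes.z l ^ (n - m).natAbs)) := by
        rw [ContinuousLinearMap.comp_apply, ContinuousLinearMap.comp_apply, hDs, map_smul, hR,
          hDγ, WRes.exp_eq]
        rfl
      have e2 : (((WRes.z l)⁻¹ - WRes.z l)⁻¹ • WRes.K q (WRes.z l)) (lp.single 2 m (1 : ℂ)) n
          = ((WRes.z l)⁻¹ - WRes.z l)⁻¹ * WRes.k q (WRes.z l) (n, m) := by
        rw [← WRes.K_apply q hq hq1 _ hzq]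
        rfl
      refine e2.trans (Eq.trans ?_ e1.symm)
      unfold WRes.k
      push_cast
      ring
end

section
/- Let γ > 0, let D_γ be the bounded operator on ℓ²(ℤ) given by (D_γ x)(n) = e^{−(γ/2)|n|} x(n), and let P_γ be the rank-one bounded operator on ℓ²(ℤ) given by (P_γ x)(n) = e^{−(γ/2)|n|} · ∑_{m∈ℤ} e^{−(γ/2)|m|} x(m). Then there exists ε₀ with 0 < ε₀ ≤ γ/8 and a map A from the open disk D_{ε₀}(0) = {λ ∈ ℂ : |λ| < ε₀} to B(ℓ²(ℤ)) such that: (i) A is holomorphic on D_{ε₀}(0); (ii) A(λ) is compact for every λ ∈ D_{ε₀}(0); and (iii) for every λ ∈ D_{ε₀}(0) with Im(λ) > 0, λ² lies in the resolvent set of L₀ and D_γ ∘ (L₀ − λ²)⁻¹ ∘ D_γ = (i/(2λ))·P_γ + A(λ). In particular the weighted resolvent splits into a singular rank-one part at λ = 0 plus a part holomorphic across 0. -/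
/-- The Hilbert space. -/
noncomputable abbrev HSp : Type := lp (fun _ : ℤ => ℂ) 2

theorem exists_shift (k : ℤ) : ∃ S : HSp →L[ℂ] HSp, ‖S‖ ≤ 1 ∧ ∀ (x : HSp) (n : ℤ), (S x) n = x (n + k) := by
  have h2 : 0 < (2 : ENNReal).toReal := by norm_num
  have hm : ∀ x : HSp, Memℓp (fun n : ℤ => x (n + k)) 2 := by
    intro x
    apply memℓp_gen
    exact (Equiv.addRight k).summable_iff.2 ((memℓp_gen_iff h2).1 (lp.memℓp x))
  let T : HSp →ₗ[ℂ] HSp :=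
    { toFun := fun x => ⟨fun n : ℤ => x (n + k), hm x⟩
      map_add' := fun x y => by ext n; rfl
      map_smul' := fun c x => by ext n; rfl }
  refine ⟨T.mkContinuous 1 ?_, T.mkContinuous_norm_le (by norm_num) _, fun x n => rfl⟩
  intro x
  rw [one_mul]
  rw [← Real.rpow_le_rpow_iff (norm_nonneg _) (norm_nonneg _) h2, lp.norm_rpow_eq_tsum h2,
    lp.norm_rpow_eq_tsum h2]
  exact ((Equiv.addRight k).tsum_eq (fun n => ‖x n‖ ^ (2 : ENNReal).toReal)).le

theorem summable_pow_natAbs {r : ℝ} (h0 : 0 ≤ r) (h1 : r < 1) :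
    Summable (fun n : ℤ => r ^ n.natAbs) := by
  apply Summable.of_nat_of_neg
  · simpa using summable_geometric_of_lt_one h0 h1
  · simpa using summable_geometric_of_lt_one h0 h1

theorem sub_alg_apply (T : HSp →L[ℂ] HSp) (c : ℂ) (x : HSp) (n : ℤ) :
    ((T - algebraMap ℂ (HSp →L[ℂ] HSp) c) x) n = (T x) n - c * x n := rfl

theorem one_sub_smul_apply (T : HSp →L[ℂ] HSp) (c : ℂ) (x : HSp) (n : ℤ) :
    (((1 : HSp →L[ℂ] HSp) - c • T) x) n = x n - c * (T x) n := rfl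

theorem alg_mul_apply (T : HSp →L[ℂ] HSp) (c : ℂ) (x : HSp) (n : ℤ) :
    ((algebraMap ℂ (HSp →L[ℂ] HSp) c * T) x) n = c * (T x) n := rfl

theorem unit_L0 (L0 : HSp →L[ℂ] HSp)
    (hL0 : ∀ (x : HSp) (n : ℤ), (L0 x) n = 2 * x n - x (n + 1) - x (n - 1))
    (z zi c : ℂ) (hz : z * zi = 1) (hz1 : ‖z‖ < 1) (hc : c = 2 - z - zi) :
    IsUnit (L0 - algebraMap ℂ (HSp →L[ℂ] HSp) c) := by
  obtain ⟨S, hS, hS'⟩ := exists_shift 1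
  obtain ⟨T, hT, hT'⟩ := exists_shift (-1)
  have key : L0 - algebraMap ℂ (HSp →L[ℂ] HSp) c =
      algebraMap ℂ (HSp →L[ℂ] HSp) zi * ((1 - z • S) * (1 - z • T)) := by
    ext x n
    rw [sub_alg_apply, alg_mul_apply, ContinuousLinearMap.mul_apply, one_sub_smul_apply,
      one_sub_smul_apply, hS', one_sub_smul_apply, hT', hT', hL0, add_neg_cancel_right,
      ← sub_eq_add_neg]
    subst hc
    linear_combination (x (n+1) + x (n-1) - z * x n) * hz
  have hu : ∀ S : HSp →L[ℂ] HSp, ‖S‖ ≤ 1 → IsUnit (1 - z • S) := by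
    intro S hS
    apply isUnit_one_sub_of_norm_lt_one
    rw [norm_smul]
    nlinarith [norm_nonneg z, norm_nonneg S]
  rw [key]
  refine IsUnit.mul ?_ ((hu S hS).mul (hu T hT))
  apply IsUnit.map
  exact IsUnit.of_mul_eq_one z (by rw [mul_comm]; exact hz)

theorem resolvent_single (L0 : HSp →L[ℂ] HSp)
    (hL0 : ∀ (x : HSp) (n : ℤ), (L0 x) n = 2 * x n - x (n + 1) - x (n - 1))
    (z zi c : ℂ) (hz : z * zi = 1) (hz1 : ‖z‖ < 1) (hc : c = 2 - z - zi) (m n : ℤ) :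
    (Ring.inverse (L0 - algebraMap ℂ (HSp →L[ℂ] HSp) c) (lp.single 2 m 1)) n =
      z ^ (n - m).natAbs / (zi - z) := by
  have hu := unit_L0 L0 hL0 z zi c hz hz1 hc
  have hne : zi - z ≠ 0 := by
    intro h
    have : ‖z‖ * ‖z‖ = 1 := by
      rw [← norm_mul]
      have : zi = z := sub_eq_zero.1 h
      rw [this] at hz
      simp [hz]
    nlinarith [norm_nonneg z]
  have hmem : Memℓp (fun n : ℤ => z ^ (n - m).natAbs / (zi - z)) 2 := by
    apply Memℓp.of_exponent_ge (q := 1)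
    · apply memℓp_gen
      simp only [ENNReal.toReal_one, Real.rpow_one, norm_div, norm_pow]
      apply Summable.div_const
      exact (summable_pow_natAbs (norm_nonneg z) hz1).comp_injective (i := fun n => n - m)
        (fun a b h => by simpa using h)
    · norm_num
  let g : HSp := ⟨_, hmem⟩
  have hg : ∀ n, g n = z ^ (n - m).natAbs / (zi - z) := fun n => rfl
  have hLg : (L0 - algebraMap ℂ (HSp →L[ℂ] HSp) c) g = lp.single 2 m 1 := by
    ext n
    rw [sub_alg_apply, hL0, hg, hg, hg, lp.single_apply]
    obtain ⟨d, rfl⟩ : ∃ d, n = m + d := ⟨n - m, by ring⟩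
    rw [show m + d - m = d by ring, show m + d + 1 - m = d + 1 by ring,
      show m + d - 1 - m = d - 1 by ring]
    subst hc
    rcases lt_trichotomy d 0 with h | h | h
    · obtain ⟨k, rfl⟩ : ∃ k : ℕ, d = -(k + 1) := ⟨(-d - 1).toNat, by omega⟩
      rw [Pi.single_eq_of_ne (by omega), show (-((k:ℤ) + 1)).natAbs = k + 1 by omega,
        show (-((k:ℤ) + 1) + 1).natAbs = k by omega, show (-((k:ℤ) + 1) - 1).natAbs = k + 2 by omega]
      field_simp
      ring_nf
      linear_combination (z ^ k) * hz
    · subst h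
      simp only [add_zero, Pi.single_eq_same]
      norm_num
      field_simp
      ring
    · obtain ⟨k, rfl⟩ : ∃ k : ℕ, d = k + 1 := ⟨(d - 1).toNat, by omega⟩
      rw [Pi.single_eq_of_ne (by omega), show ((k:ℤ) + 1).natAbs = k + 1 by omega,
        show ((k:ℤ) + 1 + 1).natAbs = k + 2 by omega, show ((k:ℤ) + 1 - 1).natAbs = k by omega]
      field_simp
      ring_nf
      linear_combination (z ^ k) * hz
  rw [← hLg, ← ContinuousLinearMap.mul_apply, Ring.inverse_mul_cancel _ hu]
  rfl

/-- Square root branch. -/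
noncomputable def wf (l : ℂ) : ℂ := (1 - l ^ 2 / 4) ^ (((2 : ℕ) : ℂ)⁻¹)

theorem wf_sq (l : ℂ) : wf l ^ 2 = 1 - l ^ 2 / 4 := Complex.cpow_nat_inv_pow _ two_ne_zero

theorem re_pos_aux {l : ℂ} (hl : ‖l‖ < 1) : 0 < (1 - l ^ 2 / 4).re := by
  have h1 : (l ^ 2 / 4).re ≤ ‖l ^ 2 / 4‖ := Complex.re_le_norm _
  have h2 : ‖l ^ 2 / 4‖ = ‖l‖ ^ 2 / 4 := by simp
  have := norm_nonneg l
  rw [Complex.sub_re, Complex.one_re]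
  nlinarith

theorem wf_re_pos {l : ℂ} (hl : ‖l‖ < 1) : 0 < (wf l).re := by
  have h := re_pos_aux hl
  have hne : (1 - l ^ 2 / 4) ≠ 0 := by intro h0; rw [h0] at h; simp at h
  rw [wf, Complex.cpow_def_of_ne_zero hne, Complex.exp_re]
  apply mul_pos (Real.exp_pos _)
  apply Real.cos_pos_of_mem_Ioo
  have := abs_lt.1 (Complex.abs_arg_lt_pi_div_two_iff.2 (Or.inl h))
  have e : (Complex.log (1 - l ^ 2 / 4) * (((2 : ℕ) : ℂ)⁻¹)).im = Complex.arg (1 - l ^ 2 / 4) / 2 := by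
    rw [← Complex.log_im, Nat.cast_ofNat, ← div_eq_mul_inv]
    simp
  rw [e]
  constructor <;> linarith [this.1, this.2, Real.pi_pos]

theorem wf_diff : DifferentiableOn ℂ wf (Metric.ball 0 1) := by
  intro l hl
  apply DifferentiableAt.differentiableWithinAt
  unfold wf
  apply DifferentiableAt.cpow
  · fun_prop
  · fun_prop
  · left; exact re_pos_aux (by simpa using hl)

theorem wf_bounds {l : ℂ} (hl : ‖l‖ < 1) : 1 / 2 ≤ ‖wf l‖ ∧ ‖wf l‖ ≤ 3 / 2 ∧ 1 ≤ ‖1 + wf l‖ := by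
  have h2 : ‖l ^ 2 / 4‖ = ‖l‖ ^ 2 / 4 := by simp
  have h3 : ‖wf l‖ ^ 2 = ‖1 - l ^ 2 / 4‖ := by rw [← norm_pow, wf_sq]
  have h4 : ‖1 - l ^ 2 / 4‖ ≤ 1 + ‖l ^ 2 / 4‖ := by
    have := norm_sub_le (1 : ℂ) (l ^ 2 / 4)
    rwa [norm_one] at this
  have h5 : 1 - ‖l ^ 2 / 4‖ ≤ ‖1 - l ^ 2 / 4‖ := by
    have := norm_sub_norm_le (1 : ℂ) (l ^ 2 / 4)
    rwa [norm_one] at this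
  have h6 : ‖l‖ ^ 2 < 1 := by nlinarith [norm_nonneg l]
  have h7 := norm_nonneg (wf l)
  refine ⟨?_, ?_, ?_⟩
  · nlinarith
  · nlinarith
  · have := Complex.re_le_norm (1 + wf l)
    have := wf_re_pos hl
    simp only [Complex.add_re, Complex.one_re] at *
    linarith

/-- The multiplier `e^{iθ}`. -/
noncomputable def zf (l : ℂ) : ℂ := (wf l + Complex.I * l / 2) ^ 2
/-- Its inverse. -/
noncomputable def zif (l : ℂ) : ℂ := (wf l - Complex.I * l / 2) ^ 2

theorem zf_mul (l : ℂ) : zf l * zif l = 1 := by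
  unfold zf zif
  have : (wf l + Complex.I * l / 2) * (wf l - Complex.I * l / 2) = 1 := by
    linear_combination wf_sq l - l ^ 2 / 4 * Complex.I_sq
  rw [← mul_pow, this, one_pow]

theorem zf_sum (l : ℂ) : l ^ 2 = 2 - zf l - zif l := by
  unfold zf zif
  linear_combination 2 * wf_sq l + l ^ 2 / 2 * Complex.I_sq

theorem zf_diff (l : ℂ) : zif l - zf l = - 2 * Complex.I * l * wf l := by
  unfold zf zif; ring

theorem zf_sub_one (l : ℂ) : zf l - 1 = l * (Complex.I * wf l - l / 2) := by
  unfold zf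
  linear_combination wf_sq l + l ^ 2 / 4 * Complex.I_sq

theorem zf_norm_lt {l : ℂ} (hl : ‖l‖ < 1) (him : 0 < l.im) : ‖zf l‖ < 1 := by
  have hw := wf_re_pos hl
  have h2 := congrArg Complex.im (wf_sq l)
  have e : (wf l).re * (wf l).im = - (l.re * l.im) / 4 := by
    have h4 : (l ^ 2 / 4).im = (l ^ 2).im / 4 := by simp
    rw [Complex.sub_im, h4, Complex.one_im, pow_two, pow_two, Complex.mul_im, Complex.mul_im] at h2
    linarith
  have h3 : ‖wf l + Complex.I * l / 2‖ ^ 2 < ‖wf l - Complex.I * l / 2‖ ^ 2 := by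
    have a1 : (Complex.I * l / 2).re = - l.im / 2 := by simp
    have a2 : (Complex.I * l / 2).im = l.re / 2 := by simp
    rw [← Complex.normSq_eq_norm_sq, ← Complex.normSq_eq_norm_sq, Complex.normSq_apply,
      Complex.normSq_apply]
    simp only [Complex.add_re, Complex.add_im, Complex.sub_re, Complex.sub_im, a1, a2]
    have : (wf l).im * l.re < (wf l).re * l.im := by
      have : (wf l).re * ((wf l).im * l.re) < (wf l).re * ((wf l).re * l.im) := by
        have : (wf l).re * ((wf l).im * l.re) = - (l.re ^ 2 * l.im) / 4 := by
          linear_combination l.re * e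
        rw [this]
        have : 0 < (wf l).re * ((wf l).re * l.im) := by positivity
        have : 0 ≤ l.re ^ 2 * l.im := by positivity
        linarith
      exact lt_of_mul_lt_mul_left this hw.le
    nlinarith
  have h4 : ‖zf l‖ < ‖zif l‖ := by simpa [zf, zif] using h3
  have h5 : ‖zf l‖ * ‖zif l‖ = 1 := by rw [← norm_mul, zf_mul]; simp
  by_contra! h
  nlinarith

/-- Regular part of the kernel. -/
noncomputable def af (k : ℕ) (l : ℂ) : ℂ :=
  Complex.I / (2 * wf l) * ((Complex.I * wf l - l / 2) * ∑ j ∈ Finset.range k, zf l ^ j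
    + l / (4 * (1 + wf l)))

theorem wf_ne {l : ℂ} (hl : ‖l‖ < 1) : wf l ≠ 0 := by
  intro h; have := (wf_bounds hl).1; rw [h] at this; norm_num at this
theorem wf_ne' {l : ℂ} (hl : ‖l‖ < 1) : 1 + wf l ≠ 0 := by
  intro h; have := (wf_bounds hl).2.2; rw [h] at this; norm_num at this

theorem af_eq (k : ℕ) {l : ℂ} (hl : ‖l‖ < 1) (h0 : l ≠ 0) :
    zf l ^ k / (zif l - zf l) = Complex.I / (2 * l) + af k l := by
  have hw := wf_ne hl
  have hw' := wf_ne' hl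
  have h1 : (Complex.I * wf l - l / 2) * ∑ j ∈ Finset.range k, zf l ^ j = (zf l ^ k - 1) / l := by
    rw [eq_div_iff h0]
    have := geom_sum_mul (zf l) k
    rw [zf_sub_one] at this
    linear_combination this
  have h2 : l / (4 * (1 + wf l)) = (1 - wf l) / l := by
    field_simp
    linear_combination 4 * wf_sq l
  rw [af, h1, h2, zf_diff]
  have hI := Complex.I_ne_zero
  field_simp
  linear_combination (-zf l ^ k) * Complex.I_sq

theorem af_diff (k : ℕ) : DifferentiableOn ℂ (af k) (Metric.ball 0 1) := by
  have hz : DifferentiableOn ℂ zf (Metric.ball 0 1) := by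
    unfold zf
    exact (wf_diff.add (by fun_prop)).pow 2
  have hw := wf_diff
  unfold af
  apply DifferentiableOn.mul
  · apply DifferentiableOn.div
    · fun_prop
    · fun_prop
    · intro x hx; simpa using wf_ne (by simpa using hx)
  · apply DifferentiableOn.add
    · apply DifferentiableOn.mul
      · fun_prop
      · exact DifferentiableOn.fun_sum fun i _ => hz.pow i
    · apply DifferentiableOn.div
      · fun_prop
      · fun_prop
      · intro x hx; simpa using wf_ne' (by simpa using hx)

theorem af_bound (γ : ℝ) (hγ : 0 < γ) (k : ℕ) {l : ℂ} (hl : ‖l‖ < 1) (hlγ : ‖l‖ < γ / 16) :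
    ‖af k l‖ ≤ (16 / γ + 1) * Real.exp (γ / 4 * k) := by
  obtain ⟨b1, b2, b3⟩ := wf_bounds hl
  have hq : ‖Complex.I * wf l - l / 2‖ ≤ 2 := by
    refine (norm_sub_le _ _).trans ?_
    simp; linarith
  have hz : ‖zf l‖ ≤ Real.exp (γ / 8) := by
    have : zf l = 1 + l * (Complex.I * wf l - l / 2) := by rw [← zf_sub_one]; ring
    calc ‖zf l‖ ≤ 1 + ‖l‖ * ‖Complex.I * wf l - l / 2‖ := by
          rw [this]; refine (norm_add_le _ _).trans ?_; simp
      _ ≤ γ / 8 + 1 := by nlinarith [norm_nonneg l]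
      _ ≤ _ := Real.add_one_le_exp _
  have hs : ‖∑ j ∈ Finset.range k, zf l ^ j‖ ≤ k * Real.exp (γ / 8 * k) := by
    refine (norm_sum_le _ _).trans ?_
    calc ∑ j ∈ Finset.range k, ‖zf l ^ j‖ ≤ ∑ j ∈ Finset.range k, Real.exp (γ / 8 * k) := by
          apply Finset.sum_le_sum
          intro j hj
          rw [norm_pow]
          calc ‖zf l‖ ^ j ≤ Real.exp (γ / 8) ^ j := by gcongr
            _ = Real.exp (γ / 8 * j) := by rw [← Real.exp_nat_mul, mul_comm]
            _ ≤ _ := by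
              have : (j : ℝ) ≤ k := by exact_mod_cast (Finset.mem_range.1 hj).le
              gcongr
      _ = _ := by simp
  have hs2 : ‖∑ j ∈ Finset.range k, zf l ^ j‖ ≤ 8 / γ * Real.exp (γ / 4 * k) := by
    refine hs.trans ?_
    have : γ / 8 * k ≤ Real.exp (γ / 8 * k) := by linarith [Real.add_one_le_exp (γ / 8 * k)]
    have e : Real.exp (γ / 4 * k) = Real.exp (γ / 8 * k) * Real.exp (γ / 8 * k) := by
      rw [← Real.exp_add]; ring_nf
    have : (k : ℝ) ≤ 8 / γ * Real.exp (γ / 8 * k) := by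
      calc (k : ℝ) = 8 / γ * (γ / 8 * k) := by field_simp
        _ ≤ _ := by gcongr
    rw [e, ← mul_assoc]
    gcongr
  have hE : 1 ≤ Real.exp (γ / 4 * k) := Real.one_le_exp (by positivity)
  have hc1 : ‖Complex.I / (2 * wf l)‖ ≤ 1 := by
    rw [norm_div, div_le_one (by rw [norm_mul]; norm_num; try exact norm_pos_iff.1 (by linarith))]
    simp; linarith
  have hc2 : ‖l / (4 * (1 + wf l))‖ ≤ 1 := by
    rw [norm_div, div_le_one (by rw [norm_mul]; norm_num; try exact norm_pos_iff.1 (by linarith))]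
    simp; linarith
  rw [af, norm_mul]
  calc _ ≤ 1 * (2 * (8 / γ * Real.exp (γ / 4 * k)) + 1) := by
        gcongr
        refine (norm_add_le _ _).trans ?_
        rw [norm_mul]
        gcongr
    _ ≤ _ := by
        have : 2 * (8 / γ * Real.exp (γ / 4 * k)) = 16 / γ * Real.exp (γ / 4 * k) := by ring
        rw [this]; linarith

/-- Elementary rank-one operators. -/
noncomputable def Eop (n m : ℤ) : HSp →L[ℂ] HSp :=
  (lp.evalCLM ℂ (fun _ : ℤ => ℂ) 2 m).smulRight (lp.single 2 n (1 : ℂ) : HSp)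

theorem Eop_apply (n m : ℤ) (x : HSp) : Eop n m x = x m • (lp.single 2 n (1 : ℂ) : HSp) := rfl

theorem Eop_norm (n m : ℤ) : ‖Eop n m‖ ≤ 1 := by
  refine ContinuousLinearMap.opNorm_le_bound _ zero_le_one fun x => ?_
  rw [Eop_apply, norm_smul, lp.norm_single (by norm_num), norm_one, mul_one, one_mul]
  exact lp.norm_apply_le_norm (by norm_num) x m

theorem Eop_compact (n m : ℤ) : IsCompactOperator (Eop n m) := by
  have := (isCompactOperator_of_locallyCompactSpace_rng
    ((ContinuousLinearMap.id ℂ ℂ).smulRight (lp.single 2 n (1 : ℂ) : HSp))).comp_clm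
      (lp.evalCLM ℂ (fun _ : ℤ => ℂ) 2 m)
  exact this

/-- Weight. -/
noncomputable def dw (γ : ℝ) (n : ℤ) : ℝ := Real.exp (-(γ / 2) * |(n : ℝ)|)

/-- Terms. -/
noncomputable def Ft (γ : ℝ) (p : ℤ × ℤ) (l : ℂ) : HSp →L[ℂ] HSp :=
  ((dw γ p.1 : ℂ) * (dw γ p.2 : ℂ) * af (p.1 - p.2).natAbs l) • Eop p.1 p.2

theorem summable_exp_abs {c : ℝ} (hc : 0 < c) : Summable fun n : ℤ => Real.exp (-c * |(n : ℝ)|) := by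
  convert summable_pow_natAbs (Real.exp_pos (-c)).le (by rw [Real.exp_lt_one_iff]; linarith) using 2 with n
  rw [← Real.exp_nat_mul, Nat.cast_natAbs, Int.cast_abs, mul_comm]

theorem Ft_bound (γ : ℝ) (hγ : 0 < γ) (p : ℤ × ℤ) {l : ℂ} (hl : ‖l‖ < 1) (hlγ : ‖l‖ < γ / 16) :
    ‖Ft γ p l‖ ≤ (16 / γ + 1) *
      (Real.exp (-(γ / 4) * |(p.1 : ℝ)|) * Real.exp (-(γ / 4) * |(p.2 : ℝ)|)) := by
  obtain ⟨n, m⟩ := p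
  have ha := af_bound γ hγ (n - m).natAbs hl hlγ
  have hk : (((n - m).natAbs : ℕ) : ℝ) ≤ |(n : ℝ)| + |(m : ℝ)| := by
    rw [Nat.cast_natAbs, Int.cast_abs, Int.cast_sub]; exact abs_sub _ _
  have hd : ∀ n, ‖(dw γ n : ℂ)‖ = dw γ n := fun n => by
    rw [Complex.norm_real, Real.norm_of_nonneg (by unfold dw; positivity)]
  have hd0 : ∀ n, 0 ≤ dw γ n := fun n => (Real.exp_pos _).le
  rw [Ft, norm_smul, norm_mul, norm_mul, hd, hd]
  dsimp only
  have hn := hd0 n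
  have hm := hd0 m
  calc _ ≤ dw γ n * dw γ m * ((16 / γ + 1) * Real.exp (γ / 4 * (|(n : ℝ)| + |(m : ℝ)|))) * 1 := by
        gcongr
        · refine ha.trans ?_
          gcongr
        · exact Eop_norm n m
    _ = (16 / γ + 1) * (dw γ n * dw γ m * Real.exp (γ / 4 * (|(n : ℝ)| + |(m : ℝ)|))) := by ring
    _ = _ := by
        rw [dw, dw, ← Real.exp_add, ← Real.exp_add, ← Real.exp_add]
        congr 2
        ring

/-- For `γ > 0`, `D_γ` the weight `e^{−(γ/2)|n|}` on `ℓ²(ℤ)` and `P_γ` the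
rank-one operator `(P_γ x)(n) = e^{−(γ/2)|n|} ∑_m e^{−(γ/2)|m|} x(m)`, the weighted resolvent
`D_γ (L₀ − λ²)⁻¹ D_γ` splits, on a punctured disk `D*_{ε₀}(0)` with `0 < ε₀ ≤ γ/8`, as a
singular rank-one part `(i/(2λ))·P_γ` plus a part `A(λ)` holomorphic across `0` with compact
values. -/
theorem weighted_resolvent_splitting
    (γ : ℝ) (hγ : 0 < γ)
    (L0 : lp (fun _ : ℤ => ℂ) 2 →L[ℂ] lp (fun _ : ℤ => ℂ) 2)
    (hL0 : ∀ (x : lp (fun _ : ℤ => ℂ) 2) (n : ℤ),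
      (L0 x) n = 2 * x n - x (n + 1) - x (n - 1))
    (Dγ : lp (fun _ : ℤ => ℂ) 2 →L[ℂ] lp (fun _ : ℤ => ℂ) 2)
    (hDγ : ∀ (x : lp (fun _ : ℤ => ℂ) 2) (n : ℤ),
      (Dγ x) n = (Real.exp (-(γ / 2) * |(n : ℝ)|) : ℂ) * x n)
    (Pγ : lp (fun _ : ℤ => ℂ) 2 →L[ℂ] lp (fun _ : ℤ => ℂ) 2)
    (hPγ : ∀ (x : lp (fun _ : ℤ => ℂ) 2) (n : ℤ),
      HasSum (fun m : ℤ =>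
          (Real.exp (-(γ / 2) * |(n : ℝ)|) : ℂ) * ((Real.exp (-(γ / 2) * |(m : ℝ)|) : ℂ) * x m))
        ((Pγ x) n)) :
    ∃ ε₀ : ℝ, 0 < ε₀ ∧ ε₀ ≤ γ / 8 ∧
      ∃ A : ℂ → (lp (fun _ : ℤ => ℂ) 2 →L[ℂ] lp (fun _ : ℤ => ℂ) 2),
        DifferentiableOn ℂ A (Metric.ball (0 : ℂ) ε₀) ∧
        (∀ l : ℂ, ‖l‖ < ε₀ → IsCompactOperator (A l)) ∧
        (∀ l : ℂ, ‖l‖ < ε₀ → 0 < l.im →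
          l ^ 2 ∈ resolventSet ℂ L0 ∧
          Dγ ∘L Ring.inverse
              (L0 - algebraMap ℂ (lp (fun _ : ℤ => ℂ) 2 →L[ℂ] lp (fun _ : ℤ => ℂ) 2) (l ^ 2))
              ∘L Dγ
            = (Complex.I / (2 * l)) • Pγ + A l) := by
  have hu : Summable fun p : ℤ × ℤ => (16 / γ + 1) *
      (Real.exp (-(γ / 4) * |(p.1 : ℝ)|) * Real.exp (-(γ / 4) * |(p.2 : ℝ)|)) := by
    apply Summable.mul_left
    have h := summable_exp_abs (c := γ / 4) (by positivity)
    exact h.mul_of_nonneg h (fun _ => (Real.exp_pos _).le) (fun _ => (Real.exp_pos _).le)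
  have hb : ∀ l : ℂ, ‖l‖ < min 1 (γ / 16) → ‖l‖ < 1 ∧ ‖l‖ < γ / 16 := fun l hl => lt_min_iff.1 hl
  refine ⟨min 1 (γ / 16), by positivity, (min_le_right _ _).trans (by linarith),
    fun l => ∑' p, Ft γ p l, ?_, ?_, ?_⟩
  · apply Complex.differentiableOn_tsum_of_summable_norm hu
    · intro p
      unfold Ft
      apply DifferentiableOn.smul_const
      apply DifferentiableOn.const_mul
      exact (af_diff _).mono (Metric.ball_subset_ball (min_le_left _ _))
    · exact Metric.isOpen_ball
    · intro p l hl
      have := hb l (by simpa using hl)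
      exact Ft_bound γ hγ p this.1 this.2
  · intro l hl
    have hS : Summable fun p => Ft γ p l := Summable.of_norm_bounded hu
      fun p => Ft_bound γ hγ p (hb l hl).1 (hb l hl).2
    refine isCompactOperator_of_tendsto hS.hasSum (Filter.Eventually.of_forall fun s => ?_)
    exact Submodule.sum_mem (compactOperator (RingHom.id ℂ) HSp HSp)
      fun p _ => Submodule.smul_mem _ _ (Eop_compact p.1 p.2)
  · intro l hl him
    obtain ⟨h1, h2⟩ := hb l hl
    have hS : Summable fun p => Ft γ p l := Summable.of_norm_bounded hu
      fun p => Ft_bound γ hγ p h1 h2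
    have hz1 := zf_norm_lt h1 him
    have hl0 : l ≠ 0 := by rintro rfl; simp at him
    refine ⟨?_, ?_⟩
    · rw [spectrum.mem_resolventSet_iff, ← IsUnit.neg_iff, neg_sub]
      exact unit_L0 L0 hL0 _ _ _ (zf_mul l) hz1 (zf_sum l)
    · have hA : ∀ m n : ℤ, ((∑' p, Ft γ p l) (lp.single 2 m (1 : ℂ) : HSp)) n =
          (dw γ n : ℂ) * (dw γ m : ℂ) * af (n - m).natAbs l := by
        intro m n
        let Φ : (HSp →L[ℂ] HSp) →L[ℂ] ℂ := (lp.evalCLM ℂ (fun _ : ℤ => ℂ) 2 n) ∘L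
          (ContinuousLinearMap.apply ℂ HSp (lp.single 2 m (1 : ℂ) : HSp))
        have hΦ : ∀ T, Φ T = (T (lp.single 2 m (1 : ℂ) : HSp)) n := fun T => rfl
        have hs := hS.hasSum.mapL Φ
        rw [← hΦ]
        refine hs.unique ?_
        convert hasSum_single (n, m) ?_ using 1
        · simp [hΦ, Ft, Eop_apply]
        · rintro ⟨a, b⟩ hab
          rw [hΦ, Ft]
          simp only [_root_.smul_apply, Eop_apply, lp.coeFn_smul, Pi.smul_apply,
            smul_eq_mul, lp.single_apply]
          by_cases hbm : b = m
          · subst hbm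
            have : n ≠ a := by rintro rfl; exact hab rfl
            rw [Pi.single_eq_of_ne this]; simp
          · rw [Pi.single_eq_of_ne hbm]; simp
      have hP : ∀ m n : ℤ, (Pγ (lp.single 2 m (1 : ℂ) : HSp)) n = (dw γ n : ℂ) * (dw γ m : ℂ) := by
        intro m n
        refine (hPγ _ n).unique ?_
        convert hasSum_single m ?_ using 1
        · simp [dw]
        · intro b hbm
          rw [lp.single_apply, Pi.single_eq_of_ne hbm]; simp
      have hD : ∀ m : ℤ, Dγ (lp.single 2 m (1 : ℂ) : HSp) =
          (dw γ m : ℂ) • (lp.single 2 m (1 : ℂ) : HSp) := by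
        intro m
        ext n
        rw [hDγ, lp.coeFn_smul, Pi.smul_apply, smul_eq_mul, lp.single_apply]
        by_cases h : n = m
        · subst h; simp [dw]
        · rw [Pi.single_eq_of_ne h]; simp
      apply lp.ext_continuousLinearMap (by norm_num)
      intro m
      ext n
      simp only [ContinuousLinearMap.comp_apply, lp.singleContinuousLinearMap_apply,
        _root_.add_apply, _root_.smul_apply, lp.coeFn_add, Pi.add_apply,
        lp.coeFn_smul, Pi.smul_apply, hA, hP, hD, map_smul, hDγ, smul_eq_mul]
      rw [resolvent_single L0 hL0 _ _ _ (zf_mul l) hz1 (zf_sum l), af_eq _ h1 hl0, dw, dw]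
      ring
end

section
/- Let H be a nontrivial separable complex Hilbert space, γ > 0, C > 0, and w : ℤ × ℤ → B(H) with ‖w(n,m)‖ ≤ C·e^{−γ(|n|+|m|)} for all (n,m) ∈ ℤ². Let Λ₁ ∈ B(H), let Λ₂ ∈ B(H) be compact, and assume that the range of the composition Λ₂ ∘ Λ₁ is finite-dimensional. Let V be the bounded operator on ℓ²(ℤ,H) defined by (Vφ)(n) = ∑_{m∈ℤ} Λ₁(w(n,m)(Λ₂(φ(m)))), and set H_V := H₀ + V. Then the set σ(H_V) \ [0,4] = {z ∈ σ(H_V) : z ∉ {x ∈ ℂ : ∃ t ∈ [0,4] ⊆ ℝ, x = t}} is finite. (Since V is compact, σ(H_V) \ [0,4] consists exactly of the discrete eigenvalues of H_V, so this says the discrete spectrum of H_V has no limit points in [0,4], hence is finite.) -/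
/-- rectangular swap -/
theorem fds_isUnit_swap {X E : Type*} [NormedAddCommGroup X] [NormedSpace ℂ X]
    [NormedAddCommGroup E] [NormedSpace ℂ E]
    (A : E →L[ℂ] X) (B : X →L[ℂ] E) (c : ℂ) (hc : c ≠ 0) (J : E →L[ℂ] E)
    (h1 : (c • (1 : E →L[ℂ] E) + B ∘L A) ∘L J = 1)
    (h2 : J ∘L (c • (1 : E →L[ℂ] E) + B ∘L A) = 1) :
    IsUnit (c • (1 : X →L[ℂ] X) + A ∘L B) := by
  rw [isUnit_iff_exists]
  refine ⟨c⁻¹ • (1 - A ∘L J ∘L B), ?_, ?_⟩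
  · ext x
    have h := congrArg (fun T : E →L[ℂ] E => A (T (B x))) h1
    simp only [ContinuousLinearMap.comp_apply, add_apply, smul_apply, one_apply_eq_self, map_add, map_smul] at h
    simp only [mul_apply_eq_comp, ContinuousLinearMap.comp_apply, add_apply, smul_apply, one_apply_eq_self, sub_apply, map_add, map_smul, map_sub]
    have h' : A (B (A (J (B x)))) = A (B x) - c • A (J (B x)) := eq_sub_of_add_eq' h
    rw [h', inv_smul_eq_iff₀ hc]
    abel
  · ext x
    have h := congrArg (fun T : E →L[ℂ] E => A (T (B x))) h2
    simp only [ContinuousLinearMap.comp_apply, add_apply, smul_apply, one_apply_eq_self, map_add, map_smul] at h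
    simp only [mul_apply_eq_comp, ContinuousLinearMap.comp_apply, add_apply, smul_apply, one_apply_eq_self, sub_apply, map_add, map_smul, map_sub]
    have h' : A (J (B (A (B x)))) = A (B x) - c • A (J (B x)) := eq_sub_of_add_eq' h
    rw [h', smul_inv_smul₀ hc, sub_sub_cancel, inv_smul_smul₀ hc]
    abel

theorem fds_det_diff {E : Type*} [NormedAddCommGroup E] [NormedSpace ℂ E] [FiniteDimensional ℂ E]
    (M : ℂ → E →L[ℂ] E) (s : Set ℂ) (hM : DifferentiableOn ℂ M s) :
    DifferentiableOn ℂ (fun ζ => LinearMap.det (M ζ).toLinearMap) s := by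
  let b := Module.finBasis ℂ E
  have : (fun ζ => LinearMap.det (M ζ).toLinearMap)
      = fun ζ => ∑ σ : Equiv.Perm _, ((Equiv.Perm.sign σ : ℤ) : ℂ) *
        ∏ i, (LinearMap.toContinuousLinearMap (b.coord (σ i))) (M ζ (b i)) := by
    funext ζ
    rw [← LinearMap.det_toMatrix b, Matrix.det_apply']
    simp [LinearMap.toMatrix_apply]
  rw [this]
  refine DifferentiableOn.fun_sum fun σ _ => DifferentiableOn.const_mul ?_ _
  refine DifferentiableOn.fun_finsetProd fun i _ => ?_
  exact (ContinuousLinearMap.differentiable _).comp_differentiableOn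
    (hM.clm_apply (differentiableOn_const _))

theorem fds_zeros_finite (d : ℂ → ℂ) (r : ℝ) (hr : 1 < r)
    (hd : DifferentiableOn ℂ d (Metric.ball 0 r)) (h0 : d 0 ≠ 0) :
    {ζ : ℂ | ‖ζ‖ < 1 ∧ d ζ = 0}.Finite := by
  have han : AnalyticOnNhd ℂ d (Metric.ball 0 r) := hd.analyticOnNhd Metric.isOpen_ball
  have h := han.preimage_zero_mem_codiscreteWithin (x := 0) h0 (by simp; linarith)
    (Metric.isConnected_ball (by linarith))
  have hsub : Metric.closedBall (0 : ℂ) 1 ⊆ Metric.ball 0 r := Metric.closedBall_subset_ball hr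
  have h' := Filter.codiscreteWithin_mono hsub h
  have := (isCompact_closedBall (0 : ℂ) 1).finite_sdiff_of_mem_codiscreteWithin h'
  refine this.subset ?_
  rintro ζ ⟨h1, h2⟩
  refine ⟨by simpa using h1.le, ?_⟩
  simp [h2]

theorem fds_core {X E : Type*} [NormedAddCommGroup X] [NormedSpace ℂ X] [CompleteSpace X]
    [NormedAddCommGroup E] [NormedSpace ℂ E] [FiniteDimensional ℂ E]
    (r : ℝ) (hr : 1 < r) (D : ℂ → X →L[ℂ] X) (A : ℂ → E →L[ℂ] X) (B : X →L[ℂ] E)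
    (hDd : DifferentiableOn ℂ D (Metric.ball 0 r)) (hDu : ∀ ζ ∈ Metric.ball (0 : ℂ) r, IsUnit (D ζ))
    (hAd : DifferentiableOn ℂ A (Metric.ball 0 r)) (hA0 : A 0 = 0) :
    {ζ : ℂ | ‖ζ‖ < 1 ∧ ¬ IsUnit ((1 - ζ ^ 2) • D ζ + A ζ ∘L B)}.Finite := by
  have hDi : DifferentiableOn ℂ (fun ζ => Ring.inverse (D ζ)) (Metric.ball 0 r) :=
    hDd.inverse hDu
  set M : ℂ → (E →L[ℂ] E) := fun ζ =>
    (1 - ζ ^ 2) • 1 + (B ∘L Ring.inverse (D ζ)) ∘L A ζ with hM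
  have hMd : DifferentiableOn ℂ M (Metric.ball 0 r) := by
    have h0 : Differentiable ℂ (fun ζ : ℂ => 1 - ζ ^ 2) := by fun_prop
    have h1 : Differentiable ℂ (fun ζ : ℂ => (1 - ζ ^ 2) • (1 : E →L[ℂ] E)) :=
      h0.smul_const _
    exact h1.differentiableOn.add
      (((differentiableOn_const _).clm_comp hDi).clm_comp hAd)
  have hdet := fds_det_diff M _ hMd
  have hfact : ∀ ζ ∈ Metric.ball (0 : ℂ) r, (1 - ζ ^ 2) • D ζ + A ζ ∘L B
      = ((1 - ζ ^ 2) • (1 : X →L[ℂ] X) + A ζ ∘L (B ∘L Ring.inverse (D ζ))) * D ζ := by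
    intro ζ hζ
    have hinv : Ring.inverse (D ζ) * D ζ = 1 := Ring.inverse_mul_cancel _ (hDu ζ hζ)
    rw [add_mul, smul_mul_assoc, one_mul]
    congr 1
    calc A ζ ∘L B = (A ζ ∘L B) ∘L (1 : X →L[ℂ] X) := rfl
      _ = (A ζ ∘L B) ∘L (Ring.inverse (D ζ) * D ζ) := by rw [hinv]
      _ = (A ζ ∘L (B ∘L Ring.inverse (D ζ))) * D ζ := rfl
  refine (fds_zeros_finite _ r hr hdet ?_).subset ?_
  · have : M 0 = 1 := by simp [M, hA0]
    rw [this]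
    have : LinearMap.det (1 : E →L[ℂ] E).toLinearMap = 1 :=
      LinearMap.det_id
    rw [this]; exact one_ne_zero
  · rintro ζ ⟨hζ, hnu⟩
    refine ⟨hζ, ?_⟩
    by_contra hne
    apply hnu
    have hζb : ζ ∈ Metric.ball (0 : ℂ) r := by simp; linarith
    rw [hfact ζ hζb]
    refine IsUnit.mul ?_ (hDu ζ hζb)
    have hu : IsUnit (M ζ).toLinearMap := by
      rw [LinearMap.isUnit_iff_isUnit_det]; exact isUnit_iff_ne_zero.2 hne
    obtain ⟨J, hJ1, hJ2⟩ := isUnit_iff_exists.1 hu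
    refine fds_isUnit_swap (A ζ) (B ∘L Ring.inverse (D ζ)) _ ?_ (LinearMap.toContinuousLinearMap J)
      ?_ ?_
    · intro h
      have : ζ ^ 2 = 1 := (sub_eq_zero.1 h).symm
      have h2 : ‖ζ‖ ^ 2 = 1 := by rw [← norm_pow, this, norm_one]
      nlinarith [norm_nonneg ζ]
    · ext1 x
      exact LinearMap.congr_fun hJ1 x
    · ext1 x
      exact LinearMap.congr_fun hJ2 x

theorem fds_diffA {X E : Type*} [NormedAddCommGroup X] [NormedSpace ℂ X]
    [NormedAddCommGroup E] [NormedSpace ℂ E] (S : ℂ → X →L[ℂ] X) (s : Set ℂ)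
    (hS : DifferentiableOn ℂ S s) (p1 p2 p3 : E →L[ℂ] X) :
    DifferentiableOn ℂ (fun ζ : ℂ => ((1 - ζ ^ 2) • S ζ) ∘L p1 +
      ((ζ * ((1 + ζ) / 2)) • p2 + (ζ * ((1 - ζ) / 2)) • p3)) s := by
  have h1 : Differentiable ℂ (fun ζ : ℂ => 1 - ζ ^ 2) := by fun_prop
  have h2 : Differentiable ℂ (fun ζ : ℂ => ζ * ((1 + ζ) / 2)) := by fun_prop
  have h3 : Differentiable ℂ (fun ζ : ℂ => ζ * ((1 - ζ) / 2)) := by fun_prop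
  exact ((h1.differentiableOn.smul hS).clm_comp (differentiableOn_const _)).add
    ((h2.smul_const p2).add (h3.smul_const p3)).differentiableOn

theorem fds_abstract {X : Type*} [NormedAddCommGroup X] [NormedSpace ℂ X] [CompleteSpace X]
    (Y : X →L[ℂ] X)
    (hY : ∀ ε : ℝ, 0 < ε → ∃ Z : X →L[ℂ] X, FiniteDimensional ℂ (LinearMap.range Z.toLinearMap) ∧
      ‖Y - Z‖ < ε)
    (G : ℂ → X →L[ℂ] X) (r : ℝ) (hr : 1 < r) (hG : DifferentiableOn ℂ G (Metric.ball 0 r))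
    (hp : FiniteDimensional ℂ (LinearMap.range (G 1 * Y).toLinearMap))
    (hm : FiniteDimensional ℂ (LinearMap.range (G (-1) * Y).toLinearMap)) :
    {ζ : ℂ | ‖ζ‖ < 1 ∧ ¬ IsUnit ((1 - ζ ^ 2) • (1 : X →L[ℂ] X) + ζ • (G ζ * Y))}.Finite := by
  have hb1 : Metric.ball (0 : ℂ) r ∈ nhds (1 : ℂ) := Metric.isOpen_ball.mem_nhds (by simpa using hr)
  have hb2 : Metric.ball (0 : ℂ) r ∈ nhds (-1 : ℂ) :=
    Metric.isOpen_ball.mem_nhds (by simpa using hr)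
  set g1 := dslope G 1 with hg1
  set g2 := dslope g1 (-1) with hg2
  have hg1d : DifferentiableOn ℂ g1 (Metric.ball 0 r) :=
    (Complex.differentiableOn_dslope hb1).2 hG
  have hg2d : DifferentiableOn ℂ g2 (Metric.ball 0 r) :=
    (Complex.differentiableOn_dslope hb2).2 hg1d
  have e1 : g1 (-1) = (1 / 2 : ℂ) • (G 1 - G (-1)) := by
    have h := sub_smul_dslope G 1 (-1)
    have h3 : (-1 - 1 : ℂ) = -2 := by norm_num
    rw [h3] at h
    have : G 1 - G (-1) = (2 : ℂ) • g1 (-1) := by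
      rw [← neg_sub, ← h, neg_smul, neg_neg]
    rw [this, smul_smul]; norm_num
  have e2 : ∀ ζ, G ζ = ((1 + ζ) / 2) • G 1 + ((1 - ζ) / 2) • G (-1) - (1 - ζ ^ 2) • g2 ζ := by
    intro ζ
    have h := sub_smul_dslope G 1 ζ
    have h' := sub_smul_dslope g1 (-1) ζ
    have h1 : G ζ = G 1 + (ζ - 1) • g1 ζ := by rw [h]; abel
    have h2 : g1 ζ = g1 (-1) + (ζ - -1) • g2 ζ := by rw [h']; abel
    rw [h1, h2, e1]
    module
  -- bounds
  set r' := (1 + r) / 2 with hr'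
  have hr1 : 1 < r' := by rw [hr']; linarith
  have hr2 : r' < r := by rw [hr']; linarith
  set S : ℂ → X →L[ℂ] X := fun ζ => -(ζ • g2 ζ) with hS
  have hSd : DifferentiableOn ℂ S (Metric.ball 0 r) := (differentiableOn_id.smul hg2d).neg
  obtain ⟨K, hK⟩ := (isCompact_closedBall (0 : ℂ) r').exists_bound_of_continuousOn
    (hSd.continuousOn.mono (Metric.closedBall_subset_ball hr2))
  have hK0 : 0 ≤ K := (norm_nonneg _).trans (hK 0 (by simp; linarith))
  obtain ⟨Z, hZ, hZn⟩ := hY (1 / (K + 1)) (by positivity)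
  set Δ := Y - Z with hΔ
  have hsmall : ∀ ζ ∈ Metric.ball (0 : ℂ) r', ‖S ζ * Δ‖ < 1 := by
    intro ζ hζ
    calc ‖S ζ * Δ‖ ≤ ‖S ζ‖ * ‖Δ‖ := norm_mul_le _ _
      _ ≤ K * (1 / (K + 1)) := by
        gcongr
        exact hK ζ (Metric.ball_subset_closedBall hζ)
      _ < 1 := by rw [mul_one_div, div_lt_one (by linarith)]; linarith
  set D : ℂ → X →L[ℂ] X := fun ζ => 1 + S ζ * Δ with hD
  have hDu : ∀ ζ ∈ Metric.ball (0 : ℂ) r', IsUnit (D ζ) := by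
    intro ζ hζ
    have := isUnit_one_sub_of_norm_lt_one (x := -(S ζ * Δ)) (by rw [norm_neg]; exact hsmall ζ hζ)
    simpa [hD, sub_neg_eq_add] using this
  have hsub : Metric.ball (0 : ℂ) r' ⊆ Metric.ball 0 r := Metric.ball_subset_ball hr2.le
  have hDd : DifferentiableOn ℂ D (Metric.ball 0 r') :=
    (differentiableOn_const _).add ((hSd.mono hsub).mul (differentiableOn_const _))
  -- finite-dimensional space
  let F1 := LinearMap.range Z.toLinearMap
  let F2 := LinearMap.range (G 1 * Y).toLinearMap
  let F3 := LinearMap.range (G (-1) * Y).toLinearMap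
  have : FiniteDimensional ℂ F1 := hZ
  have : FiniteDimensional ℂ F2 := hp
  have : FiniteDimensional ℂ F3 := hm
  let B1 : X →L[ℂ] F1 := Z.codRestrict F1 (fun x => ⟨x, rfl⟩)
  let B2 : X →L[ℂ] F2 := (G 1 * Y).codRestrict F2 (fun x => ⟨x, rfl⟩)
  let B3 : X →L[ℂ] F3 := (G (-1) * Y).codRestrict F3 (fun x => ⟨x, rfl⟩)
  let B : X →L[ℂ] F1 × F2 × F3 := B1.prod (B2.prod B3)
  let p1 : F1 × F2 × F3 →L[ℂ] X := F1.subtypeL ∘L ContinuousLinearMap.fst ℂ F1 (F2 × F3)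
  let p2 : F1 × F2 × F3 →L[ℂ] X :=
    F2.subtypeL ∘L ContinuousLinearMap.fst ℂ F2 F3 ∘L ContinuousLinearMap.snd ℂ F1 (F2 × F3)
  let p3 : F1 × F2 × F3 →L[ℂ] X :=
    F3.subtypeL ∘L ContinuousLinearMap.snd ℂ F2 F3 ∘L ContinuousLinearMap.snd ℂ F1 (F2 × F3)
  let A : ℂ → F1 × F2 × F3 →L[ℂ] X := fun ζ =>
    ((1 - ζ ^ 2) • S ζ) ∘L p1 + ((ζ * ((1 + ζ) / 2)) • p2 + (ζ * ((1 - ζ) / 2)) • p3)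
  have hAd : DifferentiableOn ℂ A (Metric.ball 0 r') := fds_diffA S _ (hSd.mono hsub) p1 p2 p3
  have hA0 : A 0 = 0 := by
    have hS0 : S 0 = 0 := by simp [hS]
    simp [A, hS0]
  have hfact : ∀ ζ, (1 - ζ ^ 2) • (1 : X →L[ℂ] X) + ζ • (G ζ * Y)
      = (1 - ζ ^ 2) • D ζ + A ζ ∘L B := by
    intro ζ
    have hAB : A ζ ∘L B = ((1 - ζ ^ 2) • S ζ) * Z + ((ζ * ((1 + ζ) / 2)) • (G 1 * Y)
        + (ζ * ((1 - ζ) / 2)) • (G (-1) * Y)) := by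
      ext x
      rfl
    rw [hAB, e2 ζ]
    simp only [hD, hS, hΔ]
    simp only [sub_mul, add_mul, smul_mul_assoc, mul_sub, neg_mul, smul_neg]
    module
  simp only [hfact]
  exact fds_core r' hr1 D A B hDd hDu hAd hA0

theorem fds_ring_swap {R : Type*} [Ring R] (x y : R) (h : IsUnit (1 + y * x)) :
    IsUnit (1 + x * y) := by
  obtain ⟨u, h1, h2⟩ := isUnit_iff_exists.1 h
  rw [isUnit_iff_exists]
  refine ⟨1 - x * u * y, ?_, ?_⟩
  · have : (1 + x * y) * (1 - x * u * y) = 1 + x * y - x * ((1 + y * x) * u) * y := by noncomm_ring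
    rw [this, h1]; noncomm_ring
  · have : (1 - x * u * y) * (1 + x * y) = 1 + x * y - x * (u * (1 + y * x)) * y := by noncomm_ring
    rw [this, h2]; noncomm_ring

theorem fds_ring_bs {R : Type*} [Ring R] (M Rz a b q W : R) (hM : IsUnit M) (hMR : M * Rz = 1)
    (hbR : b * Rz = Rz * b) (hqb : q * b = b * q) (hqa : q * a = a * q)
    (h : IsUnit (1 + q * Rz * q * (b * a * W))) : IsUnit (M + a * q * W * q * b) := by
  have e1 : M + a * q * W * q * b = M * (1 + (Rz * a * q * W) * (q * b)) := by
    have : M * (1 + (Rz * a * q * W) * (q * b)) = M + (M * Rz) * a * q * W * q * b := by noncomm_ring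
    rw [this, hMR, one_mul]
  rw [e1]
  refine hM.mul (fds_ring_swap _ _ ?_)
  have e2 : (q * b) * (Rz * a * q * W) = q * Rz * q * (b * a * W) := by
    calc (q * b) * (Rz * a * q * W) = q * (b * Rz) * (a * q) * W := by noncomm_ring
      _ = q * Rz * (b * q) * a * W := by rw [hbR, ← hqa]; noncomm_ring
      _ = _ := by rw [← hqb]; noncomm_ring
  rw [e2]; exact h

theorem fds_zeta (z : ℂ) (hz : ¬ ∃ t : ℝ, t ∈ Set.Icc (0 : ℝ) 4 ∧ z = (t : ℂ)) :
    ∃ ζ : ℂ, ζ ≠ 0 ∧ ‖ζ‖ < 1 ∧ z = 2 - ζ - ζ⁻¹ := by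
  obtain ⟨s, hs⟩ := IsAlgClosed.exists_pow_nat_eq ((2 - z) ^ 2 - 4) (n := 2) (by norm_num)
  set ζ := ((2 - z) + s) / 2 with hζ
  have hmul : ζ * (((2 - z) - s) / 2) = 1 := by
    rw [hζ]; linear_combination (-1 / 4) * hs
  have hne : ζ ≠ 0 := left_ne_zero_of_mul_eq_one hmul
  have hinv : ζ⁻¹ = ((2 - z) - s) / 2 := inv_eq_of_mul_eq_one_right hmul
  have hzz : z = 2 - ζ - ζ⁻¹ := by rw [hinv, hζ]; ring
  rcases lt_trichotomy ‖ζ‖ 1 with h | h | h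
  · exact ⟨ζ, hne, h, hzz⟩
  · exfalso
    apply hz
    refine ⟨2 - 2 * ζ.re, ?_, ?_⟩
    · have := Complex.abs_re_le_norm ζ
      rw [h] at this
      have := abs_le.1 this
      constructor <;> linarith
    · rw [hzz, Complex.inv_eq_conj h]
      have := Complex.add_conj ζ
      push_cast at this ⊢
      linear_combination -this
  · refine ⟨ζ⁻¹, inv_ne_zero hne, ?_, ?_⟩
    · rw [norm_inv]; exact inv_lt_one_of_one_lt₀ h
    · rw [inv_inv, hzz]; ring

theorem fds_summable (c : ℝ) (h0 : 0 ≤ c) (h1 : c < 1) : Summable (fun k : ℤ => c ^ k.natAbs) := by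
  rw [summable_int_iff_summable_nat_and_neg]
  simp [summable_geometric_of_lt_one h0 h1]

section
variable {H : Type*} [NormedAddCommGroup H] [InnerProductSpace ℂ H]

theorem fds_mem (φ : lp (fun _ : ℤ => H) 2) (ψ : ℤ → H) (k : ℤ) (M : ℝ)
    (h : ∀ n, ‖ψ n‖ ≤ M * ‖φ (n + k)‖) : Memℓp ψ 2 := by
  have hs := (lp.memℓp φ).summable (by norm_num)
  have hs' := ((Equiv.addRight k).summable_iff.2 hs).mul_left (M ^ 2)
  refine memℓp_gen (Summable.of_nonneg_of_le (fun n => by positivity) (fun n => ?_) hs')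
  simp only [ENNReal.toReal_ofNat, Real.rpow_ofNat, Function.comp, Equiv.coe_addRight]
  rw [← mul_pow]
  exact pow_le_pow_left₀ (norm_nonneg _) (h n) 2

theorem fds_norm_le (φ ψ : lp (fun _ : ℤ => H) 2) (k : ℤ) (M : ℝ) (hM : 0 ≤ M)
    (h : ∀ n, ‖ψ n‖ ≤ M * ‖φ (n + k)‖) : ‖ψ‖ ≤ M * ‖φ‖ := by
  have h2 : (0 : ℝ) < (2 : ENNReal).toReal := by norm_num
  have hs := (lp.memℓp φ).summable h2
  have hs' := ((Equiv.addRight k).summable_iff.2 hs).mul_left (M ^ 2)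
  refine lp.norm_le_of_tsum_le h2 (by positivity) ?_
  have e := lp.norm_rpow_eq_tsum h2 φ
  have e' : ∑' n, ‖φ n‖ ^ (2 : ENNReal).toReal = ∑' n, ‖φ (n + k)‖ ^ (2 : ENNReal).toReal :=
    ((Equiv.addRight k).tsum_eq (fun n => ‖φ n‖ ^ (2 : ENNReal).toReal)).symm
  rw [Real.mul_rpow hM (norm_nonneg _), e, e', ← tsum_mul_left]
  have hle : ∀ n, ‖ψ n‖ ^ (2 : ENNReal).toReal ≤ M ^ (2 : ENNReal).toReal * ‖φ (n + k)‖ ^ (2 : ENNReal).toReal := by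
    intro n
    rw [← Real.mul_rpow hM (norm_nonneg _)]
    exact Real.rpow_le_rpow (norm_nonneg _) (h n) h2.le
  refine Summable.tsum_le_tsum hle ((lp.memℓp ψ).summable h2) ?_
  simpa using hs'

theorem fds_opnorm_le (T : lp (fun _ : ℤ => H) 2 →L[ℂ] lp (fun _ : ℤ => H) 2) (k : ℤ) (M : ℝ)
    (hM : 0 ≤ M) (h : ∀ φ n, ‖(T φ) n‖ ≤ M * ‖φ (n + k)‖) : ‖T‖ ≤ M :=
  T.opNorm_le_bound hM fun φ => fds_norm_le φ (T φ) k M hM (h φ)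

/-- weighted shift -/
theorem fds_exists_op (k : ℤ) (f : ℤ → H →L[ℂ] H) (M : ℝ) (hf : ∀ n, ‖f n‖ ≤ M) :
    ∃ T : lp (fun _ : ℤ => H) 2 →L[ℂ] lp (fun _ : ℤ => H) 2,
      ∀ φ n, (T φ) n = f n (φ (n + k)) := by
  have hM : 0 ≤ M := (norm_nonneg _).trans (hf 0)
  have hb : ∀ (φ : lp (fun _ : ℤ => H) 2) n, ‖f n (φ (n + k))‖ ≤ M * ‖φ (n + k)‖ :=
    fun φ n => (f n).le_of_opNorm_le (hf n) _
  let L : lp (fun _ : ℤ => H) 2 →ₗ[ℂ] lp (fun _ : ℤ => H) 2 :=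
    { toFun := fun φ => ⟨fun n => f n (φ (n + k)), fds_mem φ _ k M (hb φ)⟩
      map_add' := fun φ ψ => by ext n; simp; rfl
      map_smul' := fun c φ => by ext n; simp }
  exact ⟨L.mkContinuous M fun φ => fds_norm_le φ (L φ) k M hM (hb φ), fun φ n => rfl⟩

/-- elementary matrix unit operator -/
noncomputable def fdsUnit (n m : ℤ) (v : H →L[ℂ] H) :
    lp (fun _ : ℤ => H) 2 →L[ℂ] lp (fun _ : ℤ => H) 2 :=
  (lp.singleContinuousLinearMap ℂ (fun _ : ℤ => H) 2 n) ∘L v ∘L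
    (lp.evalCLM ℂ (fun _ : ℤ => H) 2 m)

theorem fdsUnit_apply (n m : ℤ) (v : H →L[ℂ] H) (φ : lp (fun _ : ℤ => H) 2) (j : ℤ) :
    (fdsUnit n m v φ) j = if j = n then v (φ m) else 0 := by
  have : fdsUnit n m v φ = lp.single 2 n (v (φ m)) := rfl
  rw [this]
  by_cases h : j = n
  · subst h; simp
  · rw [lp.single_apply_ne _ _ _ h, if_neg h]

theorem fdsUnit_norm (n m : ℤ) (v : H →L[ℂ] H) : ‖fdsUnit n m v‖ ≤ ‖v‖ := by
  refine ContinuousLinearMap.opNorm_le_bound _ (norm_nonneg _) fun φ => ?_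
  have : fdsUnit n m v φ = lp.single 2 n (v (φ m)) := rfl
  rw [this, lp.norm_single (by norm_num)]
  exact (v.le_opNorm _).trans (by gcongr; exact lp.norm_apply_le_norm (by norm_num) φ m)

theorem fdsUnit_range (n m : ℤ) (v : H →L[ℂ] H)
    (hv : FiniteDimensional ℂ (LinearMap.range v.toLinearMap)) :
    FiniteDimensional ℂ (LinearMap.range (fdsUnit n m v).toLinearMap) := by
  have hle : LinearMap.range (fdsUnit n m v).toLinearMap ≤ (LinearMap.range v.toLinearMap).map
      (lp.singleContinuousLinearMap ℂ (fun _ : ℤ => H) 2 n).toLinearMap := by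
    rintro _ ⟨φ, rfl⟩
    exact ⟨v (φ m), ⟨_, rfl⟩, rfl⟩
  exact Submodule.finiteDimensional_of_le hle
end

theorem fds_fin_add {X Y : Type*} [AddCommGroup X] [Module ℂ X] [AddCommGroup Y] [Module ℂ Y]
    {ι : Type*} (s : Finset ι) (f : ι → X →ₗ[ℂ] Y)
    (h : ∀ i ∈ s, FiniteDimensional ℂ (LinearMap.range (f i))) :
    FiniteDimensional ℂ (LinearMap.range (∑ i ∈ s, f i)) := by
  classical
  induction s using Finset.induction_on with
  | empty => 
    rw [Finset.sum_empty, show LinearMap.range (0 : X →ₗ[ℂ] Y) = ⊥ from LinearMap.range_zero]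
    infer_instance
  | insert i s hi ih =>
    rw [Finset.sum_insert hi]
    have h1 := h i (Finset.mem_insert_self _ _)
    have h2 := ih fun j hj => h j (Finset.mem_insert_of_mem hj)
    exact Submodule.finiteDimensional_of_le (LinearMap.range_add_le (f i) (∑ i ∈ s, f i))

section
variable {H : Type*} [NormedAddCommGroup H] [InnerProductSpace ℂ H] [CompleteSpace H]

/-- free resolvent -/
theorem fds_resolvent
    (τ : ℤ → lp (fun _ : ℤ => H) 2 →L[ℂ] lp (fun _ : ℤ => H) 2)
    (hτ : ∀ k φ n, (τ k φ) n = φ (n + k)) (ζ : ℂ) (hζ : ‖ζ‖ < 1) :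
    ∃ R, HasSum (fun k : ℤ => ζ ^ k.natAbs • τ k) R ∧
      ((1 + ζ ^ 2) • 1 - ζ • (τ 1 + τ (-1))) * R = (1 - ζ ^ 2) • 1 ∧
      R * ((1 + ζ ^ 2) • 1 - ζ • (τ 1 + τ (-1))) = (1 - ζ ^ 2) • 1 := by
  have hn : ∀ k, ‖τ k‖ ≤ 1 := fun k => fds_opnorm_le _ k 1 zero_le_one fun φ n => by
    rw [hτ, one_mul]
  have hsum : Summable (fun k : ℤ => ζ ^ k.natAbs • τ k) := by
    refine Summable.of_norm_bounded (fds_summable ‖ζ‖ (norm_nonneg _) hζ) fun k => ?_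
    rw [norm_smul, norm_pow]
    exact mul_le_of_le_one_right (by positivity) (hn k)
  have hmul : ∀ j k, τ j * τ k = τ (j + k) := by
    intro j k
    ext φ n
    rw [mul_apply_eq_comp, hτ, hτ, hτ, add_assoc]
  have h0 : τ 0 = 1 := by
    ext φ n
    rw [hτ]; simp
  have hR := hsum.hasSum
  set R := ∑' k : ℤ, ζ ^ k.natAbs • τ k
  have hcomm : ∀ j, τ j * R = R * τ j := by
    intro j
    have h1 := hR.mul_left (τ j)
    have h2 := hR.mul_right (τ j)
    refine h1.unique ?_
    convert h2 using 2 with k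
    rw [mul_smul_comm, smul_mul_assoc, hmul, hmul, add_comm]
  have hsh : ∀ j, HasSum (fun k : ℤ => ζ ^ (k - j).natAbs • τ k) (τ j * R) := by
    intro j
    have h1 := hR.mul_left (τ j)
    rw [← (Equiv.addLeft j).hasSum_iff]
    have e : (fun k : ℤ => ζ ^ (k - j).natAbs • τ k) ∘ (Equiv.addLeft j)
        = fun k : ℤ => τ j * ζ ^ k.natAbs • τ k := by
      funext k
      simp [hmul]
    rw [e]
    exact h1
  have key : ((1 + ζ ^ 2) • 1 - ζ • (τ 1 + τ (-1))) * R = (1 - ζ ^ 2) • 1 := by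
    have h1 := (hR.const_smul (1 + ζ ^ 2)).sub (((hsh 1).add (hsh (-1))).const_smul ζ)
    have h2 : HasSum (fun k : ℤ => (1 + ζ ^ 2) • ζ ^ k.natAbs • τ k
        - ζ • (ζ ^ (k - 1).natAbs • τ k + ζ ^ (k - -1).natAbs • τ k))
        ((1 - ζ ^ 2) • 1) := by
      convert hasSum_single (0 : ℤ) ?_ using 1
      · simp [h0]; module
      · intro k hk
        have : (1 + ζ ^ 2) * ζ ^ k.natAbs = ζ * (ζ ^ (k - 1).natAbs + ζ ^ (k - -1).natAbs) := by
          rcases lt_or_gt_of_ne hk with h | h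
          · obtain ⟨j, rfl⟩ : ∃ j : ℕ, k = -((j : ℤ) + 1) := ⟨(-k - 1).toNat, by omega⟩
            have e1 : (-((j : ℤ) + 1)).natAbs = j + 1 := by omega
            have e2 : (-((j : ℤ) + 1) - 1).natAbs = j + 2 := by omega
            have e3 : (-((j : ℤ) + 1) - -1).natAbs = j := by omega
            rw [e1, e2, e3]; ring
          · obtain ⟨j, rfl⟩ : ∃ j : ℕ, k = (j : ℤ) + 1 := ⟨(k - 1).toNat, by omega⟩
            have e1 : ((j : ℤ) + 1).natAbs = j + 1 := by omega
            have e2 : ((j : ℤ) + 1 - 1).natAbs = j := by omega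
            have e3 : ((j : ℤ) + 1 - -1).natAbs = j + 2 := by omega
            rw [e1, e2, e3]; ring
        rw [← add_smul, smul_smul, smul_smul, this, sub_self]
    rw [← h1.unique h2, sub_mul, smul_mul_assoc, one_mul, smul_mul_assoc, add_mul]
  refine ⟨R, hR, key, ?_⟩
  rw [← key, mul_sub, sub_mul, smul_mul_assoc, one_mul, mul_smul_comm, mul_one, mul_smul_comm,
    smul_mul_assoc, mul_add, add_mul, hcomm, hcomm]

theorem fds_polar
    (q : lp (fun _ : ℤ => H) 2 →L[ℂ] lp (fun _ : ℤ => H) 2)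
    (τ : ℤ → lp (fun _ : ℤ => H) 2 →L[ℂ] lp (fun _ : ℤ => H) 2)
    (c : ℤ → ℂ) (hq : ∀ φ n, (q φ) n = c n • φ n) (hc0 : c 0 = 1)
    (hτ : ∀ k φ n, (τ k φ) n = φ (n + k)) (s : ℂ) (hs : s = 1 ∨ s = -1)
    (G K W : lp (fun _ : ℤ => H) 2 →L[ℂ] lp (fun _ : ℤ => H) 2)
    (hG : HasSum (fun k : ℤ => s ^ k.natAbs • (q * τ k * q)) G)
    (T : H →L[ℂ] H) (hK : ∀ φ n, (K φ) n = T (φ n))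
    (hT : FiniteDimensional ℂ (LinearMap.range T.toLinearMap)) :
    FiniteDimensional ℂ (LinearMap.range (G * (K * W)).toLinearMap) := by
  have hs2 : ∀ m n : ℤ, s ^ (m - n).natAbs = s ^ n.natAbs * s ^ m.natAbs := by
    intro m n
    rcases hs with rfl | rfl
    · simp
    · rw [← pow_add]
      apply neg_one_pow_congr
      rw [Nat.even_add, Int.natAbs_even, Int.natAbs_even, Int.natAbs_even, Int.even_sub]
      tauto
  have hval : ∀ φ n, HasSum (fun m : ℤ => (s ^ n.natAbs * c n) • (s ^ m.natAbs * c m) • φ m)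
      ((G φ) n) := by
    intro φ n
    have h1 : HasSum (fun k : ℤ => s ^ k.natAbs • ((q (τ k (q φ))) n)) ((G φ) n) := (hG.mapL ((lp.evalCLM ℂ (fun _ : ℤ => H) 2 n) ∘L
      (ContinuousLinearMap.apply ℂ (lp (fun _ : ℤ => H) 2) φ)))
    rw [← (Equiv.addLeft n).hasSum_iff]
    convert h1 using 1
    funext k
    rw [hq, hτ, hq]
    have e := hs2 (n + k) n
    rw [add_sub_cancel_left] at e
    simp only [Function.comp, Equiv.coe_addLeft]
    rw [e, smul_smul, smul_smul, smul_smul]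
    congr 1; ring
  have hval' : ∀ φ n, (G φ) n = (s ^ n.natAbs * c n) • (G φ) 0 := by
    intro φ n
    have h0 := hval φ 0
    simp only [hc0, Int.natAbs_zero, pow_zero, one_mul, one_smul] at h0
    exact (hval φ n).unique (h0.const_smul _)
  have hGK : G * K = K * G := by
    have h1 := hG.mul_right K
    have h2 := hG.mul_left K
    refine h1.unique ?_
    convert h2 using 2 with k
    ext φ n
    simp only [mul_apply_eq_comp, smul_apply, hK, hq, hτ, lp.coeFn_smul, Pi.smul_apply, map_smul]
  -- evaluation at zero is injective on the range, and lands in the range of T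
  let R := LinearMap.range (G * (K * W)).toLinearMap
  let e : R →ₗ[ℂ] LinearMap.range T.toLinearMap :=
    LinearMap.codRestrict _ ((lp.evalCLM ℂ (fun _ : ℤ => H) 2 0).toLinearMap ∘ₗ R.subtype) (by
      rintro ⟨_, φ, rfl⟩
      refine ⟨(G (W φ)) 0, ?_⟩
      have : (G * (K * W)) φ = K (G (W φ)) := by rw [← mul_assoc, hGK]; rfl
      calc T ((G (W φ)) 0) = (K (G (W φ))) 0 := (hK _ _).symm
        _ = ((G * (K * W)) φ) 0 := by rw [this])
  refine FiniteDimensional.of_injective e ?_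
  rw [← LinearMap.ker_eq_bot, LinearMap.ker_eq_bot']
  rintro ⟨_, φ, rfl⟩ h
  have h0 : ((G * (K * W)) φ) 0 = 0 := congrArg Subtype.val h
  apply Subtype.ext
  ext n
  have h3 : (G (K (W φ))) n = _ := hval' (K (W φ)) n
  have h4 : (G (K (W φ))) 0 = 0 := h0
  rw [h4, smul_zero] at h3
  exact h3
end

theorem finite_discrete_spectrum
    (H : Type*) [NormedAddCommGroup H] [InnerProductSpace ℂ H] [CompleteSpace H]
    [Nontrivial H] [TopologicalSpace.SeparableSpace H]
    (γ C : ℝ) (hγ : 0 < γ) (hC : 0 < C)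
    (w : ℤ × ℤ → H →L[ℂ] H)
    (hw : ∀ n m : ℤ, ‖w (n, m)‖ ≤ C * Real.exp (-γ * (|(n : ℝ)| + |(m : ℝ)|)))
    (Λ₁ Λ₂ : H →L[ℂ] H) (hΛ₂ : IsCompactOperator Λ₂)
    (hfin : FiniteDimensional ℂ (LinearMap.range (Λ₂ ∘L Λ₁).toLinearMap))
    (H0 V : lp (fun _ : ℤ => H) 2 →L[ℂ] lp (fun _ : ℤ => H) 2)
    (hH0 : ∀ (φ : lp (fun _ : ℤ => H) 2) (n : ℤ),
      (H0 φ) n = (2 : ℂ) • φ n - φ (n + 1) - φ (n - 1))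
    (hV : ∀ (φ : lp (fun _ : ℤ => H) 2) (n : ℤ),
      HasSum (fun m : ℤ => Λ₁ (w (n, m) (Λ₂ (φ m)))) ((V φ) n)) :
    Set.Finite (spectrum ℂ (H0 + V) \
      {z : ℂ | ∃ t : ℝ, t ∈ Set.Icc (0 : ℝ) 4 ∧ z = (t : ℂ)}) := by
  -- the weight
  obtain ⟨ρ, hρ⟩ : ∃ ρ : ℝ, ρ = Real.exp (-(γ / 2)) := ⟨_, rfl⟩
  have hρ0 : 0 < ρ := by rw [hρ]; exact Real.exp_pos _
  have hρ1 : ρ < 1 := by rw [hρ]; exact (Real.exp_lt_exp.2 (by linarith : -(γ / 2) < 0)).trans_eq Real.exp_zero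
  have hρC : (ρ : ℂ) ≠ 0 := by exact_mod_cast hρ0.ne'
  have hexp : ∀ n : ℤ, Real.exp (-γ * |(n : ℝ)|) = ρ ^ n.natAbs * ρ ^ n.natAbs := by
    intro n
    rw [← pow_add, hρ, ← Real.exp_nat_mul]
    congr 1
    push_cast
    rw [Nat.cast_natAbs, Int.cast_abs]
    ring
  have hw2 : ∀ n m : ℤ, ‖w (n, m)‖ ≤
      C * ((ρ ^ n.natAbs * ρ ^ n.natAbs) * (ρ ^ m.natAbs * ρ ^ m.natAbs)) := by
    intro n m
    refine (hw n m).trans_eq ?_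
    rw [mul_add, Real.exp_add, hexp, hexp]
  -- basic operators
  have hτe : ∀ k : ℤ, ∃ T : lp (fun _ : ℤ => H) 2 →L[ℂ] lp (fun _ : ℤ => H) 2,
      ∀ φ n, (T φ) n = φ (n + k) := by
    intro k
    obtain ⟨T, hT⟩ := fds_exists_op k (fun _ => (1 : H →L[ℂ] H)) ‖(1 : H →L[ℂ] H)‖ (fun _ => le_rfl)
    exact ⟨T, fun φ n => hT φ n⟩
  choose τ hτ using hτe
  have hdiag : ∀ S : H →L[ℂ] H, ∃ T : lp (fun _ : ℤ => H) 2 →L[ℂ] lp (fun _ : ℤ => H) 2,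
      ∀ φ n, (T φ) n = S (φ n) := by
    intro S
    obtain ⟨T, hT⟩ := fds_exists_op 0 (fun _ => S) ‖S‖ (fun _ => le_rfl)
    exact ⟨T, fun φ n => by rw [hT, add_zero]⟩
  obtain ⟨a, ha⟩ := hdiag Λ₁
  obtain ⟨b, hb⟩ := hdiag Λ₂
  obtain ⟨q, hq⟩ : ∃ q : lp (fun _ : ℤ => H) 2 →L[ℂ] lp (fun _ : ℤ => H) 2,
      ∀ φ n, (q φ) n = ((ρ : ℂ) ^ n.natAbs) • φ n := by
    obtain ⟨T, hT⟩ := fds_exists_op 0 (fun n : ℤ => ((ρ : ℂ) ^ n.natAbs) • (1 : H →L[ℂ] H)) 1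
      (fun n => by
        rw [norm_smul, norm_pow, Complex.norm_real, Real.norm_of_nonneg hρ0.le, norm_one, mul_one]
        exact pow_le_one₀ hρ0.le hρ1.le)
    exact ⟨T, fun φ n => by rw [hT, add_zero]; rfl⟩
  -- the reduced kernel
  let w' : ℤ × ℤ → H →L[ℂ] H := fun p =>
    (((ρ : ℂ) ^ p.1.natAbs)⁻¹ * ((ρ : ℂ) ^ p.2.natAbs)⁻¹) • w p
  have hw' : ∀ p, ‖w' p‖ ≤ C * (ρ ^ p.1.natAbs * ρ ^ p.2.natAbs) := by
    rintro ⟨n, m⟩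
    simp only [w']
    rw [norm_smul, norm_mul, norm_inv, norm_inv, norm_pow, norm_pow, Complex.norm_real,
      Real.norm_of_nonneg hρ0.le]
    refine (mul_le_mul_of_nonneg_left (hw2 n m) (by positivity)).trans_eq ?_
    have h1 : ρ ^ n.natAbs ≠ 0 := (pow_pos hρ0 _).ne'
    have h2 : ρ ^ m.natAbs ≠ 0 := (pow_pos hρ0 _).ne'
    field_simp
  have hρs := fds_summable ρ hρ0.le hρ1
  have hρs2 : Summable (fun p : ℤ × ℤ => C * (ρ ^ p.1.natAbs * ρ ^ p.2.natAbs)) :=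
    (hρs.mul_of_nonneg hρs (fun _ => by positivity) (fun _ => by positivity)).mul_left C
  have hWs : Summable (fun p : ℤ × ℤ => fdsUnit p.1 p.2 (w' p)) :=
    Summable.of_norm_bounded hρs2 fun p => (fdsUnit_norm _ _ _).trans (hw' p)
  obtain ⟨W, hW⟩ := hWs
  -- factorisation of V
  have hVf : V = a * q * W * q * b := by
    ext φ n
    have h1 : HasSum (fun p : ℤ × ℤ => (a (q (fdsUnit p.1 p.2 (w' p) (q (b φ))))) n)
        ((a (q (W (q (b φ))))) n) :=
      hW.mapL ((lp.evalCLM ℂ (fun _ : ℤ => H) 2 n) ∘L a ∘L q ∘L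
        (ContinuousLinearMap.apply ℂ (lp (fun _ : ℤ => H) 2) (q (b φ))))
    have hinj : Function.Injective (fun m : ℤ => (n, m)) := fun x y h => (Prod.mk.inj h).2
    rw [← hinj.hasSum_iff] at h1
    · refine (hV φ n).unique ?_
      change HasSum _ ((a (q (W (q (b φ))))) n)
      convert h1 using 1
      funext m
      simp only [Function.comp, ha, hq, fdsUnit_apply, if_true, hb, w']
      rw [smul_apply]
      have h1 : (ρ : ℂ) ^ n.natAbs ≠ 0 := pow_ne_zero _ hρC
      have h2 : (ρ : ℂ) ^ m.natAbs ≠ 0 := pow_ne_zero _ hρC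
      have : (ρ : ℂ) ^ n.natAbs * (((ρ : ℂ) ^ n.natAbs)⁻¹ * ((ρ : ℂ) ^ m.natAbs)⁻¹
        * (ρ : ℂ) ^ m.natAbs) = 1 := by field_simp
      simp only [map_smul, smul_smul]
      rw [this, one_smul]
    · rintro ⟨j, m⟩ hj
      have hne : n ≠ j := by
        rintro rfl
        exact hj ⟨m, rfl⟩
      rw [ha, hq, fdsUnit_apply, if_neg hne, smul_zero, map_zero]
  -- the finite-rank-fibre operator
  let K := b * a
  have hK : ∀ φ n, (K φ) n = (Λ₂ ∘L Λ₁) (φ n) := by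
    intro φ n
    have : K φ = b (a φ) := rfl
    rw [this, hb, ha]; rfl
  have hYs : HasSum (fun p : ℤ × ℤ => K * fdsUnit p.1 p.2 (w' p)) (K * W) := hW.mul_left K
  have hKu : ∀ p : ℤ × ℤ, K * fdsUnit p.1 p.2 (w' p) = fdsUnit p.1 p.2 ((Λ₂ ∘L Λ₁) ∘L w' p) := by
    intro p
    ext φ n
    rw [mul_apply_eq_comp, hK, fdsUnit_apply, fdsUnit_apply]
    split_ifs
    · rfl
    · simp
  have hY : ∀ ε : ℝ, 0 < ε → ∃ Z : lp (fun _ : ℤ => H) 2 →L[ℂ] lp (fun _ : ℤ => H) 2,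
      FiniteDimensional ℂ (LinearMap.range Z.toLinearMap) ∧ ‖K * W - Z‖ < ε := by
    intro ε hε
    have h1 := Metric.tendsto_nhds.1 (show Filter.Tendsto _ _ _ from hYs) ε hε
    obtain ⟨s, hs⟩ := h1.exists
    refine ⟨∑ p ∈ s, K * fdsUnit p.1 p.2 (w' p), ?_, ?_⟩
    · rw [ContinuousLinearMap.toLinearMap_sum]
      refine fds_fin_add s _ fun p _ => ?_
      rw [hKu]
      apply fdsUnit_range
      have hle : LinearMap.range ((Λ₂ ∘L Λ₁) ∘L w' p).toLinearMap ≤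
          LinearMap.range (Λ₂ ∘L Λ₁).toLinearMap := by
        rintro _ ⟨x, rfl⟩
        exact ⟨w' p x, rfl⟩
      exact Submodule.finiteDimensional_of_le hle
    · rw [← dist_eq_norm, dist_comm]; exact hs
  -- the analytic family
  let G : ℂ → lp (fun _ : ℤ => H) 2 →L[ℂ] lp (fun _ : ℤ => H) 2 :=
    fun ζ => ∑' k : ℤ, ζ ^ k.natAbs • (q * τ k * q)
  have hQn : ∀ k : ℤ, ‖q * τ k * q‖ ≤ ρ ^ k.natAbs := by
    intro k
    refine fds_opnorm_le _ k _ (by positivity) fun φ n => ?_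
    have : (q * τ k * q) φ = q (τ k (q φ)) := rfl
    rw [this, hq, hτ, hq, smul_smul, norm_smul, norm_mul, norm_pow, norm_pow, Complex.norm_real,
      Real.norm_of_nonneg hρ0.le, ← pow_add]
    refine mul_le_mul_of_nonneg_right ?_ (norm_nonneg _)
    exact pow_le_pow_of_le_one hρ0.le hρ1.le (by omega)
  obtain ⟨r, hr⟩ : ∃ r : ℝ, r = (1 + ρ⁻¹) / 2 := ⟨_, rfl⟩
  have hρi : 1 < ρ⁻¹ := (one_lt_inv₀ hρ0).2 hρ1
  have hr1 : 1 < r := by rw [hr]; linarith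
  have hrρ : r * ρ = (ρ + 1) / 2 := by rw [hr]; field_simp
  have hsr := fds_summable (r * ρ) (by positivity) (by rw [hrρ]; linarith)
  have hGb : ∀ (k : ℤ) (ζ : ℂ), ζ ∈ Metric.ball (0 : ℂ) r →
      ‖ζ ^ k.natAbs • (q * τ k * q)‖ ≤ (r * ρ) ^ k.natAbs := by
    intro k ζ hζ
    have hζ' : ‖ζ‖ ≤ r := by simpa using (Metric.mem_ball.1 hζ).le
    rw [norm_smul, norm_pow, mul_pow]
    exact mul_le_mul (pow_le_pow_left₀ (norm_nonneg _) hζ' _) (hQn k) (norm_nonneg _)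
      (by positivity)
  have hGd : DifferentiableOn ℂ G (Metric.ball 0 r) := by
    refine Complex.differentiableOn_tsum_of_summable_norm hsr (fun k => ?_) Metric.isOpen_ball hGb
    have : Differentiable ℂ (fun ζ : ℂ => ζ ^ k.natAbs) := by fun_prop
    exact (this.smul_const (q * τ k * q)).differentiableOn
  have hGs : ∀ ζ ∈ Metric.ball (0 : ℂ) r,
      HasSum (fun k : ℤ => ζ ^ k.natAbs • (q * τ k * q)) (G ζ) := fun ζ hζ =>
    (Summable.of_norm_bounded hsr fun k => hGb k ζ hζ).hasSum
  have hp := fds_polar q τ (fun n => (ρ : ℂ) ^ n.natAbs) hq (by simp) hτ 1 (Or.inl rfl) (G 1) K W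
    (hGs 1 (by simpa using hr1)) (Λ₂ ∘L Λ₁) hK hfin
  have hm := fds_polar q τ (fun n => (ρ : ℂ) ^ n.natAbs) hq (by simp) hτ (-1) (Or.inr rfl) (G (-1))
    K W (hGs (-1) (by simpa using hr1)) (Λ₂ ∘L Λ₁) hK hfin
  have hfinal := fds_abstract (K * W) hY G r hr1 hGd hp hm
  refine (hfinal.image (fun ζ => 2 - ζ - ζ⁻¹)).subset ?_
  rintro z ⟨hzs, hz⟩
  obtain ⟨ζ, hζ0, hζ1, rfl⟩ := fds_zeta z hz
  refine ⟨ζ, ⟨hζ1, fun hu => ?_⟩, rfl⟩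
  apply hzs
  obtain ⟨R, hR, hPR, hRP⟩ := fds_resolvent τ hτ ζ hζ1
  have hne : 1 - ζ ^ 2 ≠ 0 := by
    intro h
    have : ζ ^ 2 = 1 := (sub_eq_zero.1 h).symm
    have h2 : ‖ζ‖ ^ 2 = 1 := by rw [← norm_pow, this, norm_one]
    nlinarith [norm_nonneg ζ]
  have hMe : H0 - algebraMap ℂ _ (2 - ζ - ζ⁻¹)
      = ζ⁻¹ • ((1 + ζ ^ 2) • 1 - ζ • (τ 1 + τ (-1))) := by
    have e1 : H0 = (2 : ℂ) • 1 - τ 1 - τ (-1) := by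
      ext φ n
      rw [hH0]
      have : (((2 : ℂ) • 1 - τ 1 - τ (-1) :
          lp (fun _ : ℤ => H) 2 →L[ℂ] lp (fun _ : ℤ => H) 2) φ) n
          = (2 : ℂ) • φ n - (τ 1 φ) n - (τ (-1) φ) n := rfl
      rw [this, hτ, hτ, ← sub_eq_add_neg]
    rw [e1, Algebra.algebraMap_eq_smul_one, smul_sub, smul_smul, smul_smul, inv_mul_cancel₀ hζ0]
    have : ζ⁻¹ * (1 + ζ ^ 2) = ζ⁻¹ + ζ := by field_simp
    rw [this]
    module
  obtain ⟨Rz, hRz⟩ : ∃ Rz, Rz = (ζ * (1 - ζ ^ 2)⁻¹) • R := ⟨_, rfl⟩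
  have hc : ζ⁻¹ * (ζ * (1 - ζ ^ 2)⁻¹) * (1 - ζ ^ 2) = 1 := by field_simp
  have hMR : (H0 - algebraMap ℂ _ (2 - ζ - ζ⁻¹)) * Rz = 1 := by
    rw [hMe, hRz, smul_mul_smul_comm, hPR, smul_smul, hc, one_smul]
  have hRM : Rz * (H0 - algebraMap ℂ _ (2 - ζ - ζ⁻¹)) = 1 := by
    rw [hMe, hRz, smul_mul_smul_comm, hRP, smul_smul, mul_comm (ζ * _) ζ⁻¹, hc, one_smul]
  have hbR : b * Rz = Rz * b := by
    have h1 := hR.mul_left b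
    have h2 := hR.mul_right b
    have : b * R = R * b := by
      refine h1.unique ?_
      convert h2 using 2 with k
      ext φ n
      simp only [mul_apply_eq_comp, smul_apply, hb, hτ, lp.coeFn_smul, Pi.smul_apply, map_smul]
    rw [hRz, mul_smul_comm, smul_mul_assoc, this]
  have hqb : q * b = b * q := by
    ext φ n
    simp only [mul_apply_eq_comp, hb, hq, map_smul]
  have hqa : q * a = a * q := by
    ext φ n
    simp only [mul_apply_eq_comp, ha, hq, map_smul]
  have hGq : q * R * q = G ζ := by
    have h1 := (hR.mul_left q).mul_right q
    refine h1.unique ?_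
    have e : (fun k : ℤ => q * ζ ^ k.natAbs • τ k * q)
        = fun k : ℤ => ζ ^ k.natAbs • (q * τ k * q) := by
      funext k
      rw [mul_smul_comm, smul_mul_assoc]
    rw [e]
    exact hGs ζ (by simp; linarith)
  have hu2 : IsUnit (1 + q * Rz * q * (b * a * W)) := by
    have e : (1 - ζ ^ 2) • (1 : lp (fun _ : ℤ => H) 2 →L[ℂ] lp (fun _ : ℤ => H) 2)
        + ζ • (G ζ * (K * W)) = (1 - ζ ^ 2) • (1 + q * Rz * q * (b * a * W)) := by
      rw [hRz, mul_smul_comm, smul_mul_assoc, hGq, smul_add, smul_mul_assoc, smul_smul]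
      congr 2
      field_simp
    rw [e] at hu
    exact (isUnit_smul_iff (Units.mk0 _ hne) _).1 hu
  have hM : IsUnit (H0 - algebraMap ℂ _ (2 - ζ - ζ⁻¹)) := isUnit_iff_exists.2 ⟨Rz, hMR, hRM⟩
  have hfin2 := fds_ring_bs _ Rz a b q W hM hMR hbR hqb hqa hu2
  rw [← hVf] at hfin2
  have := hfin2.neg
  rw [neg_add, neg_sub, ← sub_eq_add_neg, sub_sub] at this
  exact this
end

section
/- Let H be a nontrivial separable complex Hilbert space, γ > 0, C > 0, and w : ℤ × ℤ → B(H) with ‖w(n,m)‖ ≤ C·e^{−γ(|n|+|m|)} for all (n,m) ∈ ℤ². Let Λ₁ ∈ B(H), let Λ₂ ∈ B(H) be compact with the range of Λ₂ ∘ Λ₁ finite-dimensional, and let V be the bounded operator on ℓ²(ℤ,H) defined by (Vφ)(n) = ∑_{m∈ℤ} Λ₁(w(n,m)(Λ₂(φ(m)))). Assume moreover that V is selfadjoint, and set H_V := H₀ + V. Then: (i) the set σ(H_V) \ [0,4] is finite; (ii) the set of eigenvalues of H_V lying in [0,4] is finite; and (iii) every eigenvalue z of H_V has finite-dimensional eigenspace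 ker(H_V − z). -/
open Filter Topology

set_option linter.unusedSectionVars false


lemma seq_decay (b : ℕ → ℝ) (r D : ℝ) (hr0 : 0 < r) (hr1 : r < 1)
    (hb : Tendsto b atTop (𝓝 0)) (h : ∀ k, b k ≤ b (k + 1) + D * r ^ k) (k : ℕ) :
    b k ≤ D / (1 - r) * r ^ k := by
  have h1 : (1 - r) ≠ 0 := by linarith
  have key : ∀ j, b k ≤ b (k + j) + D / (1 - r) * (r ^ k - r ^ (k + j)) := by
    intro j
    induction j with
    | zero => simp
    | succ j ih =>
      have h2 := h (k + j)
      have h3 : D * r ^ (k + j) = D / (1 - r) * (r ^ (k + j) - r ^ (k + (j + 1))) := by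
        field_simp
        ring
      rw [← add_assoc] at *
      linarith
  have h2 : Tendsto (fun j => b (k + j) + D / (1 - r) * (r ^ k - r ^ (k + j))) atTop
      (𝓝 (0 + D / (1 - r) * (r ^ k - 0))) := by
    have e : Tendsto (fun j => k + j) atTop atTop := tendsto_atTop_mono (fun j => by simp) tendsto_id
    refine (hb.comp e).add (Tendsto.const_mul _ (tendsto_const_nhds.sub ?_))
    exact (tendsto_pow_atTop_nhds_zero_of_lt_one hr0.le hr1).comp e
  have := ge_of_tendsto' h2 key
  simpa using this

lemma int_decay (a : ℤ → ℝ) (r D : ℝ) (hr0 : 0 < r) (hr1 : r < 1)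
    (ha : Tendsto a cofinite (𝓝 0)) (h : ∀ n, |a (n + 1) - a n| ≤ D * r ^ n.natAbs) (n : ℤ) :
    a n ≤ D / (1 - r) * r ^ n.natAbs := by
  have hD : 0 ≤ D := by
    have := (abs_nonneg _).trans (h 0)
    simpa using this
  obtain ⟨k, rfl | rfl⟩ := n.eq_nat_or_neg
  · have := seq_decay (fun k : ℕ => a k) r D hr0 hr1 ?_ ?_ k
    · simpa using this
    · have e : Tendsto (fun k : ℕ => (k : ℤ)) atTop cofinite := by
        rw [← Nat.cofinite_eq_atTop]
        exact Nat.cast_injective.tendsto_cofinite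
      exact ha.comp e
    · intro k
      have := (abs_le.1 (h k)).1
      simp at this ⊢
      linarith
  · have := seq_decay (fun k : ℕ => a (-k)) r D hr0 hr1 ?_ ?_ k
    · simpa using this
    · have e : Tendsto (fun k : ℕ => (-k : ℤ)) atTop cofinite := by
        rw [← Nat.cofinite_eq_atTop]
        exact (neg_injective.comp Nat.cast_injective).tendsto_cofinite
      exact ha.comp e
    · intro k
      have h1 := (abs_le.1 (h (-(k + 1 : ℕ) : ℤ))).2
      have e1 : (-(k + 1 : ℕ) + 1 : ℤ) = -k := by push_cast; ring
      rw [e1] at h1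
      have h2 : (-((k + 1 : ℕ) : ℤ)).natAbs = k + 1 := by omega
      rw [h2] at h1
      have h3 : r ^ (k + 1) ≤ r ^ k := pow_le_pow_of_le_one hr0.le hr1.le (by omega)
      have h4 := mul_le_mul_of_nonneg_left h3 hD
      linarith

lemma exists_unit (t : ℝ) (h0 : 0 ≤ t) (h4 : t ≤ 4) :
    ∃ ξ η : ℂ, ‖ξ‖ = 1 ∧ ‖η‖ = 1 ∧ ξ * η = 1 ∧ ξ + η = 2 - t := by
  set c : ℝ := 1 - t / 2 with hc
  set s : ℝ := Real.sqrt (1 - c ^ 2) with hs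
  have hcs : c ^ 2 + s ^ 2 = 1 := by
    rw [hs, Real.sq_sqrt]
    · ring
    · nlinarith
  have hn : ∀ x y : ℝ, x ^ 2 + y ^ 2 = 1 → ‖(⟨x, y⟩ : ℂ)‖ = 1 := by
    intro x y hxy
    rw [Complex.norm_eq_sqrt_sq_add_sq]
    simp [hxy]
  refine ⟨⟨c, s⟩, ⟨c, -s⟩, hn _ _ hcs, hn _ _ (by linarith), ?_, ?_⟩
  · apply Complex.ext <;> simp <;> nlinarith
  · apply Complex.ext <;> simp [hc]; ring

abbrev L2 (H : Type*) [NormedAddCommGroup H] := lp (fun _ : ℤ => H) 2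

section
variable {H : Type*} [NormedAddCommGroup H] [InnerProductSpace ℂ H]

lemma l2_summable (φ : L2 H) : Summable (fun n => ‖φ n‖ ^ 2) := by
  have := (lp.hasSum_norm (p := 2) (by norm_num) φ).summable
  simpa using this

lemma l2_hasSum (φ : L2 H) : HasSum (fun n => ‖φ n‖ ^ 2) (‖φ‖ ^ 2) := by
  have := (lp.hasSum_norm (p := 2) (by norm_num) φ)
  simpa using this

lemma l2_tendsto (φ : L2 H) : Tendsto (fun n => ‖φ n‖) cofinite (𝓝 0) := by
  have h := (l2_summable φ).tendsto_cofinite_zero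
  have h2 := (Real.continuous_sqrt.tendsto 0).comp h
  simpa [Function.comp_def, Real.sqrt_sq] using h2

lemma tail_decay (φ : ℤ → H) (hφ : Tendsto (fun n => ‖φ n‖) cofinite (𝓝 0))
    (t : ℝ) (h0 : 0 ≤ t) (h4 : t ≤ 4) (r D : ℝ) (hr0 : 0 < r)
    (hr1 : r < 1)
    (h : ∀ n, ‖((2 : ℂ) - t) • φ n - φ (n + 1) - φ (n - 1)‖ ≤ D * r ^ n.natAbs) (n : ℤ) :
    ‖φ n‖ ≤ D / r / (1 - r) / (1 - r) * r ^ n.natAbs := by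
  obtain ⟨ξ, η, hξ, hη, hξη, hsum⟩ := exists_unit t h0 h4
  have hD : 0 ≤ D := by
    have := (norm_nonneg _).trans (h 0)
    simpa using this
  have hsh : Tendsto (fun n => ‖φ (n + 1)‖) cofinite (𝓝 0) :=
    hφ.comp (add_left_injective (1 : ℤ)).tendsto_cofinite
  have hu : ∀ n, ‖φ (n + 1) - ξ • φ n‖ ≤ D / r / (1 - r) * r ^ n.natAbs := by
    apply int_decay _ _ _ hr0 hr1
    · refine squeeze_zero (fun n => norm_nonneg _) (fun n => norm_sub_le _ _) ?_
      simpa [norm_smul, hξ] using hsh.add hφ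
    · intro n
      have e : ‖φ (n + 1) - ξ • φ n‖ = ‖η • (φ (n + 1) - ξ • φ n)‖ := by
        rw [norm_smul, hη, one_mul]
      rw [e]
      refine (abs_norm_sub_norm_le _ _).trans ?_
      have e2 : φ (n + 1 + 1) - ξ • φ (n + 1) - η • (φ (n + 1) - ξ • φ n)
          = - (((2 : ℂ) - t) • φ (n + 1) - φ (n + 1 + 1) - φ (n + 1 - 1)) := by
        rw [← hsum, smul_sub, smul_smul, mul_comm η ξ, hξη, one_smul, add_smul]
        simp only [add_sub_cancel_right]
        abel
      rw [e2, norm_neg]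
      refine (h (n + 1)).trans ?_
      have h3 : r * r ^ (n + 1).natAbs ≤ r ^ n.natAbs := by
        rw [← pow_succ']
        exact pow_le_pow_of_le_one hr0.le hr1.le (by omega)
      have h4 : D * r ^ (n + 1).natAbs = D / r * (r * r ^ (n + 1).natAbs) := by
        field_simp
      rw [h4]
      exact mul_le_mul_of_nonneg_left h3 (by positivity)
  refine int_decay _ _ _ hr0 hr1 hφ ?_ n
  intro n
  have e : ‖φ n‖ = ‖ξ • φ n‖ := by rw [norm_smul, hξ, one_mul]
  rw [e]
  exact (abs_norm_sub_norm_le _ _).trans (hu n)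

lemma form_hasSum (H0 : L2 H →L[ℂ] L2 H) (ε : ℝ) (hε : ε ^ 2 = 1)
    (hH0 : ∀ (φ : L2 H) (n : ℤ),
      (H0 φ) n = (2 : ℂ) • φ n - (ε : ℂ) • φ (n + 1) - (ε : ℂ) • φ (n - 1)) (φ ψ : L2 H) :
    HasSum (fun n => inner ℂ (φ (n + 1) - (ε : ℂ) • φ n) (ψ (n + 1) - (ε : ℂ) • ψ n))
      (inner ℂ (H0 φ) ψ) := by
  have h1 := lp.hasSum_inner (𝕜 := ℂ) (H0 φ) ψ
  have ha := lp.hasSum_inner (𝕜 := ℂ) φ ψ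
  have ha' := (Equiv.addRight (1 : ℤ)).hasSum_iff.2 ha
  have hs : Summable (fun n => inner ℂ (φ (n - 1)) (ψ n)) := by
    refine Summable.of_norm_bounded (g := fun n => ‖φ (n - 1)‖ ^ 2 + ‖ψ n‖ ^ 2) ?_ ?_
    · exact ((Equiv.subRight (1 : ℤ)).summable_iff.2 (l2_summable φ)).add (l2_summable ψ)
    · intro n
      refine (norm_inner_le_norm _ _).trans ?_
      nlinarith [sq_nonneg (‖φ (n - 1)‖ - ‖ψ n‖), sq_nonneg (‖φ (n - 1)‖), sq_nonneg (‖ψ n‖)]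
  obtain ⟨b, hb⟩ := hs
  have hb' := (Equiv.addRight (1 : ℤ)).hasSum_iff.2 hb
  have h3 := ((h1.add ha').sub ha).add ((hb.sub hb').mul_left (ε : ℂ))
  have e : inner ℂ (H0 φ) ψ = inner ℂ (H0 φ) ψ + inner ℂ φ ψ - inner ℂ φ ψ + (ε : ℂ) * (b - b) := by
    ring
  rw [e]
  refine h3.congr_fun ?_
  intro n
  have hε2 : (ε : ℂ) * ε = 1 := by rw [← pow_two]; exact_mod_cast hε
  simp only [hH0, Function.comp, Equiv.coe_addRight, add_sub_cancel_right, inner_sub_left, inner_sub_right,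
    inner_smul_left, inner_smul_right, Complex.conj_ofReal, Complex.conj_ofNat]
  linear_combination (inner ℂ (φ n) (ψ n)) * hε2

end

lemma summable_natAbs_of (f : ℕ → ℝ) (hf : Summable f) : Summable (fun n : ℤ => f n.natAbs) := by
  apply Summable.of_nat_of_neg <;> simpa using hf

lemma summable_r (r : ℝ) (hr0 : 0 < r) (hr1 : r < 1) : Summable (fun n : ℤ => r ^ n.natAbs) :=
  summable_natAbs_of (fun n => r ^ n) (summable_geometric_of_lt_one hr0.le hr1)

lemma summable_nr (r : ℝ) (hr0 : 0 < r) (hr1 : r < 1) :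
    Summable (fun n : ℤ => (n.natAbs : ℝ) * r ^ n.natAbs) := by
  apply summable_natAbs_of (fun n => (n : ℝ) * r ^ n)
  have := summable_pow_mul_geometric_of_norm_lt_one 1 (r := r) (by
    rw [Real.norm_eq_abs, abs_of_pos hr0]; exact hr1)
  simpa using this

lemma tail_small (g : ℤ → ℝ) (hg : Summable g) (δ : ℝ) (hδ : 0 < δ) :
    ∃ s : Finset ℤ, 0 ∈ s ∧ Summable (Set.indicator (↑s)ᶜ g) ∧ ∑' n, Set.indicator (↑s)ᶜ g n ≤ δ := by
  have h := tendsto_tsum_compl_atTop_zero g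
  have h1 := (h.eventually (gt_mem_nhds hδ)).and (eventually_ge_atTop ({0} : Finset ℤ))
  obtain ⟨s, hs, hs0⟩ := h1.exists
  refine ⟨s, by simpa using hs0, hg.indicator _, ?_⟩
  rw [← tsum_subtype]
  exact hs.le

/-- The potential acts fiberwise on a finite-dimensional subspace. -/
structure Pot {H : Type*} [NormedAddCommGroup H] [InnerProductSpace ℂ H] (K : Submodule ℂ H)
    (v : ℤ → ℤ → H →L[ℂ] H) (C r : ℝ) (V : L2 H →L[ℂ] L2 H) : Prop where
  hC : 0 < C
  hr0 : 0 < r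
  hr1 : r < 1
  hv : ∀ n m, ‖v n m‖ ≤ C * (r ^ n.natAbs * r ^ m.natAbs)
  hK : ∀ n m x, v n m x ∈ K
  hK' : ∀ n m, ∀ x ∈ Kᗮ, v n m x = 0
  hV : ∀ (φ : L2 H) (n : ℤ), HasSum (fun m => v n m (φ m)) (V φ n)

section
variable {H : Type*} [NormedAddCommGroup H] [InnerProductSpace ℂ H]
  {K : Submodule ℂ H} [FiniteDimensional ℂ K]
  {v : ℤ → ℤ → H →L[ℂ] H} {C r : ℝ} {V : L2 H →L[ℂ] L2 H}

lemma Pot.bound (h : Pot K v C r V) :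
    ∃ D : ℝ, 0 ≤ D ∧ ∀ φ n, ‖V φ n‖ ≤ D * ‖φ‖ * r ^ n.natAbs := by
  have hs := summable_r r h.hr0 h.hr1
  refine ⟨C * ∑' n : ℤ, r ^ n.natAbs, ?_, ?_⟩
  · exact mul_nonneg h.hC.le (tsum_nonneg fun n => pow_nonneg h.hr0.le _)
  · intro φ n
    have h1 := hs.hasSum.mul_left (C * ‖φ‖ * r ^ n.natAbs)
    have h2 := (h.hV φ n).norm_le_of_bounded h1 (fun m => by
      refine (ContinuousLinearMap.le_opNorm _ _).trans ?_
      have h3 : ‖φ m‖ ≤ ‖φ‖ := lp.norm_apply_le_norm (by norm_num) φ m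
      calc _ ≤ (C * (r ^ n.natAbs * r ^ m.natAbs)) * ‖φ‖ :=
            mul_le_mul (h.hv n m) h3 (norm_nonneg _) ((norm_nonneg _).trans (h.hv n m))
        _ = _ := by ring)
    refine h2.trans (le_of_eq ?_)
    ring

lemma Pot.mem (h : Pot K v C r V) (φ n) : V φ n ∈ K := by
  refine K.closed_of_finiteDimensional.mem_of_tendsto (h.hV φ n) (Eventually.of_forall fun s => ?_)
  exact K.sum_mem fun m _ => h.hK n m _

lemma Pot.compact [CompleteSpace H] (h : Pot K v C r V) : IsCompactOperator V := by
  obtain ⟨D, hD, hb⟩ := h.bound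
  let G : ℤ → L2 H →L[ℂ] L2 H := fun n =>
    (lp.singleContinuousLinearMap ℂ (fun _ : ℤ => H) 2 n).comp
      ((lp.evalCLM ℂ (fun _ : ℤ => H) 2 n).comp V)
  have hG : ∀ n φ, G n φ = lp.single 2 n (V φ n) := fun n φ => rfl
  have hGn : ∀ n, ‖G n‖ ≤ D * r ^ n.natAbs := by
    intro n
    refine ContinuousLinearMap.opNorm_le_bound _ (mul_nonneg hD (pow_nonneg h.hr0.le _)) fun φ => ?_
    rw [hG, lp.norm_single (by norm_num)]
    refine (hb φ n).trans (le_of_eq (by ring))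
  have hsum : Summable G := Summable.of_norm_bounded ((summable_r r h.hr0 h.hr1).mul_left D) hGn
  have hV : V = ∑' n, G n := by
    ext1 φ
    have h1 := hsum.hasSum.mapL (ContinuousLinearMap.apply ℂ (L2 H) φ)
    have h2 := lp.hasSum_single (p := 2) (by norm_num) (V φ)
    exact h2.unique h1
  have hGc : ∀ n, IsCompactOperator (G n) := by
    intro n
    let A : L2 H →L[ℂ] K := ((lp.evalCLM ℂ (fun _ : ℤ => H) 2 n).comp V).codRestrict K
      (fun φ => h.mem φ n)
    have : IsCompactOperator A := by
      have : ProperSpace K := FiniteDimensional.proper ℂ K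
      exact isCompactOperator_of_locallyCompactSpace_dom A
    exact this.clm_comp ((lp.singleContinuousLinearMap ℂ (fun _ : ℤ => H) 2 n).comp K.subtypeL)
  rw [hV]
  refine isCompactOperator_of_tendsto hsum.hasSum (Eventually.of_forall fun s => ?_)
  induction s using Finset.induction_on with
  | empty => simpa using isCompactOperator_zero
  | insert a s ha ih =>
    rw [Finset.sum_insert ha]
    exact (hGc a).add ih

lemma Pot.embedded [CompleteSpace H] (h : Pot K v C r V) (H0 : L2 H →L[ℂ] L2 H)
    (hH0 : ∀ (φ : L2 H) (n : ℤ), (H0 φ) n = (2 : ℂ) • φ n - φ (n + 1) - φ (n - 1)) :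
    ∃ s : Finset ℤ, ∀ t : ℝ, 0 ≤ t → t ≤ 4 → ∀ φ : L2 H, (H0 + V) φ = (t : ℂ) • φ →
      (∀ n, φ n ∈ K) ∧ ‖φ‖ ^ 2 ≤ 2 * ∑ n ∈ s, ‖φ n‖ ^ 2 := by
  obtain ⟨D, hD, hb⟩ := h.bound
  have hr0 := h.hr0
  have hr1 := h.hr1
  have h1r : 0 < 1 - r := by linarith
  set E := D / r / (1 - r) / (1 - r) with hE
  have hE0 : 0 ≤ E := by positivity
  have hs2 : Summable (fun n : ℤ => E ^ 2 * r ^ n.natAbs) := (summable_r r hr0 hr1).mul_left _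
  obtain ⟨s, -, hs, hs'⟩ := tail_small _ hs2 (1 / 2) (by norm_num)
  refine ⟨s, fun t h0 h4 φ hφ => ?_⟩
  have heq : ∀ n, ((2 : ℂ) - t) • φ n - φ (n + 1) - φ (n - 1) = - V φ n := by
    intro n
    have h1 : (H0 φ) n + (V φ) n = (t : ℂ) • φ n := by
      exact congrArg (fun ψ : L2 H => ψ n) hφ
    rw [hH0] at h1
    rw [sub_smul, ← h1]
    abel
  constructor
  · intro n
    have key := tail_decay (fun n => φ n - K.starProjection (φ n)) ?_ t h0 h4 r 0 hr0 hr1 ?_ n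
    · have k2 : φ n - K.starProjection (φ n) = 0 := by
        rw [← norm_le_zero_iff]
        simpa using key
      exact Submodule.starProjection_eq_self_iff.1 (sub_eq_zero.1 k2).symm
    · refine squeeze_zero (fun n => norm_nonneg _) (fun n => norm_sub_le _ _) ?_
      have h1 := l2_tendsto φ
      have h2 : Tendsto (fun n => ‖K.starProjection (φ n)‖) cofinite (𝓝 0) :=
        squeeze_zero (fun n => norm_nonneg _) (fun n => K.norm_starProjection_apply_le _) h1
      simpa using h1.add h2
    · intro n
      have h1 := heq n
      have h2 := congrArg K.starProjection h1
      simp only [map_sub, map_smul, map_neg] at h2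
      rw [Submodule.starProjection_eq_self_iff.2 (h.mem φ n), ← h1] at h2
      rw [zero_mul, norm_le_zero_iff]
      have h3 := sub_eq_zero.2 h2.symm
      rw [← h3]
      simp only [smul_sub]
      abel
  · have hdec : ∀ n, ‖φ n‖ ≤ E * ‖φ‖ * r ^ n.natAbs := by
      intro n
      have := tail_decay φ (l2_tendsto φ) t h0 h4 r (D * ‖φ‖) hr0 hr1 (fun n => by
        rw [heq, norm_neg]; exact hb φ n) n
      refine this.trans (le_of_eq ?_)
      rw [hE]; ring
    have h1 := (l2_hasSum φ)
    have h2 : ‖φ‖ ^ 2 = ∑ n ∈ s, ‖φ n‖ ^ 2 + ∑' n, Set.indicator (↑s)ᶜ (fun n => ‖φ n‖ ^ 2) n := by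
      rw [← h1.tsum_eq, ← tsum_subtype]
      exact (h1.summable.sum_add_tsum_compl (s := s)).symm
    have h3 : ∑' n, Set.indicator (↑s)ᶜ (fun n => ‖φ n‖ ^ 2) n ≤ ‖φ‖ ^ 2 * (1 / 2) := by
      refine le_trans ?_ (mul_le_mul_of_nonneg_left hs' (sq_nonneg _))
      rw [← tsum_mul_left]
      refine Summable.tsum_le_tsum ?_ (h1.summable.indicator _) (hs.mul_left _)
      intro n
      by_cases hn : n ∈ ((↑s)ᶜ : Set ℤ)
      · simp only [Set.indicator_of_mem hn]
        have p1 : r ^ n.natAbs ≤ 1 := pow_le_one₀ hr0.le hr1.le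
        have p0 : 0 ≤ r ^ n.natAbs := pow_nonneg hr0.le _
        calc ‖φ n‖ ^ 2 ≤ (E * ‖φ‖ * r ^ n.natAbs) ^ 2 := pow_le_pow_left₀ (norm_nonneg _) (hdec n) 2
          _ = (‖φ‖ ^ 2 * (E ^ 2 * r ^ n.natAbs)) * r ^ n.natAbs := by ring
          _ ≤ (‖φ‖ ^ 2 * (E ^ 2 * r ^ n.natAbs)) * 1 := mul_le_mul_of_nonneg_left p1 (by positivity)
          _ = _ := by ring
      · simp [Set.indicator_of_notMem hn]
    linarith

lemma Pot.form_bound (h : Pot K v C r V) :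
    ∃ s : Finset ℤ, ∀ (ε : ℝ) (Q : L2 H →L[ℂ] L2 H), (ε = 1 ∨ ε = -1) →
      (∀ (φ : L2 H) (n : ℤ),
        (Q φ) n = (2 : ℂ) • φ n - (ε : ℂ) • φ (n + 1) - (ε : ℂ) • φ (n - 1)) →
      ∀ φ : L2 H, (∀ n ∈ s, K.starProjection (φ n) = 0) →
        |(inner ℂ (V φ) φ).re| ≤ (inner ℂ (Q φ) φ).re := by
  have hC := h.hC
  have hr0 := h.hr0
  obtain ⟨s, hs0, hs, hs'⟩ := tail_small _ (summable_nr r h.hr0 h.hr1) (1 / (C + 1)) (by positivity)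
  set f : ℤ → ℝ := Set.indicator (↑s)ᶜ (fun n : ℤ => (n.natAbs : ℝ) * r ^ n.natAbs) with hf
  have hf0 : ∀ n, 0 ≤ f n := fun n => Set.indicator_nonneg (fun n _ => by positivity) n
  refine ⟨s, fun ε Q hε hQ φ hφ => ?_⟩
  have hε2 : ε ^ 2 = 1 := by rcases hε with rfl | rfl <;> norm_num
  have hε1 : ‖(ε : ℂ)‖ = 1 := by rcases hε with rfl | rfl <;> simp
  have hsum := form_hasSum Q ε hε2 hQ φ φ
  have hsum' : HasSum (fun n => ‖φ (n + 1) - (ε : ℂ) • φ n‖ ^ 2) (inner ℂ (Q φ) φ).re := by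
    have := hsum.mapL Complex.reCLM
    refine this.congr_fun fun n => ?_
    rw [Complex.reCLM_apply]
    exact (inner_self_eq_norm_sq (𝕜 := ℂ) _).symm
  set B := (inner ℂ (Q φ) φ).re with hB
  have hB0 : 0 ≤ B := hsum'.nonneg fun n => sq_nonneg _
  set A := Real.sqrt B with hA
  have hA0 : 0 ≤ A := Real.sqrt_nonneg _
  have hAB : A * A = B := Real.mul_self_sqrt hB0
  have hstep : ∀ n, ‖φ (n + 1) - (ε : ℂ) • φ n‖ ≤ A := fun n =>
    Real.le_sqrt_of_sq_le (le_hasSum hsum' n fun j _ => sq_nonneg _)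
  have hstepP : ∀ n, |‖K.starProjection (φ (n + 1))‖ - ‖K.starProjection (φ n)‖| ≤ A := by
    intro n
    have e : ‖K.starProjection (φ n)‖ = ‖(ε : ℂ) • K.starProjection (φ n)‖ := by
      rw [norm_smul, hε1, one_mul]
    rw [e]
    refine (abs_norm_sub_norm_le _ _).trans ?_
    rw [← map_smul, ← map_sub]
    exact (K.norm_starProjection_apply_le _).trans (hstep n)
  have hgrow : ∀ n : ℤ, ‖K.starProjection (φ n)‖ ≤ n.natAbs * A := by
    intro n
    obtain ⟨k, rfl | rfl⟩ := n.eq_nat_or_neg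
    · induction k with
      | zero => simp [hφ 0 hs0]
      | succ k ih =>
        have := (abs_le.1 (hstepP k)).2
        rw [Int.natAbs_natCast] at ih ⊢
        simp at ih this ⊢
        linarith
    · induction k with
      | zero => simp [hφ 0 hs0]
      | succ k ih =>
        have := (abs_le.1 (hstepP (-(k + 1 : ℕ) : ℤ))).1
        have e1 : (-(k + 1 : ℕ) + 1 : ℤ) = -k := by push_cast; ring
        rw [e1] at this
        have h2 : (-((k + 1 : ℕ) : ℤ)).natAbs = k + 1 := by omega
        rw [h2]
        simp at ih this ⊢
        linarith
  have hPf : ∀ n : ℤ, r ^ n.natAbs * ‖K.starProjection (φ n)‖ ≤ A * f n := by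
    intro n
    by_cases hn : n ∈ s
    · rw [hφ n hn]
      simpa using mul_nonneg hA0 (hf0 n)
    · rw [hf, Set.indicator_of_mem (by simpa using hn)]
      have := mul_le_mul_of_nonneg_left (hgrow n) (pow_nonneg hr0.le n.natAbs)
      refine this.trans (le_of_eq (by ring))
  set τ := ∑' n, f n with hτ
  have hτ0 : 0 ≤ τ := tsum_nonneg hf0
  have hfs : HasSum f τ := hs.hasSum
  have hVn : ∀ n, ‖V φ n‖ ≤ C * A * τ * r ^ n.natAbs := by
    intro n
    have h1 := hfs.mul_left (C * A * r ^ n.natAbs)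
    have h2 := (h.hV φ n).norm_le_of_bounded h1 (fun m => by
      have e : v n m (φ m) = v n m (K.starProjection (φ m)) := by
        have := h.hK' n m _ (K.sub_starProjection_mem_orthogonal (φ m))
        rw [map_sub] at this
        exact sub_eq_zero.1 this
      rw [e]
      refine (ContinuousLinearMap.le_opNorm _ _).trans ?_
      calc _ ≤ (C * (r ^ n.natAbs * r ^ m.natAbs)) * ‖K.starProjection (φ m)‖ :=
            mul_le_mul_of_nonneg_right (h.hv n m) (norm_nonneg _)
        _ = C * r ^ n.natAbs * (r ^ m.natAbs * ‖K.starProjection (φ m)‖) := by ring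
        _ ≤ C * r ^ n.natAbs * (A * f m) := mul_le_mul_of_nonneg_left (hPf m) (by positivity)
        _ = _ := by ring)
    refine h2.trans (le_of_eq ?_)
    ring
  have hin : ‖inner ℂ (V φ) φ‖ ≤ (C * A * τ * A) * τ := by
    refine (lp.hasSum_inner (𝕜 := ℂ) (V φ) φ).norm_le_of_bounded (hfs.mul_left (C * A * τ * A)) fun n => ?_
    have e : inner ℂ (V φ n) (φ n) = inner ℂ (V φ n) (K.starProjection (φ n)) := by
      have := K.sub_starProjection_mem_orthogonal (φ n) (V φ n) (h.mem φ n)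
      rw [inner_sub_right] at this
      exact sub_eq_zero.1 this
    rw [e]
    refine (norm_inner_le_norm _ _).trans ?_
    calc _ ≤ (C * A * τ * r ^ n.natAbs) * ‖K.starProjection (φ n)‖ :=
          mul_le_mul_of_nonneg_right (hVn n) (norm_nonneg _)
      _ = C * A * τ * (r ^ n.natAbs * ‖K.starProjection (φ n)‖) := by ring
      _ ≤ C * A * τ * (A * f n) := mul_le_mul_of_nonneg_left (hPf n) (by positivity)
      _ = _ := by ring
  refine (Complex.abs_re_le_norm _).trans (hin.trans ?_)
  have hτ1 : τ * (C + 1) ≤ 1 := by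
    have := mul_le_mul_of_nonneg_right hs' (show 0 ≤ C + 1 by positivity)
    rwa [one_div, inv_mul_cancel₀ (by positivity)] at this
  have hτC : τ * C ≤ 1 := by nlinarith
  have hτ2 : τ ≤ 1 := by nlinarith
  calc C * A * τ * A * τ = (τ * C) * τ * (A * A) := by ring
    _ ≤ 1 * 1 * (A * A) := by gcongr
    _ = B := by rw [hAB]; ring

end

section generic
variable {E : Type*} [NormedAddCommGroup E] [InnerProductSpace ℂ E]
  {W : Type*} [AddCommGroup W] [Module ℂ W] [FiniteDimensional ℂ W]

lemma eig_orth (B : E →L[ℂ] E) (hB : ∀ x y, inner ℂ (B x) y = inner ℂ x (B y))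
    {a b : ℝ} (hab : a ≠ b) {x y : E} (hx : B x = (a : ℂ) • x) (hy : B y = (b : ℂ) • y) :
    inner ℂ x y = 0 := by
  have h := hB x y
  rw [hx, hy, inner_smul_left, inner_smul_right, Complex.conj_ofReal] at h
  have h2 : ((a : ℂ) - b) * inner ℂ x y = 0 := by rw [sub_mul, h, sub_self]
  rcases mul_eq_zero.1 h2 with h3 | h3
  · exact absurd (by exact_mod_cast sub_eq_zero.1 h3) hab
  · exact h3

lemma eig_real (B : E →L[ℂ] E) (hB : ∀ x y, inner ℂ (B x) y = inner ℂ x (B y))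
    {z : ℂ} {x : E} (hx0 : x ≠ 0) (hx : B x = z • x) : z = (z.re : ℂ) := by
  have h := hB x x
  rw [hx, inner_smul_left, inner_smul_right] at h
  have h2 := mul_right_cancel₀ (inner_self_ne_zero.2 hx0) h
  exact (Complex.conj_eq_iff_re.1 h2).symm

lemma neg_finite (B : E →L[ℂ] E) (hB : ∀ x y, inner ℂ (B x) y = inner ℂ x (B y))
    (T : E →ₗ[ℂ] W) (hT : ∀ x, T x = 0 → 0 ≤ (inner ℂ (B x) x).re) :
    Set.Finite {t : ℝ | t < 0 ∧ ∃ x, x ≠ 0 ∧ B x = (t : ℂ) • x} := by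
  set S := {t : ℝ | t < 0 ∧ ∃ x, x ≠ 0 ∧ B x = (t : ℂ) • x} with hS
  choose f hf0 hf using fun t : S => t.2.2
  have hli : LinearIndependent ℂ (fun t : S => T (f t)) := by
    rw [linearIndependent_iff']
    intro u c hc
    set x := ∑ t ∈ u, c t • f t with hx
    have hTx : T x = 0 := by rw [hx, map_sum, ← hc]; simp
    have h1 := hT x hTx
    have h2 : inner ℂ (B x) x = ((∑ t ∈ u, (t : ℝ) * (‖c t‖ ^ 2 * ‖f t‖ ^ 2) : ℝ) : ℂ) := by
      have hBx : B x = ∑ t ∈ u, ((t : ℝ) : ℂ) • c t • f t := by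
        rw [hx, map_sum]
        refine Finset.sum_congr rfl fun t _ => ?_
        rw [map_smul, hf, smul_comm]
      rw [hBx, sum_inner, Complex.ofReal_sum]
      refine Finset.sum_congr rfl fun t ht => ?_
      rw [hx, inner_sum, Finset.sum_eq_single t]
      · rw [inner_smul_left, inner_self_eq_norm_sq_to_K, norm_smul]
        simp
        left; ring
      · intro b _ hbt
        have : (t : ℝ) ≠ b := fun e => hbt (Subtype.ext e.symm)
        rw [inner_smul_left, inner_smul_left, inner_smul_right, eig_orth B hB this (hf t) (hf b)]
        simp only [mul_zero]
      · intro h; exact absurd ht h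
    rw [h2, Complex.ofReal_re] at h1
    have hnp : ∀ t ∈ u, (t : ℝ) * (‖c t‖ ^ 2 * ‖f t‖ ^ 2) ≤ 0 := fun t _ =>
      mul_nonpos_of_nonpos_of_nonneg t.2.1.le (by positivity)
    have h3 := (Finset.sum_eq_zero_iff_of_nonpos hnp).1 (le_antisymm (Finset.sum_nonpos hnp) h1)
    intro t ht
    have h4 := h3 t ht
    have h5 : (t : ℝ) ≠ 0 := t.2.1.ne
    have h6 : ‖f t‖ ≠ 0 := norm_ne_zero_iff.2 (hf0 t)
    simpa [h5, hf0 t] using h4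
  exact Set.finite_coe_iff.1 hli.finite

lemma neg_ker (B : E →L[ℂ] E)
    (T : E →ₗ[ℂ] W) (hT : ∀ x, T x = 0 → 0 ≤ (inner ℂ (B x) x).re) (t : ℝ) (ht : t < 0)
    (x : E) (hx : B x = (t : ℂ) • x) (hTx : T x = 0) : x = 0 := by
  have h := hT x hTx
  rw [hx, inner_smul_left, Complex.conj_ofReal, Complex.re_ofReal_mul] at h
  have h1 : (inner ℂ x x).re = ‖x‖ ^ 2 := inner_self_eq_norm_sq (𝕜 := ℂ) x
  rw [h1] at h
  by_contra hx0
  have : 0 < ‖x‖ ^ 2 := by positivity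
  nlinarith

lemma ker_fin (B : E →L[ℂ] E) (z : ℂ) (T : E →ₗ[ℂ] W)
    (h : ∀ x, B x = z • x → T x = 0 → x = 0) :
    FiniteDimensional ℂ (LinearMap.ker (B - z • (1 : E →L[ℂ] E)).toLinearMap) := by
  refine FiniteDimensional.of_injective (T.domRestrict (LinearMap.ker (B - z • (1 : E →L[ℂ] E)).toLinearMap)) ?_
  rw [← LinearMap.ker_eq_bot, LinearMap.ker_eq_bot']
  rintro ⟨x, hx⟩ hTx
  refine Subtype.ext (h x ?_ hTx)
  have : B x - z • x = 0 := hx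
  exact sub_eq_zero.1 this

lemma spec_eig [CompleteSpace E] (A V : E →L[ℂ] E) (hV : IsCompactOperator V) (z : ℂ)
    (hz : z ∉ spectrum ℂ A) (hz' : z ∈ spectrum ℂ (A + V)) :
    ∃ x, x ≠ 0 ∧ (A + V) x = z • x := by
  rw [spectrum.notMem_iff] at hz
  obtain ⟨U, hU⟩ := hz
  set R : E →L[ℂ] E := ((U⁻¹ : (E →L[ℂ] E)ˣ) : E →L[ℂ] E) with hR
  have hRV : IsCompactOperator (R * V) := hV.clm_comp R
  have hUR : (U : E →L[ℂ] E) * R = 1 := U.mul_inv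
  rcases hRV.hasEigenvalue_or_mem_resolventSet (one_ne_zero : (1 : ℂ) ≠ 0) with h | h
  · obtain ⟨x, hx⟩ := h.exists_hasEigenvector
    refine ⟨x, hx.2, ?_⟩
    have h1 : R (V x) = x := by simpa using hx.apply_eq_smul
    have h2 : (U : E →L[ℂ] E) x = V x := by
      have := congrArg (fun F : E →L[ℂ] E => F (V x)) hUR
      rw [← h1]
      simpa [h1] using this
    rw [hU] at h2
    have h3 : z • x - A x = V x := by simpa [Algebra.algebraMap_eq_smul_one] using h2
    rw [add_apply, ← h3]
    abel
  · exfalso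
    rw [spectrum.mem_iff] at hz'
    apply hz'
    rw [spectrum.mem_resolventSet_iff] at h
    have e : algebraMap ℂ (E →L[ℂ] E) z - (A + V)
        = (U : E →L[ℂ] E) * (algebraMap ℂ (E →L[ℂ] E) 1 - R * V) := by
      rw [mul_sub, ← mul_assoc, hUR, hU, map_one]
      simp only [mul_one, one_mul]
      abel
    rw [e]
    exact U.isUnit.mul h

end generic

section
variable {H : Type*} [NormedAddCommGroup H] [InnerProductSpace ℂ H] [CompleteSpace H]

lemma Q_symm (Q : L2 H →L[ℂ] L2 H) (ε : ℝ) (hε : ε ^ 2 = 1)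
    (hQ : ∀ (φ : L2 H) (n : ℤ),
      (Q φ) n = (2 : ℂ) • φ n - (ε : ℂ) • φ (n + 1) - (ε : ℂ) • φ (n - 1)) (φ ψ : L2 H) :
    inner ℂ (Q φ) ψ = inner ℂ φ (Q ψ) := by
  have h1 := form_hasSum Q ε hε hQ φ ψ
  have h2 := (form_hasSum Q ε hε hQ ψ φ).mapL Complex.conjCLE.toContinuousLinearMap
  have h3 : HasSum (fun n => inner ℂ (φ (n + 1) - (ε : ℂ) • φ n) (ψ (n + 1) - (ε : ℂ) • ψ n))
      (inner ℂ φ (Q ψ)) := by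
    rw [← inner_conj_symm]
    refine HasSum.congr_fun h2 fun n => ?_
    exact (inner_conj_symm _ _).symm
  exact h1.unique h3

lemma Q_spec (Q : L2 H →L[ℂ] L2 H) (ε : ℝ) (hε : ε ^ 2 = 1)
    (hQ : ∀ (φ : L2 H) (n : ℤ),
      (Q φ) n = (2 : ℂ) • φ n - (ε : ℂ) • φ (n + 1) - (ε : ℂ) • φ (n - 1)) (t : ℝ) (ht : t < 0) :
    (t : ℂ) ∉ spectrum ℂ Q := by
  intro h
  have hpos : 0 ≤ Q := by
    rw [ContinuousLinearMap.nonneg_iff_isPositive]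
    refine ⟨fun φ ψ => Q_symm Q ε hε hQ φ ψ, fun φ => ?_⟩
    have := (form_hasSum Q ε hε hQ φ φ).mapL Complex.reCLM
    refine HasSum.nonneg (fun n => ?_) this
    exact inner_self_nonneg (𝕜 := ℂ)
  have h2 := spectrum_nonneg_of_nonneg hpos (spectrum.of_algebraMap_mem ℂ (r := t) h)
  linarith

variable {K : Submodule ℂ H} [FiniteDimensional ℂ K]
  {v : ℤ → ℤ → H →L[ℂ] H} {C r : ℝ} {V : L2 H →L[ℂ] L2 H}

/-- Finite-rank observation of a sequence at the sites of `s`. -/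
noncomputable def obs (K : Submodule ℂ H) [FiniteDimensional ℂ K] (s : Finset ℤ) :
    L2 H →ₗ[ℂ] (s → K) where
  toFun φ n := K.orthogonalProjectionOnto (φ n)
  map_add' φ ψ := by ext1 n; exact map_add _ _ _
  map_smul' c φ := by ext1 n; exact map_smul _ _ _

lemma obs_zero {s : Finset ℤ} {φ : L2 H} (h : obs K s φ = 0) :
    ∀ n ∈ s, K.starProjection (φ n) = 0 := by
  intro n hn
  have := congrFun h ⟨n, hn⟩
  rw [Submodule.starProjection_apply]
  have h2 : K.orthogonalProjectionOnto (φ n) = 0 := this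
  rw [h2]; rfl

lemma embedded_finite (B : L2 H →L[ℂ] L2 H) (hB : ∀ x y, inner ℂ (B x) y = inner ℂ x (B y))
    (s : Finset ℤ) (hs : ∀ t : ℝ, 0 ≤ t → t ≤ 4 → ∀ φ : L2 H, B φ = (t : ℂ) • φ →
      (∀ n, φ n ∈ K) ∧ ‖φ‖ ^ 2 ≤ 2 * ∑ n ∈ s, ‖φ n‖ ^ 2) :
    Set.Finite {t : ℝ | (0 ≤ t ∧ t ≤ 4) ∧ ∃ x, x ≠ 0 ∧ B x = (t : ℂ) • x} := by
  set S := {t : ℝ | (0 ≤ t ∧ t ≤ 4) ∧ ∃ x, x ≠ 0 ∧ B x = (t : ℂ) • x} with hS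
  have hch : ∀ t : S, ∃ x, ‖x‖ = 1 ∧ B x = ((t : ℝ) : ℂ) • x := by
    intro t
    obtain ⟨x, hx0, hx⟩ := t.2.2
    refine ⟨((‖x‖⁻¹ : ℝ) : ℂ) • x, ?_, ?_⟩
    · rw [norm_smul]
      simp [hx0]
    · rw [map_smul, hx, smul_comm]
  choose f hf1 hf using hch
  have hon : Orthonormal ℂ f := by
    refine ⟨hf1, fun a b hab => ?_⟩
    exact eig_orth B hB (fun e => hab (Subtype.ext e)) (hf a) (hf b)
  let b := stdOrthonormalBasis ℂ K
  set M := Module.finrank ℂ K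
  have hcard : ∀ u : Finset S, (u.card : ℝ) ≤ 2 * (s.card * M) := by
    intro u
    have h1 : (u.card : ℝ) ≤ ∑ t ∈ u, 2 * ∑ n ∈ s, ‖f t n‖ ^ 2 := by
      calc (u.card : ℝ) = ∑ t ∈ u, (1 : ℝ) := by simp
        _ ≤ _ := Finset.sum_le_sum fun t _ => by
          have := (hs t t.2.1.1 t.2.1.2 (f t) (hf t)).2
          rw [hf1] at this
          simpa using this
    have h2 : ∀ t n, ‖f t n‖ ^ 2 = ∑ i, ‖inner ℂ (f t) (lp.single (E := fun _ : ℤ => H) 2 n (b i : H))‖ ^ 2 := by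
      intro t n
      have hm := (hs t t.2.1.1 t.2.1.2 (f t) (hf t)).1 n
      have h3 := b.sum_sq_norm_inner_right ⟨f t n, hm⟩
      rw [Submodule.coe_norm] at h3
      simp only at h3
      rw [← h3]
      refine Finset.sum_congr rfl fun i _ => ?_
      rw [lp.inner_single_right, norm_inner_symm]
      rfl
    have h4 : ∑ t ∈ u, ∑ n ∈ s, ‖f t n‖ ^ 2 ≤ s.card * M := by
      simp only [h2]
      rw [Finset.sum_comm]
      calc _ ≤ ∑ n ∈ s, (M : ℝ) := Finset.sum_le_sum fun n _ => by
            rw [Finset.sum_comm]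
            calc _ ≤ ∑ i : Fin M, (1 : ℝ) := Finset.sum_le_sum fun i _ => by
                  refine (hon.sum_inner_products_le _).trans ?_
                  rw [lp.norm_single (by norm_num)]
                  have : ‖(b i : H)‖ = 1 := b.orthonormal.1 i
                  rw [this]; norm_num
              _ = M := by simp
        _ = _ := by simp
    rw [← Finset.mul_sum] at h1
    linarith
  by_contra hinf
  have : Infinite S := Set.infinite_coe_iff.2 hinf
  obtain ⟨u, hu⟩ := Infinite.exists_subset_card_eq S (2 * (s.card * M) + 1)
  have := hcard u
  rw [hu] at this
  push_cast at this
  linarith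

theorem core (h : Pot K v C r V) (H0 : L2 H →L[ℂ] L2 H)
    (hH0 : ∀ (φ : L2 H) (n : ℤ), (H0 φ) n = (2 : ℂ) • φ n - φ (n + 1) - φ (n - 1))
    (hVsa : IsSelfAdjoint V) :
    Set.Finite (spectrum ℂ (H0 + V) \
      {z : ℂ | ∃ t : ℝ, t ∈ Set.Icc (0 : ℝ) 4 ∧ z = (t : ℂ)}) ∧
    Set.Finite {z : ℂ | (∃ t : ℝ, t ∈ Set.Icc (0 : ℝ) 4 ∧ z = (t : ℂ)) ∧
      ∃ φ : L2 H, φ ≠ 0 ∧ (H0 + V) φ = z • φ} ∧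
    ∀ z : ℂ, (∃ φ : L2 H, φ ≠ 0 ∧ (H0 + V) φ = z • φ) →
      FiniteDimensional ℂ
        (LinearMap.ker (H0 + V - z • (1 : L2 H →L[ℂ] L2 H)).toLinearMap) := by
  have hQ1 : ∀ (φ : L2 H) (n : ℤ),
      (H0 φ) n = (2 : ℂ) • φ n - ((1 : ℝ) : ℂ) • φ (n + 1) - ((1 : ℝ) : ℂ) • φ (n - 1) := by
    intro φ n; rw [hH0]; simp
  set Q : L2 H →L[ℂ] L2 H := (4 : ℂ) • (1 : L2 H →L[ℂ] L2 H) - H0 with hQdef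
  have hQ2 : ∀ (φ : L2 H) (n : ℤ),
      (Q φ) n = (2 : ℂ) • φ n - ((-1 : ℝ) : ℂ) • φ (n + 1) - ((-1 : ℝ) : ℂ) • φ (n - 1) := by
    intro φ n
    have : (Q φ) n = (4 : ℂ) • φ n - (H0 φ) n := rfl
    rw [this, hH0, show (4 : ℂ) = 2 + 2 by norm_num, add_smul]
    simp only [Complex.ofReal_neg, Complex.ofReal_one, neg_smul, one_smul]
    abel
  have hVs : ∀ x y, inner ℂ (V x) y = inner ℂ x (V y) := fun x y =>
    (ContinuousLinearMap.isSelfAdjoint_iff_isSymmetric.1 hVsa) x y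
  have hH0s := Q_symm H0 1 (by norm_num) hQ1
  have hBs : ∀ x y, inner ℂ ((H0 + V) x) y = inner ℂ x ((H0 + V) y) := by
    intro x y
    simp only [add_apply, inner_add_left, inner_add_right, hH0s, hVs]
  have hQs := Q_symm Q (-1) (by norm_num) hQ2
  have hBs' : ∀ x y, inner ℂ ((Q - V) x) y = inner ℂ x ((Q - V) y) := by
    intro x y
    simp only [sub_apply, inner_sub_left, inner_sub_right, hQs, hVs]
  have hsa : IsSelfAdjoint (H0 + V) :=
    ContinuousLinearMap.isSelfAdjoint_iff_isSymmetric.2 hBs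
  obtain ⟨s, hs⟩ := h.form_bound
  obtain ⟨s', hs'⟩ := h.embedded H0 hH0
  have hT1 : ∀ x, obs K s x = 0 → 0 ≤ (inner ℂ ((H0 + V) x) x).re := by
    intro x hx
    have := hs 1 H0 (Or.inl rfl) hQ1 x (obs_zero hx)
    rw [add_apply, inner_add_left, Complex.add_re]
    linarith [(abs_le.1 this).1]
  have hT2 : ∀ x, obs K s x = 0 → 0 ≤ (inner ℂ ((Q - V) x) x).re := by
    intro x hx
    have := hs (-1) Q (Or.inr rfl) hQ2 x (obs_zero hx)
    rw [sub_apply, inner_sub_left, Complex.sub_re]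
    linarith [(abs_le.1 this).2]
  have hflip : ∀ (t : ℝ) x, (H0 + V) x = (t : ℂ) • x → (Q - V) x = ((4 - t : ℝ) : ℂ) • x := by
    intro t x hx
    have e : (Q - V) x = (4 : ℂ) • x - (H0 + V) x := by
      simp only [hQdef, sub_apply, smul_apply,
        one_apply_eq_self, add_apply]
      abel
    rw [e, hx, ← sub_smul]
    push_cast
    rfl
  refine ⟨?_, ?_, ?_⟩
  · have f1 := neg_finite (H0 + V) hBs (obs K s) hT1
    have f2 := neg_finite (Q - V) hBs' (obs K s) hT2
    refine ((f1.image (fun t : ℝ => (t : ℂ))).union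
      (f2.image (fun t : ℝ => ((4 - t : ℝ) : ℂ)))).subset ?_
    rintro z ⟨hz, hz'⟩
    have hre := hsa.mem_spectrum_eq_re hz
    generalize z.re = t at hre
    subst hre
    have ht : t < 0 ∨ 4 < t := by
      by_contra hcon
      push Not at hcon
      exact hz' ⟨t, hcon, rfl⟩
    have hnot : (t : ℂ) ∉ spectrum ℂ H0 := by
      rcases ht with ht | ht
      · exact Q_spec H0 1 (by norm_num) hQ1 t ht
      · have h1 := Q_spec Q (-1) (by norm_num) hQ2 (4 - t) (by linarith)
        rw [spectrum.notMem_iff] at h1 ⊢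
        have e : algebraMap ℂ (L2 H →L[ℂ] L2 H) (t : ℂ) - H0
            = -(algebraMap ℂ (L2 H →L[ℂ] L2 H) ((4 - t : ℝ) : ℂ) - Q) := by
          rw [hQdef, Algebra.algebraMap_eq_smul_one, Algebra.algebraMap_eq_smul_one]
          push_cast
          rw [sub_smul]
          abel
        rw [e]
        exact h1.neg
    obtain ⟨x, hx0, hx⟩ := spec_eig H0 V h.compact _ hnot hz
    rcases ht with ht | ht
    · left
      exact ⟨t, ⟨ht, x, hx0, hx⟩, rfl⟩
    · right
      refine ⟨4 - t, ⟨by linarith, x, hx0, hflip t x hx⟩, ?_⟩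
      simp
  · have f := embedded_finite (K := K) (H0 + V) hBs s' hs'
    refine (f.image (fun t : ℝ => (t : ℂ))).subset ?_
    rintro z ⟨⟨t, ht, rfl⟩, x, hx0, hx⟩
    exact ⟨t, ⟨ht, x, hx0, hx⟩, rfl⟩
  · rintro z ⟨φ, hφ0, hφ⟩
    have hre := eig_real (H0 + V) hBs hφ0 hφ
    generalize z.re = t at hre
    subst hre
    rcases lt_or_ge t 0 with ht | ht
    · exact ker_fin (H0 + V) t (obs K s) fun x hx hTx => neg_ker (H0 + V) _ hT1 t ht x hx hTx
    rcases lt_or_ge 4 t with ht4 | ht4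
    · exact ker_fin (H0 + V) t (obs K s) fun x hx hTx =>
        neg_ker (Q - V) _ hT2 (4 - t) (by linarith) x (hflip t x hx) hTx
    · refine ker_fin (H0 + V) t (obs K s') fun x hx hTx => ?_
      obtain ⟨hm, hn⟩ := hs' t ht ht4 x hx
      have h0 := obs_zero hTx
      rw [Finset.sum_eq_zero fun n hn => by
        rw [← Submodule.starProjection_eq_self_iff.2 (hm n), h0 n hn]; simp] at hn
      have : ‖x‖ ^ 2 = 0 := le_antisymm (by simpa using hn) (sq_nonneg _)
      simpa using this

end
lemma exists_pot {H : Type*} [NormedAddCommGroup H] [InnerProductSpace ℂ H] [CompleteSpace H]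
    (γ C : ℝ) (hγ : 0 < γ) (hC : 0 < C)
    (w : ℤ × ℤ → H →L[ℂ] H)
    (hw : ∀ n m : ℤ, ‖w (n, m)‖ ≤ C * Real.exp (-γ * (|(n : ℝ)| + |(m : ℝ)|)))
    (Λ₁ Λ₂ : H →L[ℂ] H)
    (hfin : FiniteDimensional ℂ (LinearMap.range (Λ₂ ∘L Λ₁).toLinearMap))
    (V : L2 H →L[ℂ] L2 H)
    (hV : ∀ (φ : L2 H) (n : ℤ),
      HasSum (fun m : ℤ => Λ₁ (w (n, m) (Λ₂ (φ m)))) ((V φ) n))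
    (hVsa : IsSelfAdjoint V) :
    ∃ (K : Submodule ℂ H) (_ : FiniteDimensional ℂ K) (v : ℤ → ℤ → H →L[ℂ] H) (C' r : ℝ),
      Pot K v C' r V := by
  let v : ℤ → ℤ → H →L[ℂ] H := fun n m => Λ₁.comp ((w (n, m)).comp Λ₂)
  have hv : ∀ n m x, v n m x = Λ₁ (w (n, m) (Λ₂ x)) := fun _ _ _ => rfl
  have hsingle : ∀ n m x, V (lp.single (E := fun _ : ℤ => H) 2 m x) n = v n m x := by
    intro n m x
    have h1 := hV (lp.single (E := fun _ : ℤ => H) 2 m x) n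
    have h2 : HasSum (fun j : ℤ => Λ₁ (w (n, j) (Λ₂ ((lp.single (E := fun _ : ℤ => H) 2 m x) j))))
        (Λ₁ (w (n, m) (Λ₂ ((lp.single (E := fun _ : ℤ => H) 2 m x) m)))) := by
      refine hasSum_single m fun j hj => ?_
      rw [lp.single_apply_ne _ _ _ hj]
      simp
    rw [lp.single_apply_self] at h2
    exact h1.unique h2
  have hsym : ∀ n m x y, inner ℂ (v n m x) y = inner ℂ x (v m n y) := by
    intro n m x y
    have h1 := (ContinuousLinearMap.isSelfAdjoint_iff_isSymmetric.1 hVsa)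
      (lp.single (E := fun _ : ℤ => H) 2 m x) (lp.single (E := fun _ : ℤ => H) 2 n y)
    have h2 : inner ℂ (V (lp.single (E := fun _ : ℤ => H) 2 m x)) (lp.single (E := fun _ : ℤ => H) 2 n y)
      = inner ℂ (lp.single (E := fun _ : ℤ => H) 2 m x) (V (lp.single (E := fun _ : ℤ => H) 2 n y)) := h1
    rw [lp.inner_single_right, lp.inner_single_left, hsingle, hsingle] at h2
    exact h2
  let K : Submodule ℂ H := LinearMap.range Λ₁.toLinearMap ⊓ (LinearMap.ker Λ₂.toLinearMap)ᗮ
  have hK : FiniteDimensional ℂ K := by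
    let g : K →ₗ[ℂ] LinearMap.range (Λ₂ ∘L Λ₁).toLinearMap :=
      (Λ₂.toLinearMap.domRestrict K).codRestrict _ (by
        rintro ⟨x, ⟨y, rfl⟩, -⟩
        exact ⟨y, rfl⟩)
    refine FiniteDimensional.of_injective g ?_
    rw [← LinearMap.ker_eq_bot, LinearMap.ker_eq_bot']
    rintro ⟨x, hx1, hx2⟩ hgx
    have h1 : Λ₂ x = 0 := congrArg Subtype.val hgx
    have h2 := hx2 x h1
    exact Subtype.ext (inner_self_eq_zero.1 h2)
  have hvK : ∀ n m x, v n m x ∈ K := by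
    intro n m x
    refine ⟨⟨_, rfl⟩, fun y hy => ?_⟩
    have hy' : Λ₂ y = 0 := hy
    rw [← hsym m n, hv, hy']
    simp
  have hr : ∀ n : ℤ, Real.exp (-γ * |(n : ℝ)|) = Real.exp (-γ) ^ n.natAbs := by
    intro n
    rw [← Real.exp_nat_mul, Nat.cast_natAbs, mul_comm]
    simp
  have hL : 0 ≤ ‖Λ₁‖ * ‖Λ₂‖ * C := by positivity
  refine ⟨K, hK, v, ‖Λ₁‖ * ‖Λ₂‖ * C + 1, Real.exp (-γ), by positivity, Real.exp_pos _,
    by rw [Real.exp_lt_one_iff]; linarith, ?_, hvK, ?_, hV⟩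
  · intro n m
    have h1 := hw n m
    rw [mul_add, Real.exp_add, hr, hr] at h1
    have hp : 0 ≤ Real.exp (-γ) ^ n.natAbs * Real.exp (-γ) ^ m.natAbs := by positivity
    calc ‖v n m‖ ≤ ‖Λ₁‖ * (‖w (n, m)‖ * ‖Λ₂‖) :=
          (ContinuousLinearMap.opNorm_comp_le _ _).trans
            (mul_le_mul_of_nonneg_left (ContinuousLinearMap.opNorm_comp_le _ _) (norm_nonneg _))
      _ ≤ ‖Λ₁‖ * ((C * (Real.exp (-γ) ^ n.natAbs * Real.exp (-γ) ^ m.natAbs)) * ‖Λ₂‖) := by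
          gcongr
      _ = (‖Λ₁‖ * ‖Λ₂‖ * C) * (Real.exp (-γ) ^ n.natAbs * Real.exp (-γ) ^ m.natAbs) := by ring
      _ ≤ _ := by
          refine mul_le_mul_of_nonneg_right ?_ hp
          linarith
  · intro n m x hx
    rw [← inner_self_eq_zero (𝕜 := ℂ), hsym]
    exact (Submodule.mem_orthogonal' _ _).1 hx _ (hvK _ _ _)

/-- (Corollary 2.5/`c1s` of the paper.) With the data of Statement 17 and
`V` selfadjoint, for `H_V = H₀ + V`: (i) `σ(H_V) \ [0,4]` is finite; (ii) the set of
eigenvalues of `H_V` in `[0,4]` is finite; (iii) every eigenvalue of `H_V` has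
finite-dimensional eigenspace. -/
theorem selfadjoint_finite_spectrum_and_embedded_eigenvalues
    (H : Type*) [NormedAddCommGroup H] [InnerProductSpace ℂ H] [CompleteSpace H]
    [Nontrivial H] [TopologicalSpace.SeparableSpace H]
    (γ C : ℝ) (hγ : 0 < γ) (hC : 0 < C)
    (w : ℤ × ℤ → H →L[ℂ] H)
    (hw : ∀ n m : ℤ, ‖w (n, m)‖ ≤ C * Real.exp (-γ * (|(n : ℝ)| + |(m : ℝ)|)))
    (Λ₁ Λ₂ : H →L[ℂ] H) (hΛ₂ : IsCompactOperator Λ₂)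
    (hfin : FiniteDimensional ℂ (LinearMap.range (Λ₂ ∘L Λ₁).toLinearMap))
    (H0 V : lp (fun _ : ℤ => H) 2 →L[ℂ] lp (fun _ : ℤ => H) 2)
    (hH0 : ∀ (φ : lp (fun _ : ℤ => H) 2) (n : ℤ),
      (H0 φ) n = (2 : ℂ) • φ n - φ (n + 1) - φ (n - 1))
    (hV : ∀ (φ : lp (fun _ : ℤ => H) 2) (n : ℤ),
      HasSum (fun m : ℤ => Λ₁ (w (n, m) (Λ₂ (φ m)))) ((V φ) n))
    (hVsa : IsSelfAdjoint V) :
    Set.Finite (spectrum ℂ (H0 + V) \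
      {z : ℂ | ∃ t : ℝ, t ∈ Set.Icc (0 : ℝ) 4 ∧ z = (t : ℂ)}) ∧
    Set.Finite {z : ℂ | (∃ t : ℝ, t ∈ Set.Icc (0 : ℝ) 4 ∧ z = (t : ℂ)) ∧
      ∃ φ : lp (fun _ : ℤ => H) 2, φ ≠ 0 ∧ (H0 + V) φ = z • φ} ∧
    ∀ z : ℂ, (∃ φ : lp (fun _ : ℤ => H) 2, φ ≠ 0 ∧ (H0 + V) φ = z • φ) →
      FiniteDimensional ℂ
        (LinearMap.ker (H0 + V - z • (1 : lp (fun _ : ℤ => H) 2 →L[ℂ] lp (fun _ : ℤ => H) 2)).toLinearMap) := by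
  obtain ⟨K, hK, v, C', r, h⟩ := exists_pot γ C hγ hC w hw Λ₁ Λ₂ hfin V hV hVsa
  exact core h H0 hH0 hVsa
end
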